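/- Let k be a number field of degree 7 over ℚ having exactly 5 real infinite places (and 1 complex place), and suppose its regulator satisfies R_k ≤ 3.2. Then the discriminant D_k of k satisfies |D_k| < 3 030 000. -/

import Mathlib

section
namespace RegB
open MeasureTheory Set Filter Topology

/-- cast of integer vector -/
noncomputable def ic {n : ℕ} (m : Fin n → ℤ) : Fin n → ℝ := fun i => (m i : ℝ)

lemma ic_add {n : ℕ} (m k : Fin n → ℤ) : ic (m + k) = ic m + ic k := by
  ext i; simp [ic]

theorem poisson_gen {n : ℕ} (φ : (Fin n → ℝ) → ℂ) (hc : Continuous φ) (hi : Integrable φ)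
    (hb : ∀ r : ℝ, ∃ b : (Fin n → ℤ) → ℝ, Summable b ∧ ∀ x, ‖x‖ ≤ r → ∀ m, ‖φ (x + ic m)‖ ≤ b m)
    (ψ : (Fin n → ℤ) → ℂ) (hψs : Summable ψ)
    (hψ : ∀ k : Fin n → ℤ, ∫ x : Fin n → ℝ, UnitAddTorus.mFourier (-k) (fun i => (x i : UnitAddCircle)) * φ x = ψ k) :
    HasSum ψ (∑' m : Fin n → ℤ, φ (ic m)) := by
  set Φ : (Fin n → ℝ) → ℂ := fun x => ∑' m : Fin n → ℤ, φ (x + ic m) with hΦ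
  have hcΦ : Continuous Φ := by
    rw [continuous_iff_continuousAt]
    intro x0
    obtain ⟨b, hbs, hbb⟩ := hb (‖x0‖ + 1)
    have : ContinuousOn Φ (Metric.ball 0 (‖x0‖ + 1)) := by
      apply continuousOn_tsum (u := b) _ hbs
      · intro m x hx
        exact hbb x (by have := Metric.mem_ball.1 hx; rw [dist_zero_right] at this; exact this.le) m
      · intro m
        fun_prop
    exact this.continuousAt (Metric.isOpen_ball.mem_nhds (by simp))
  have hper : ∀ x (k : Fin n → ℤ), Φ (x + ic k) = Φ x := by
    intro x k
    simp only [hΦ]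
    rw [← (Equiv.addLeft k).tsum_eq (fun m => φ (x + ic m))]
    congr 1; ext m
    simp [ic_add, add_assoc]
  have hq : IsOpenQuotientMap (Pi.map (fun (_ : Fin n) (x : ℝ) => (x : UnitAddCircle))) :=
    IsOpenQuotientMap.piMap (fun i => QuotientAddGroup.isOpenQuotientMap_mk)
  set s : UnitAddTorus (Fin n) → (Fin n → ℝ) := Function.surjInv hq.surjective with hs
  have hsπ : ∀ t, Pi.map (fun (_ : Fin n) (x : ℝ) => (x : UnitAddCircle)) (s t) = t :=
    Function.surjInv_eq hq.surjective
  have hF : ∀ x : Fin n → ℝ, Φ (s (fun i => (x i : UnitAddCircle))) = Φ x := by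
    intro x
    have h1 := hsπ (fun i => (x i : UnitAddCircle))
    have h2 : ∀ i, ∃ k : ℤ, s (fun i => (x i : UnitAddCircle)) i = x i + k := by
      intro i
      have h3 := congrFun h1 i
      simp only [Pi.map_apply] at h3
      have h4 : ((s (fun i => (x i : UnitAddCircle)) i - x i : ℝ) : UnitAddCircle) = 0 := by
        rw [AddCircle.coe_sub, h3, sub_self]
      obtain ⟨k, hk⟩ := AddCircle.coe_eq_zero_iff (p := (1:ℝ)) |>.1 h4
      exact ⟨k, by simp at hk; linarith⟩
    choose k hk using h2
    have : s (fun i => (x i : UnitAddCircle)) = x + ic k := by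
      ext i; simp [ic, hk]
    rw [this, hper]
  let F : C(UnitAddTorus (Fin n), ℂ) := ⟨Φ ∘ s, by
    rw [← hq.continuous_comp_iff]
    have : (Φ ∘ s) ∘ Pi.map (fun (_ : Fin n) (x : ℝ) => (x : UnitAddCircle)) = Φ := by
      ext x; exact hF x
    rw [this]; exact hcΦ⟩
  have hcoef : ∀ k, UnitAddTorus.mFourierCoeff F k = ψ k := by
    intro k
    rw [UnitAddTorus.mFourierCoeff_eq_integral F k 0, ← hψ k]
    have hmc : Continuous (fun x : Fin n → ℝ => UnitAddTorus.mFourier (-k) (fun i => (x i : UnitAddCircle))) := by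
      apply (UnitAddTorus.mFourier (-k)).continuous.comp
      exact continuous_pi fun i => (AddCircle.continuous_mk' 1).comp (continuous_apply i)
    have hmn : ∀ y, ‖UnitAddTorus.mFourier (-k) y‖ ≤ 1 := by
      intro y
      have := (UnitAddTorus.mFourier (-k)).norm_coe_le_norm y
      rwa [UnitAddTorus.mFourier_norm] at this
    set g : (Fin n → ℝ) → ℂ := fun x => UnitAddTorus.mFourier (-k) (fun i => (x i : UnitAddCircle)) * φ x with hg
    have hgi : Integrable g := by
      apply hi.bdd_mul (c := 1) hmc.aestronglyMeasurable
      exact Eventually.of_forall (fun x => hmn _)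
    set S : (Fin n → ℤ) → Set (Fin n → ℝ) := fun m => {x | ∀ i, x i ∈ Ioc (m i : ℝ) (m i + 1)} with hS
    have hSm : ∀ m, MeasurableSet (S m) := fun m => MeasurableSet.univ_pi' (fun i => measurableSet_Ioc)
    have hSU : ⋃ m, S m = univ := by
      ext x
      simp only [mem_iUnion, mem_univ, iff_true]
      refine ⟨fun i => ⌈x i⌉ - 1, fun i => ?_⟩
      push_cast
      constructor
      · have := Int.ceil_lt_add_one (x i); linarith
      · have := Int.le_ceil (x i); linarith
    have hSd : Pairwise (Function.onFun Disjoint S) := by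
      intro a b hab
      rw [Function.onFun, Set.disjoint_left]
      intro x hxa hxb
      apply hab
      ext i
      have h1 := hxa i
      have h2 := hxb i
      have e1 : (a i : ℝ) < b i + 1 := h1.1.trans_le h2.2
      have e2 : (b i : ℝ) < a i + 1 := h2.1.trans_le h1.2
      have e1' : a i < b i + 1 := by exact_mod_cast e1
      have e2' : b i < a i + 1 := by exact_mod_cast e2
      omega
    have H1 : HasSum (fun m => ∫ x in S m, g x) (∫ x, g x) := by
      have := hasSum_integral_iUnion (f := g) (μ := volume) hSm hSd hgi.integrableOn
      rwa [hSU, setIntegral_univ] at this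
    have hgper : ∀ x (m : Fin n → ℤ), g (x + ic m) =
        UnitAddTorus.mFourier (-k) (fun i => (x i : UnitAddCircle)) * φ (x + ic m) := by
      intro x m
      simp only [hg]
      congr 2
      ext i
      simp [ic]
    have H2 : ∀ m, ∫ x in S m, g x = ∫ x in S 0, g (x + ic m) := by
      intro m
      have := (measurePreserving_add_right (volume : Measure (Fin n → ℝ)) (ic m)).setIntegral_preimage_emb
        (MeasurableEquiv.addRight (ic m)).measurableEmbedding g (S m)
      rw [← this]
      congr 2
      ext x
      simp [hS, ic, add_comm _ (1:ℝ)]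
    have H3 : HasSum (fun m => ∫ x in S 0, g (x + ic m))
        (∫ x in S 0, UnitAddTorus.mFourier (-k) (fun i => (x i : UnitAddCircle)) * Φ x) := by
      obtain ⟨b, hbs, hbb⟩ := hb 1
      have hS0 : ∀ x ∈ S 0, ‖x‖ ≤ 1 := by
        intro x hx
        rw [pi_norm_le_iff_of_nonneg zero_le_one]
        intro i
        have := hx i
        simp at this
        rw [Real.norm_eq_abs, abs_le]; constructor <;> linarith
      have hvol : volume (S 0) < ⊤ := by
        refine lt_of_le_of_lt (measure_mono (t := Metric.closedBall 0 1) ?_) measure_closedBall_lt_top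
        intro x hx; simpa using hS0 x hx
      have : IsFiniteMeasure (volume.restrict (S 0)) := ⟨by simpa using hvol⟩
      apply hasSum_integral_of_dominated_convergence (fun m _ => b m)
      · intro m
        apply Continuous.aestronglyMeasurable
        simp_rw [hgper]
        exact hmc.mul (hc.comp (by fun_prop))
      · intro m
        filter_upwards [ae_restrict_mem (hSm 0)] with x hx
        rw [hgper, norm_mul]
        calc _ ≤ 1 * ‖φ (x + ic m)‖ := by gcongr; exact hmn _
          _ ≤ _ := by rw [one_mul]; exact hbb x (hS0 x hx) m
      · exact Eventually.of_forall fun _ => hbs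
      · exact integrable_const _
      · filter_upwards [ae_restrict_mem (hSm 0)] with x hx
        simp_rw [hgper]
        apply HasSum.mul_left
        exact (Summable.of_norm_bounded hbs (hbb x (hS0 x hx))).hasSum
    simp_rw [H2] at H1
    have h0 := H3.unique H1
    rw [← h0]
    have : {x : Fin n → ℝ | ∀ i, x i ∈ Ioc ((0 : Fin n → ℝ) i) ((0 : Fin n → ℝ) i + 1)} = S 0 := by
      simp [hS]
    rw [this]
    congr 1
    ext x
    simp only [smul_eq_mul]
    congr 1
    exact hF x
  have hco : UnitAddTorus.mFourierCoeff F = ψ := funext hcoef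
  have := UnitAddTorus.hasSum_mFourier_series_apply_of_summable (f := F) (by rw [hco]; exact hψs) 0
  rw [hco] at this
  have e1 : F 0 = ∑' m : Fin n → ℤ, φ (ic m) := by
    have := hF 0
    have h0 : F 0 = Φ 0 := by
      simp only [Pi.zero_apply] at this
      exact this
    rw [h0, hΦ]; simp
  rw [e1] at this
  convert this using 2 with k
  have : UnitAddTorus.mFourier k 0 = 1 := by simp [UnitAddTorus.mFourier]
  rw [this]; simp
end RegB
end

section
namespace RegB
open MeasureTheory Set Filter Topology Matrix

lemma summable_prod_fin {g : ℤ → ℝ} (hg0 : ∀ k, 0 ≤ g k) (hg : Summable g) (n : ℕ) :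
    Summable (fun m : Fin n → ℤ => ∏ i, g (m i)) := by
  induction n with
  | zero => exact (hasSum_fintype _).summable
  | succ n ih =>
    rw [← (Fin.consEquiv (fun _ : Fin (n+1) => ℤ)).summable_iff]
    have := hg.mul_of_nonneg ih hg0 (fun m => Finset.prod_nonneg fun i _ => hg0 _)
    convert this using 2 with x
    simp [Fin.prod_univ_succ, Fin.consEquiv]

lemma summable_gauss (n : ℕ) {c : ℝ} (hc : 0 < c) :
    Summable (fun m : Fin n → ℤ => Real.exp (-c * ∑ i, (m i : ℝ)^2)) := by
  have h := summable_pow_mul_jacobiTheta₂_term_bound 0 (T := c / Real.pi) (by positivity) 0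
  have h2 : Summable (fun k : ℤ => Real.exp (-c * (k:ℝ)^2)) := by
    convert h using 2 with k
    rw [pow_zero, one_mul]
    congr 1
    field_simp
    ring
  have := summable_prod_fin (fun k => (Real.exp_pos _).le) h2 n
  convert this using 2 with m
  rw [← Real.exp_sum, Finset.mul_sum]

lemma exists_lower {n : ℕ} (B : Matrix (Fin n) (Fin n) ℝ) (hB : B.det ≠ 0) :
    ∃ c > 0, ∀ x : Fin n → ℝ, c * ∑ i, (x i)^2 ≤ ∑ i, ((B *ᵥ x) i)^2 := by
  set C := ∑ i, ∑ j, (B⁻¹ i j)^2 with hC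
  have hC0 : 0 ≤ C := by positivity
  refine ⟨(C+1)⁻¹, by positivity, fun x => ?_⟩
  have hx : x = B⁻¹ *ᵥ (B *ᵥ x) := by
    rw [mulVec_mulVec, nonsing_inv_mul _ (isUnit_iff_ne_zero.2 hB), one_mulVec]
  set y := B *ᵥ x
  rw [inv_mul_le_iff₀ (by positivity)]
  have : ∑ i, (x i)^2 ≤ C * ∑ i, (y i)^2 := by
    rw [hC, Finset.sum_mul]
    apply Finset.sum_le_sum
    intro i _
    have := Finset.sum_mul_sq_le_sq_mul_sq Finset.univ (fun j => B⁻¹ i j) y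
    rw [hx]
    exact this
  have h2 : 0 ≤ ∑ i, (y i)^2 := by positivity
  linarith

lemma sq_shift {n : ℕ} (x : Fin n → ℝ) (m : Fin n → ℤ) {r : ℝ} (hx : ‖x‖ ≤ r) :
    (1/2) * ∑ i, (m i:ℝ)^2 - n * r^2 ≤ ∑ i, ((x + ic m) i)^2 := by
  have : (n:ℝ) * r^2 = ∑ i : Fin n, r^2 := by simp
  rw [this, Finset.mul_sum, ← Finset.sum_sub_distrib]
  apply Finset.sum_le_sum
  intro i _
  have h1 : |x i| ≤ r := (norm_le_pi_norm x i).trans hx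
  have h2 : (x i)^2 ≤ r^2 := by
    rw [← sq_abs]; exact pow_le_pow_left₀ (abs_nonneg _) h1 2
  simp only [Pi.add_apply, ic]
  nlinarith [sq_nonneg (2 * x i + m i)]

theorem fourier_gauss {n : ℕ} (B : Matrix (Fin n) (Fin n) ℝ) (hB : B.det ≠ 0) (k : Fin n → ℤ) :
    ∫ x : Fin n → ℝ, UnitAddTorus.mFourier (-k) (fun i => (x i : UnitAddCircle)) *
      Complex.exp (-(Real.pi * ∑ i, ((B *ᵥ x) i)^2 : ℝ))
    = ((|B.det|⁻¹ * Real.exp (-(Real.pi * ∑ i, ((B⁻¹ᵀ *ᵥ ic k) i)^2)) : ℝ) : ℂ) := by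
  set w := B⁻¹ᵀ *ᵥ ic k with hw
  set f : (Fin n → ℝ) → ℂ := fun y => Complex.exp (-(Real.pi:ℂ) * ∑ i, (y i : ℂ)^2 + ∑ i, (-(2 * Real.pi * Complex.I * w i)) * y i) with hf
  have h1 : ∀ x : Fin n → ℝ, UnitAddTorus.mFourier (-k) (fun i => (x i : UnitAddCircle)) *
      Complex.exp (-(Real.pi * ∑ i, ((B *ᵥ x) i)^2 : ℝ)) = f (B *ᵥ x) := by
    intro x
    have hd : ∑ i, w i * (B *ᵥ x) i = ∑ i, (k i : ℝ) * x i := by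
      change w ⬝ᵥ (B *ᵥ x) = ic k ⬝ᵥ x
      rw [hw, mulVec_transpose, ← dotProduct_mulVec, mulVec_mulVec,
        nonsing_inv_mul _ (isUnit_iff_ne_zero.2 hB), one_mulVec]
    have hd' : ∑ i, (w i:ℂ) * ((B *ᵥ x) i : ℝ) = ∑ i, (k i : ℂ) * x i := by
      exact_mod_cast hd
    simp only [UnitAddTorus.mFourier, ContinuousMap.coe_mk, hf, fourier_coe_apply, Pi.neg_apply]
    rw [← Complex.exp_sum, ← Complex.exp_add]
    congr 1
    have : ∑ i, (-(2 * Real.pi * Complex.I * w i)) * ((B *ᵥ x) i : ℂ) = -(2 * Real.pi * Complex.I) * ∑ i, (w i:ℂ) * ((B *ᵥ x) i : ℝ) := by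
      rw [Finset.mul_sum]; apply Finset.sum_congr rfl; intros; ring
    rw [this, hd', Finset.mul_sum (s := Finset.univ) (f := fun i => (k i : ℂ) * x i)]
    push_cast
    rw [add_comm, neg_mul]
    congr 1
    apply Finset.sum_congr rfl; intros; ring
  simp_rw [h1]
  have hmp := Real.map_matrix_volume_pi_eq_smul_volume_pi hB
  have hcl : Continuous f := by fun_prop
  have h2 : ∫ x : Fin n → ℝ, f (B *ᵥ x) = ∫ y, f y ∂(Measure.map (toLin' B) volume) := by
    rw [integral_map]
    · simp
    · exact (LinearMap.continuous_of_finiteDimensional _).aemeasurable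
    · exact hcl.aestronglyMeasurable
  rw [h2, hmp, integral_smul_measure, hf, GaussianFourier.integral_cexp_neg_mul_sum_add (by simpa using Real.pi_pos)]
  have hpi : (Real.pi : ℂ) ≠ 0 := by exact_mod_cast Real.pi_ne_zero
  rw [div_self hpi, Complex.one_cpow, one_mul, ENNReal.toReal_ofReal (abs_nonneg _), Complex.real_smul]
  push_cast
  rw [abs_inv, Complex.ofReal_inv]
  congr 2
  rw [Finset.mul_sum, Finset.sum_div, ← Finset.sum_neg_distrib]
  apply Finset.sum_congr rfl
  intro i _
  rw [neg_sq, mul_pow, mul_pow, mul_pow, Complex.I_sq]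
  field_simp
  ring

theorem poisson_gauss {n : ℕ} (B : Matrix (Fin n) (Fin n) ℝ) (hB : B.det ≠ 0) :
    HasSum (fun k : Fin n → ℤ => |B.det|⁻¹ * Real.exp (-(Real.pi * ∑ i, ((B⁻¹ᵀ *ᵥ ic k) i)^2)))
      (∑' m : Fin n → ℤ, Real.exp (-(Real.pi * ∑ i, ((B *ᵥ ic m) i)^2))) := by
  have gs : ∀ (A : Matrix (Fin n) (Fin n) ℝ), A.det ≠ 0 → ∀ r : ℝ, ∃ b : (Fin n → ℤ) → ℝ, Summable b ∧
      ∀ x, ‖x‖ ≤ r → ∀ m, Real.exp (-(Real.pi * ∑ i, ((A *ᵥ (x + ic m)) i)^2)) ≤ b m := by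
    intro A hA r
    obtain ⟨c, hc, hcx⟩ := exists_lower A hA
    refine ⟨fun m => Real.exp (Real.pi * c * (n * r^2)) * Real.exp (-(Real.pi * c / 2) * ∑ i, (m i : ℝ)^2),
      (summable_gauss n (by positivity)).mul_left _, fun x hx m => ?_⟩
    beta_reduce
    rw [← Real.exp_add, Real.exp_le_exp]
    have h1 := hcx (x + ic m)
    have h2 := sq_shift x m hx
    have h3 : c * ((1/2) * ∑ i, (m i:ℝ)^2 - n * r^2) ≤ ∑ i, ((A *ᵥ (x + ic m)) i)^2 :=
      (mul_le_mul_of_nonneg_left h2 hc.le).trans h1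
    have h4 := mul_le_mul_of_nonneg_left h3 Real.pi_pos.le
    linarith
  have hBi : (B⁻¹ᵀ).det ≠ 0 := by
    rw [det_transpose, det_nonsing_inv]
    simpa using hB
  have hs : Summable (fun k : Fin n → ℤ => |B.det|⁻¹ * Real.exp (-(Real.pi * ∑ i, ((B⁻¹ᵀ *ᵥ ic k) i)^2))) := by
    apply Summable.mul_left
    obtain ⟨b, hb, hbb⟩ := gs _ hBi 0
    refine Summable.of_nonneg_of_le (fun k => (Real.exp_pos _).le) (fun k => ?_) hb
    simpa using hbb 0 (by simp) k
  have key := poisson_gen (n := n) (fun x => Complex.exp (-(Real.pi * ∑ i, ((B *ᵥ x) i)^2 : ℝ)))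
    (by
      have : Continuous fun x : Fin n → ℝ => B *ᵥ x := by fun_prop
      fun_prop) ?_ ?_ _ (Complex.ofRealCLM.summable hs) (fun k => fourier_gauss B hB k)
  · rw [← Complex.hasSum_ofReal]
    have e : ((∑' m : Fin n → ℤ, Real.exp (-(Real.pi * ∑ i, ((B *ᵥ ic m) i)^2)) : ℝ) : ℂ) =
        ∑' (m : Fin n → ℤ), Complex.exp (-(Real.pi * ∑ i, (B *ᵥ ic m) i ^ 2 : ℝ)) := by
      rw [Complex.ofReal_tsum]
      congr 1; ext m; push_cast; rfl
    rw [e]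
    exact key
  · obtain ⟨c, hc, hcx⟩ := exists_lower B hB
    have hint : Integrable (fun x : Fin n → ℝ => ∏ i, Real.exp (-(Real.pi * c) * (x i)^2)) :=
      Integrable.fintype_prod (f := fun (_ : Fin n) (t : ℝ) => Real.exp (-(Real.pi * c) * t^2)) (fun i => integrable_exp_neg_mul_sq (by positivity))
    refine hint.mono' ?_ ?_
    · apply Continuous.aestronglyMeasurable
      have : Continuous fun x : Fin n → ℝ => B *ᵥ x := by fun_prop
      fun_prop
    · refine Eventually.of_forall fun x => ?_
      rw [Complex.norm_exp, ← Real.exp_sum, Real.exp_le_exp]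
      have := mul_le_mul_of_nonneg_left (hcx x) Real.pi_pos.le
      rw [← Finset.mul_sum]
      simp only [Complex.neg_re, Complex.ofReal_re]
      linarith
  · intro r
    obtain ⟨b, hb, hbb⟩ := gs B hB r
    refine ⟨b, hb, fun x hx m => ?_⟩
    rw [Complex.norm_exp]
    simpa only [Complex.neg_re, Complex.ofReal_re] using hbb x hx m

open scoped MatrixOrder in
lemma posDef_factor {n : ℕ} (G : Matrix (Fin n) (Fin n) ℝ) (hG : G.PosDef) :
    ∃ B : Matrix (Fin n) (Fin n) ℝ, B.det ≠ 0 ∧ G = Bᵀ * B := by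
  refine ⟨CFC.sqrt G, ?_, ?_⟩
  · intro h
    have h1 := CFC.sqrt_mul_sqrt_self G hG.posSemidef.nonneg
    have h2 := hG.det_pos
    rw [← h1, det_mul, h] at h2
    simp at h2
  · have h1 := CFC.sqrt_mul_sqrt_self G hG.posSemidef.nonneg
    have h2 := (CFC.sqrt_nonneg G).posSemidef.isHermitian
    have h3 : (CFC.sqrt G)ᵀ = CFC.sqrt G := by
      rw [← conjTranspose_eq_transpose_of_trivial]; exact h2
    rw [h3, h1]

/-- theta series -/
noncomputable def theta {n : ℕ} (G : Matrix (Fin n) (Fin n) ℝ) : ENNReal :=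
  ∑' m : Fin n → ℤ, ENNReal.ofReal (Real.exp (-(Real.pi * (ic m ⬝ᵥ G *ᵥ ic m))))

lemma quad_factor {n : ℕ} (B : Matrix (Fin n) (Fin n) ℝ) (x : Fin n → ℝ) :
    x ⬝ᵥ (Bᵀ * B) *ᵥ x = ∑ i, ((B *ᵥ x) i)^2 := by
  rw [← mulVec_mulVec, dotProduct_mulVec, vecMul_transpose]
  simp [dotProduct, sq]

theorem theta_poisson {n : ℕ} (G : Matrix (Fin n) (Fin n) ℝ) (hG : G.PosDef) :
    theta G = ENNReal.ofReal (√G.det)⁻¹ * theta G⁻¹ := by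
  obtain ⟨B, hB, rfl⟩ := posDef_factor G hG
  have h := poisson_gauss B hB
  have hBi : (B⁻¹ᵀ).det ≠ 0 := by
    rw [det_transpose, det_nonsing_inv]
    simpa using hB
  have h1 : (Bᵀ * B)⁻¹ = (B⁻¹ᵀ)ᵀ * B⁻¹ᵀ := by
    rw [transpose_transpose, Matrix.mul_inv_rev, transpose_nonsing_inv]
  have h2 : (√(Bᵀ * B).det)⁻¹ = |B.det|⁻¹ := by
    rw [det_mul, det_transpose, Real.sqrt_mul_self_eq_abs]
  have h3 := poisson_gauss (B⁻¹ᵀ) hBi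
  have hs : Summable (fun m : Fin n → ℤ => Real.exp (-(Real.pi * ∑ i, ((B *ᵥ ic m) i)^2))) := by
    have := h3.summable
    rw [summable_mul_left_iff (by simpa using hBi)] at this
    have e : B⁻¹ᵀ⁻¹ᵀ = B := by
      rw [transpose_nonsing_inv, transpose_transpose, nonsing_inv_nonsing_inv]
      simpa using hB
    rw [e] at this
    exact this
  rw [theta, theta, h1, h2]
  simp_rw [quad_factor]
  rw [← ENNReal.tsum_mul_left]
  simp_rw [← ENNReal.ofReal_mul (inv_nonneg.2 (abs_nonneg B.det))]
  rw [← ENNReal.ofReal_tsum_of_nonneg (fun _ => (Real.exp_pos _).le) hs,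
    ← ENNReal.ofReal_tsum_of_nonneg (fun _ => by positivity) h.summable, h.tsum_eq]

lemma theta_lt_top {n : ℕ} (G : Matrix (Fin n) (Fin n) ℝ) {c : ℝ}
    (h : ∀ x : Fin n → ℝ, c * ∑ i, (x i)^2 ≤ x ⬝ᵥ G *ᵥ x) :
    theta G ≤ ∑' m : Fin n → ℤ, ENNReal.ofReal (Real.exp (-(Real.pi * c) * ∑ i, (m i : ℝ)^2)) := by
  apply ENNReal.tsum_le_tsum
  intro m
  apply ENNReal.ofReal_le_ofReal
  rw [Real.exp_le_exp]
  have := mul_le_mul_of_nonneg_left (h (ic m)) Real.pi_pos.le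
  simp only [ic] at this ⊢
  linarith

lemma gauss_tsum_lt_top (n : ℕ) {c : ℝ} (hc : 0 < c) :
    ∑' m : Fin n → ℤ, ENNReal.ofReal (Real.exp (-(Real.pi * c) * ∑ i, (m i : ℝ)^2)) < ⊤ := by
  rw [← ENNReal.ofReal_tsum_of_nonneg (fun _ => (Real.exp_pos _).le)
    (summable_gauss n (by positivity))]
  exact ENNReal.ofReal_lt_top

end RegB
end

section
open MeasureTheory Set Filter Topology Matrix NumberField
namespace RegB
section gram
variable {K : Type*} [Field K] [NumberField K] {n : ℕ}

noncomputable def gram (b : Fin n → K) (t : InfinitePlace K → ℝ) : Matrix (Fin n) (Fin n) ℝ :=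
  Matrix.of fun i j => (∑ φ : K →+* ℂ, (t (InfinitePlace.mk φ) : ℂ) * φ (b i) *
    (starRingEnd ℂ) (φ (b j))).re

/-- the quadratic form -/
noncomputable def qf (t : InfinitePlace K → ℝ) (x : K) : ℝ :=
  ∑ φ : K →+* ℂ, t (InfinitePlace.mk φ) * ‖φ x‖^2

noncomputable def conjEquiv : (K →+* ℂ) ≃ (K →+* ℂ) :=
  ⟨ComplexEmbedding.conjugate, ComplexEmbedding.conjugate,
    fun φ => by ext; simp, fun φ => by ext; simp⟩

lemma gram_ofReal (b : Fin n → K) (t : InfinitePlace K → ℝ) (i j : Fin n) :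
    ((gram b t i j : ℝ) : ℂ) = ∑ φ : K →+* ℂ, (t (InfinitePlace.mk φ) : ℂ) * φ (b i) *
    (starRingEnd ℂ) (φ (b j)) := by
  rw [gram, Matrix.of_apply, ← Complex.conj_eq_iff_re, map_sum]
  rw [← Equiv.sum_comp conjEquiv]
  apply Finset.sum_congr rfl
  intro φ _
  simp [conjEquiv, ComplexEmbedding.conjugate_coe_eq, InfinitePlace.mk_conjugate_eq]

lemma gram_quad (b : Fin n → K) (t : InfinitePlace K → ℝ) (y : Fin n → ℝ) :
    y ⬝ᵥ gram b t *ᵥ y = ∑ φ : K →+* ℂ, t (InfinitePlace.mk φ) * ‖∑ i, (y i : ℂ) * φ (b i)‖^2 := by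
  have h : ((y ⬝ᵥ gram b t *ᵥ y : ℝ) : ℂ) = ((∑ φ : K →+* ℂ, t (InfinitePlace.mk φ) *
      ‖∑ i, (y i : ℂ) * φ (b i)‖^2 : ℝ) : ℂ) := by
    simp only [dotProduct, mulVec, Complex.ofReal_sum, Complex.ofReal_mul, gram_ofReal,
      Complex.ofReal_pow]
    simp_rw [← Complex.mul_conj', map_sum, map_mul, Complex.conj_ofReal, Finset.sum_mul_sum,
      Finset.mul_sum, Finset.sum_mul]
    simp_rw [Finset.mul_sum]
    conv_lhs => enter [2, i]; rw [Finset.sum_comm]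
    rw [Finset.sum_comm]
    refine Finset.sum_congr rfl fun φ _ => Finset.sum_congr rfl fun i _ => Finset.sum_congr rfl fun j _ => ?_
    ring
  exact_mod_cast h

lemma gram_quad_int (b : Fin n → K) (t : InfinitePlace K → ℝ) (m : Fin n → ℤ) :
    ic m ⬝ᵥ gram b t *ᵥ ic m = qf t (∑ i, (m i : K) * b i) := by
  rw [gram_quad, qf]
  simp [ic]

noncomputable def emb (e : Fin n ≃ (K →+* ℂ)) (b : Fin n → K) : Matrix (Fin n) (Fin n) ℂ :=
  Matrix.of fun i j => e j (b i)

lemma gram_eq (e : Fin n ≃ (K →+* ℂ)) (b : Fin n → K) (t : InfinitePlace K → ℝ) :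
    (gram b t).map (algebraMap ℝ ℂ) = emb e b * diagonal (fun j => (t (InfinitePlace.mk (e j)) : ℂ)) *
      (emb e b)ᴴ := by
  ext i j
  rw [Matrix.map_apply, Complex.coe_algebraMap, gram_ofReal, ← Equiv.sum_comp e, Matrix.mul_apply]
  refine Finset.sum_congr rfl fun k _ => ?_
  simp only [emb, Matrix.mul_diagonal, Matrix.of_apply, conjTranspose_apply, starRingEnd_apply]
  ring

lemma emb_det_sq (e : Fin n ≃ (K →+* ℂ)) (b : Fin n → K) :
    ((Algebra.discr ℚ b : ℚ) : ℂ) = (emb e b).det ^ 2 := by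
  have := Algebra.discr_eq_det_embeddingsMatrixReindex_pow_two ℚ ℂ b
    (e.trans (RingHom.equivRatAlgHom K ℂ))
  rw [← eq_ratCast (algebraMap ℚ ℂ), this]
  rfl

lemma gram_det (e : Fin n ≃ (K →+* ℂ)) (b : Fin n → K) (t : InfinitePlace K → ℝ) :
    (gram b t).det = (∏ φ : K →+* ℂ, t (InfinitePlace.mk φ)) * |(Algebra.discr ℚ b : ℚ)| := by
  have h : (((gram b t).det : ℝ) : ℂ) = (((∏ φ : K →+* ℂ, t (InfinitePlace.mk φ)) *
      |(Algebra.discr ℚ b : ℚ)| : ℝ) : ℂ) := by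
    have h1 : (|((Algebra.discr ℚ b : ℚ) : ℝ)|) = ‖(emb e b).det‖^2 := by
      rw [← norm_pow, ← emb_det_sq, Complex.norm_ratCast]
    have h2 := RingHom.map_det (algebraMap ℝ ℂ) (gram b t)
    rw [RingHom.mapMatrix_apply, gram_eq e, det_mul, det_mul, det_diagonal, det_conjTranspose] at h2
    rw [Complex.coe_algebraMap] at h2
    push_cast
    rw [h2, h1, ← Equiv.prod_comp e]
    push_cast
    rw [← Complex.mul_conj', starRingEnd_apply]
    ring
  exact_mod_cast h

lemma gram_posDef (e : Fin n ≃ (K →+* ℂ)) (b : Module.Basis (Fin n) ℚ K) (t : InfinitePlace K → ℝ)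
    (ht : ∀ w, 0 < t w) : (gram b t).PosDef := by
  have hd : Algebra.discr ℚ b ≠ 0 := Algebra.discr_not_zero_of_basis ℚ b
  have hdet : (emb e b).det ≠ 0 := by
    intro h
    have := emb_det_sq e b
    rw [h] at this
    apply hd
    simpa using this
  refine Matrix.PosDef.of_dotProduct_mulVec_pos ?_ ?_
  · ext i j
    rw [conjTranspose_apply, star_trivial]
    have : ((gram b t j i : ℝ) : ℂ) = (gram b t i j : ℝ) := by
      rw [← Complex.conj_ofReal (gram b t j i), gram_ofReal, gram_ofReal, map_sum]
      refine Finset.sum_congr rfl fun φ _ => ?_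
      simp
      ring
    exact_mod_cast this
  · intro x hx
    rw [star_trivial, gram_quad]
    have h1 : ∃ φ : K →+* ℂ, ∑ i, (x i : ℂ) * φ (b i) ≠ 0 := by
      by_contra! h
      apply hx
      have h2 : (fun i => (x i : ℂ)) ᵥ* emb e b = 0 := by
        ext j
        simpa [vecMul, dotProduct, emb] using h (e j)
      have h3 := Matrix.eq_zero_of_vecMul_eq_zero hdet h2
      ext i
      have := congrFun h3 i
      simpa using this
    obtain ⟨φ, hφ⟩ := h1
    apply Finset.sum_pos'
    · intro φ _
      have := ht (InfinitePlace.mk φ)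
      positivity
    · refine ⟨φ, Finset.mem_univ _, ?_⟩
      have := ht (InfinitePlace.mk φ)
      positivity

noncomputable def dualB (b : Module.Basis (Fin n) ℚ K) : Module.Basis (Fin n) ℚ K :=
  (Algebra.traceForm ℚ K).dualBasis (traceForm_nondegenerate ℚ K) b

lemma gram_inv (e : Fin n ≃ (K →+* ℂ)) (b : Module.Basis (Fin n) ℚ K) (t : InfinitePlace K → ℝ)
    (ht : ∀ w, 0 < t w) : (gram b t)⁻¹ = gram (dualB b) (fun w => (t w)⁻¹) := by
  apply Matrix.inv_eq_right_inv
  have h0 : (emb e (dualB b)) * (emb e b)ᵀ = 1 := by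
    ext i j
    have h1 := LinearMap.BilinForm.apply_dualBasis_left (traceForm_nondegenerate ℚ K) b i j
    rw [Algebra.traceForm_apply] at h1
    have h2 := trace_eq_sum_embeddings (K := ℚ) (L := K) ℂ
      (x := (((Algebra.traceForm ℚ K).dualBasis (traceForm_nondegenerate ℚ K) b) i) * b j)
    rw [h1, ← Equiv.sum_comp (RingHom.equivRatAlgHom K ℂ), ← Equiv.sum_comp e] at h2
    rw [Matrix.mul_apply, Matrix.one_apply]
    have h3 : ∀ x : Fin n, emb e (dualB b) i x * (emb e b)ᵀ x j =
      ((RingHom.equivRatAlgHom K ℂ) (e x)) (((Algebra.traceForm ℚ K).dualBasis (traceForm_nondegenerate ℚ K) b) i * b j) := by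
      intro x
      rw [map_mul]
      rfl
    rw [Finset.sum_congr rfl (fun x _ => h3 x), ← h2]
    by_cases hij : i = j <;> simp [hij, eq_comm]
  have h1 : (emb e b)ᴴ * ((emb e (dualB b)).map star) = 1 := by
    have : (emb e b)ᵀ * (emb e (dualB b)) = 1 := mul_eq_one_comm.1 h0
    have h2 := congrArg (fun M => M.map (starRingEnd ℂ)) this
    simp only [Matrix.map_mul] at h2
    rw [Matrix.map_one _ (map_zero _) (map_one _)] at h2
    exact h2
  have h2 : ((gram b t * gram (dualB b) (fun w => (t w)⁻¹))).map (algebraMap ℝ ℂ) = 1 := by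
    have hr : (gram (dualB b) (fun w => (t w)⁻¹)).map (algebraMap ℝ ℂ) =
        ((emb e (dualB b)).map star) * diagonal (fun j => ((t (InfinitePlace.mk (e j)))⁻¹ : ℂ)) *
      (emb e (dualB b))ᵀ := by
      ext i j
      rw [Matrix.map_apply, Complex.coe_algebraMap, ← Complex.conj_ofReal, gram_ofReal,
        ← Equiv.sum_comp e, Matrix.mul_apply, map_sum]
      refine Finset.sum_congr rfl fun k _ => ?_
      simp only [emb, Matrix.mul_diagonal, Matrix.of_apply, transpose_apply, Matrix.map_apply,
        map_mul, Complex.conj_conj, Complex.conj_ofReal, starRingEnd_apply, star_star,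
        Complex.ofReal_inv]
      rw [← starRingEnd_apply, map_inv₀, Complex.conj_ofReal]
      ring
    rw [Matrix.map_mul, gram_eq e, hr]
    have hd : diagonal (fun j => (t (InfinitePlace.mk (e j)) : ℂ)) *
        diagonal (fun j => ((t (InfinitePlace.mk (e j)))⁻¹ : ℂ)) = 1 := by
      rw [diagonal_mul_diagonal]
      have : ∀ j, (t (InfinitePlace.mk (e j)) : ℂ) ≠ 0 := fun j => by
        exact_mod_cast (ht _).ne'
      simp [this]
    have h4 : emb e b * (emb e (dualB b))ᵀ = 1 := by
      have := congrArg transpose h0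
      simpa using this
    calc _ = emb e b * (diagonal (fun j => (t (InfinitePlace.mk (e j)) : ℂ)) *
        ((emb e b)ᴴ * ((emb e (dualB b)).map star)) * diagonal (fun j => ((t (InfinitePlace.mk (e j)))⁻¹ : ℂ))) *
      (emb e (dualB b))ᵀ := by simp only [Matrix.mul_assoc]
      _ = 1 := by rw [h1, Matrix.mul_one, hd, Matrix.mul_one, h4]
  ext i j
  have := congrFun (congrFun h2 i) j
  rw [Matrix.map_apply, Complex.coe_algebraMap] at this
  by_cases hij : i = j
  · subst hij
    simp only [one_apply_eq] at this ⊢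
    exact_mod_cast this
  · simp only [one_apply_ne hij] at this ⊢
    exact_mod_cast this

end gram
end RegB
end

section
open MeasureTheory Set Filter Topology NumberField
open scoped ENNReal
namespace RegB

/-- kernel k(a) = exp(-exp(-a)) -/
noncomputable def kf (a : ℝ) : ℝ := Real.exp (-Real.exp (-a))
noncomputable def ke (a : ℝ) : ℝ≥0∞ := ENNReal.ofReal (kf a)
noncomputable def k2e (a : ℝ) : ℝ≥0∞ := ENNReal.ofReal (kf (a / 2))
/-- convolution with a kernel -/
noncomputable def cv (k g : ℝ → ℝ≥0∞) (w : ℝ) : ℝ≥0∞ := ∫⁻ a, k a * g (w - a)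

lemma kf_pos (a : ℝ) : 0 < kf a := Real.exp_pos _

lemma measurable_kf : Measurable kf := by unfold kf; fun_prop
lemma measurable_ke : Measurable ke := measurable_kf.ennreal_ofReal
lemma measurable_k2e : Measurable k2e := (measurable_kf.comp (by fun_prop)).ennreal_ofReal

lemma measurable_cv {k g : ℝ → ℝ≥0∞} (hk : Measurable k) (hg : Measurable g) :
    Measurable (cv k g) := by
  unfold cv
  apply Measurable.lintegral_prod_right' (f := fun p : ℝ × ℝ => k p.2 * g (p.1 - p.2))
  fun_prop

lemma measurable_cv_iter {k g : ℝ → ℝ≥0∞} (hk : Measurable k) (hg : Measurable g) (n : ℕ) :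
    Measurable ((cv k)^[n] g) := by
  induction n with
  | zero => exact hg
  | succ n ih => rw [Function.iterate_succ_apply']; exact measurable_cv hk ih

lemma lintegral_pi_cv {k : ℝ → ℝ≥0∞} (hk : Measurable k) (n : ℕ) :
    ∀ {g : ℝ → ℝ≥0∞}, Measurable g → ∀ u : ℝ,
    ∫⁻ a : Fin n → ℝ, (∏ i, k (a i)) * g (u - ∑ i, a i) = ((cv k)^[n] g) u := by
  induction n with
  | zero =>
    intro g hg u
    simp [lintegral_unique, volume_pi]
  | succ n ih =>
    intro g hg u
    have h := (volume_preserving_piFinSuccAbove (fun _ : Fin (n+1) => ℝ) 0).symm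
    rw [← h.lintegral_comp_emb (MeasurableEquiv.measurableEmbedding _)]
    rw [Measure.volume_eq_prod, lintegral_prod]
    · rw [Function.iterate_succ_apply']
      rw [cv]
      apply lintegral_congr
      intro a
      rw [← ih hg (u - a), ← lintegral_const_mul]
      · apply lintegral_congr
        intro x
        simp only [MeasurableEquiv.piFinSuccAbove_symm_apply, Fin.insertNthEquiv_zero,
          Fin.consEquiv_apply, Fin.prod_univ_succ, Fin.sum_univ_succ, Fin.cons_zero, Fin.cons_succ]
        rw [mul_assoc, sub_sub]
      · fun_prop
    · apply Measurable.aemeasurable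
      have : Measurable fun a : Fin (n+1) → ℝ => (∏ i, k (a i)) * g (u - ∑ i, a i) := by fun_prop
      exact this.comp (MeasurableEquiv.measurable _)

/-- log-concavity -/
def LC (g : ℝ → ℝ≥0∞) : Prop := ∀ x y v : ℝ, x ≤ y → 0 ≤ v → g x * g (y + v) ≤ g (x + v) * g y

lemma rearr {P Q A B : ℝ≥0∞} (h : (Q ≤ P ∧ B ≤ A) ∨ (P ≤ Q ∧ A ≤ B)) :
    P * B + Q * A ≤ P * A + Q * B := by
  rcases h with ⟨h1, h2⟩ | ⟨h1, h2⟩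
  · obtain ⟨p, rfl⟩ := exists_add_of_le h1
    obtain ⟨a, rfl⟩ := exists_add_of_le h2
    calc _ = (Q * B + p * B + Q * B + Q * a) := by ring
      _ ≤ (Q * B + p * B + Q * B + Q * a) + p * a := le_self_add
      _ = _ := by ring
  · obtain ⟨p, rfl⟩ := exists_add_of_le h1
    obtain ⟨a, rfl⟩ := exists_add_of_le h2
    calc _ = (P * A + P * a + P * A + p * A) := by ring
      _ ≤ (P * A + P * a + P * A + p * A) + p * a := le_self_add
      _ = _ := by ring

lemma cv_comm (k g : ℝ → ℝ≥0∞) (w : ℝ) : cv k g w = ∫⁻ s, k (w - s) * g s := by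
  unfold cv
  rw [← lintegral_sub_left_eq_self _ w]
  simp

lemma LC_cv {k g : ℝ → ℝ≥0∞} (hkm : Measurable k) (hgm : Measurable g) (hk : LC k) (hg : LC g) :
    LC (cv k g) := by
  intro x y v hxy hv
  have e : ∀ w z : ℝ, cv k g (w - z) = ∫⁻ s, k (w - s) * g (s - z) := by
    intro w z
    rw [cv_comm, ← lintegral_sub_right_eq_self _ z]
    apply lintegral_congr; intro s; congr 2; ring
  have e1 := e (x + v) v
  have e2 := e (y + v) 0
  have e3 := e (x + v) 0
  have e4 := e (y + v) v
  have m : ∀ w z : ℝ, Measurable fun s => k (w - s) * g (s - z) := fun w z => by fun_prop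
  have D : ∀ w z w' z' : ℝ, (∫⁻ s, k (w - s) * g (s - z)) * (∫⁻ s, k (w' - s) * g (s - z')) =
      ∫⁻ p : ℝ × ℝ, (k (w - p.1) * g (p.1 - z)) * (k (w' - p.2) * g (p.2 - z')) := by
    intro w z w' z'
    rw [Measure.volume_eq_prod, lintegral_prod_mul (m w z).aemeasurable (m w' z').aemeasurable]
  have D' : ∀ w z w' z' : ℝ, (∫⁻ s, k (w - s) * g (s - z)) * (∫⁻ s, k (w' - s) * g (s - z')) =
      ∫⁻ p : ℝ × ℝ, (k (w' - p.1) * g (p.1 - z')) * (k (w - p.2) * g (p.2 - z)) := by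
    intro w z w' z'
    rw [mul_comm, D]
  rw [add_sub_cancel_right] at e1 e4
  rw [sub_zero] at e2 e3
  rw [e1, e2, e3, e4]
  have key : 2 * ((∫⁻ s, k (x + v - s) * g (s - v)) * ∫⁻ s, k (y + v - s) * g (s - 0)) ≤
      2 * ((∫⁻ s, k (x + v - s) * g (s - 0)) * ∫⁻ s, k (y + v - s) * g (s - v)) := by
    rw [two_mul, two_mul]
    nth_rw 1 [D]
    nth_rw 1 [D']
    nth_rw 1 [D]
    nth_rw 1 [D']
    rw [← lintegral_add_left (by fun_prop), ← lintegral_add_left (by fun_prop)]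
    apply lintegral_mono
    rintro ⟨s, r⟩
    simp only
    have := rearr (P := k (x+v-s) * k (y+v-r)) (Q := k (x+v-r) * k (y+v-s))
      (A := g (s-0) * g (r - v)) (B := g (r - 0) * g (s - v)) ?_
    · calc _ = _ := ?_
        _ ≤ _ := this
        _ = _ := ?_ <;> ring
      all_goals ring
    · rcases le_total s r with h | h
      · left
        constructor
        · have := hk (x+v-r) (y+v-r) (r-s) (by linarith) (by linarith)
          ring_nf at this ⊢; exact this
        · have := hg (s - v) (r - v) v (by linarith) hv
          ring_nf at this ⊢; exact this
      · right
        constructor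
        · have := hk (x+v-s) (y+v-s) (s-r) (by linarith) (by linarith)
          ring_nf at this ⊢; exact this
        · have := hg (r - v) (s - v) v (by linarith) hv
          ring_nf at this ⊢; exact this
  exact (ENNReal.mul_le_mul_iff_right (by norm_num) (by norm_num)).1 key

lemma LC_ke : LC ke := by
  intro x y v hxy hv
  unfold ke kf
  rw [← ENNReal.ofReal_mul (Real.exp_pos _).le, ← ENNReal.ofReal_mul (Real.exp_pos _).le]
  apply ENNReal.ofReal_le_ofReal
  rw [← Real.exp_add, ← Real.exp_add, Real.exp_le_exp]
  rw [show -(x+v) = -x + -v by ring, show -(y+v) = -y + -v by ring, Real.exp_add, Real.exp_add]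
  have h1 : Real.exp (-y) ≤ Real.exp (-x) := Real.exp_le_exp.2 (by linarith)
  have h2 : Real.exp (-v) ≤ 1 := Real.exp_le_one_iff.2 (by linarith)
  nlinarith

lemma LC_k2e : LC k2e := by
  intro x y v hxy hv
  have := LC_ke (x/2) (y/2) (v/2) (by linarith) (by linarith)
  simp only [ke, k2e] at this ⊢
  rw [← add_div, ← add_div] at this
  exact this

/-- the main function c = 32 f -/
noncomputable def cf : ℝ → ℝ≥0∞ := (cv ke)^[5] k2e

lemma measurable_cf : Measurable cf := measurable_cv_iter measurable_ke measurable_k2e 5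

lemma LC_cf : LC cf := by
  have : ∀ n : ℕ, LC ((cv ke)^[n] k2e) := by
    intro n
    induction n with
    | zero => exact LC_k2e
    | succ n ih =>
      rw [Function.iterate_succ_apply']
      exact LC_cv measurable_ke (measurable_cv_iter measurable_ke measurable_k2e n) LC_ke ih
  exact this 5

end RegB
end

section
open MeasureTheory Set Filter Topology NumberField
open scoped ENNReal
namespace RegB

lemma unfold {n : ℕ} (L : Module.Basis (Fin n) ℝ (Fin n → ℝ)) {X : Type*} [Countable X]
    (act : (Fin n → ℤ) → X → X) (h0 : ∀ x, act 0 x = x)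
    (hadd : ∀ g h x, act (g + h) x = act g (act h x))
    (hfree : ∀ g x, act g x = x → g = 0) :
    ∃ S : Set X, (∀ x, ∃ g, act g x ∈ S) ∧
      ∀ F : (Fin n → ℝ) → X → ℝ≥0∞, (∀ x, Measurable fun ξ => F ξ x) →
        (∀ g x ξ, F ξ (act g x) = F (ξ + ∑ j, (g j : ℝ) • L j) x) →
        ∫⁻ ξ in ZSpan.fundamentalDomain L, ∑' x, F ξ x = ∑' s : S, ∫⁻ ξ, F ξ s := by
  let _ : AddAction (Fin n → ℤ) X :=
    { vadd := act, zero_vadd := h0, add_vadd := hadd }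
  have hv : ∀ g x, act g x = g +ᵥ x := fun _ _ => rfl
  let S : Set X := Set.range (fun q : AddAction.orbitRel.Quotient (Fin n → ℤ) X => Quotient.out q)
  have hS : ∀ x, ∃ g, act g x ∈ S := by
    intro x
    have : AddAction.orbitRel (Fin n → ℤ) X (Quotient.out (Quotient.mk (AddAction.orbitRel (Fin n → ℤ) X) x)) x :=
      Quotient.mk_out x
    rw [AddAction.orbitRel_apply] at this
    obtain ⟨g, hg⟩ := this
    exact ⟨g, ⟨_, hg.symm⟩⟩
  refine ⟨S, hS, ?_⟩
  intro F hF hact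
  have hbij : Function.Bijective (fun p : S × (Fin n → ℤ) => act p.2 p.1) := by
    constructor
    · rintro ⟨⟨s, q, rfl⟩, g⟩ ⟨⟨s', q', rfl⟩, g'⟩ h
      simp only at h
      have hq : q = q' := by
        rw [← Quotient.out_eq q, ← Quotient.out_eq q']
        apply Quotient.sound
        change AddAction.orbitRel _ _ _ _
        rw [AddAction.orbitRel_apply]
        refine ⟨-g + g', ?_⟩
        change act (-g + g') _ = _
        rw [hadd, ← h, ← hadd, neg_add_cancel, h0]
      subst hq
      have : -g' + g = 0 := by
        apply hfree _ (Quotient.out q)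
        rw [hadd, h, ← hadd, neg_add_cancel, h0]
      have : g = g' := by
        rw [neg_add_eq_zero] at this; exact this.symm
      subst this
      rfl
    · intro x
      obtain ⟨g, hg⟩ := hS x
      refine ⟨⟨⟨_, hg⟩, -g⟩, ?_⟩
      simp only
      rw [← hadd, neg_add_cancel, h0]
  let E := Equiv.ofBijective _ hbij
  have e1 : ∀ ξ, ∑' x, F ξ x = ∑' s : S, ∑' g : Fin n → ℤ, F (ξ + ∑ j, (g j : ℝ) • L j) s := by
    intro ξ
    rw [← E.tsum_eq, ENNReal.tsum_prod']
    refine tsum_congr fun s => tsum_congr fun g => ?_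
    exact hact g s ξ
  simp_rw [e1]
  have hm : ∀ (s : X) (c : Fin n → ℝ), Measurable fun ξ => F (ξ + c) s := fun s c =>
    (hF s).comp (measurable_id.add_const c)
  rw [lintegral_tsum (fun s : S => (Measurable.tsum (fun g => hm s.1 _)).aemeasurable)]
  refine tsum_congr fun s => ?_
  rw [lintegral_tsum (fun g => (hm s.1 _).aemeasurable)]
  have hfd := ZSpan.isAddFundamentalDomain L (volume : Measure (Fin n → ℝ))
  have : VAddInvariantMeasure (Submodule.span ℤ (Set.range L)) (Fin n → ℝ) volume :=
    inferInstanceAs <| VAddInvariantMeasure (Submodule.span ℤ (Set.range L)).toAddSubgroup (Fin n → ℝ) volume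
  rw [hfd.lintegral_eq_tsum'' (fun ξ => F ξ s)]
  rw [← ((L.restrictScalars ℤ).equivFun.symm.toEquiv).tsum_eq]
  refine tsum_congr fun g => ?_
  apply lintegral_congr
  intro ξ
  congr 1
  rw [Submodule.vadd_def, vadd_eq_add, add_comm]
  congr 1
  simp [Module.Basis.equivFun_symm_apply]
  exact Finset.sum_congr rfl fun j _ => by ext i; simp

lemma lintegral_affine {n : ℕ} (g : (Fin n → ℝ) → ℝ≥0∞) (hg : Measurable g) (c : Fin n → ℝ) :
    ∫⁻ ξ : Fin n → ℝ, g (fun i => -2 * ξ i - c i) = ENNReal.ofReal ((1/2)^n) * ∫⁻ a, g a := by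
  have h1 : ∫⁻ ξ : Fin n → ℝ, g (fun i => -2 * ξ i - c i) = ∫⁻ ξ : Fin n → ℝ, (fun a => g (a - c)) ((-2:ℝ) • ξ) := rfl
  rw [h1, ← lintegral_map (f := fun a => g (a - c)) (by fun_prop) (by fun_prop),
    Measure.map_addHaar_smul _ (by norm_num), lintegral_smul_measure, lintegral_sub_right_eq_self]
  congr 2
  simp [abs_inv]

lemma single_int (A : Fin 5 → ℝ) (hA : ∀ i, 0 < A i) (B : ℝ) (hB : 0 < B) (s : ℝ) :
    ∫⁻ ξ : Fin 5 → ℝ, ENNReal.ofReal (Real.exp (-(Real.pi * (∑ i, Real.exp (2 * ξ i) * A i ^2 +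
      2 * (Real.exp (s - ∑ i, ξ i) * B^2))))) =
    ENNReal.ofReal (1/32) * cf (-(Real.log (4 * Real.pi^7) + 2 * s + 2 * Real.log ((∏ i, A i) * B^2))) := by
  set u := -(Real.log (4 * Real.pi^7) + 2 * s + 2 * Real.log ((∏ i, A i) * B^2)) with hu
  have hpi := Real.pi_pos
  rw [cf, ← lintegral_pi_cv measurable_ke 5 measurable_k2e u]
  have := lintegral_affine (fun a : Fin 5 → ℝ => (∏ i, ke (a i)) * k2e (u - ∑ i, a i))
    (by have := measurable_ke; have := measurable_k2e; fun_prop)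
    (fun i => Real.log (Real.pi * A i^2))
  rw [show (1/32:ℝ) = (1/2)^5 by norm_num, ← this]
  apply lintegral_congr
  intro ξ
  simp only [ke, k2e]
  rw [← ENNReal.ofReal_prod_of_nonneg (fun i _ => (kf_pos _).le), ← ENNReal.ofReal_mul
    (Finset.prod_nonneg fun i _ => (kf_pos _).le)]
  congr 1
  unfold kf
  rw [← Real.exp_sum, ← Real.exp_add]
  congr 1
  have e1 : ∀ i, Real.exp (-(-2 * ξ i - Real.log (Real.pi * A i^2))) =
      Real.pi * (Real.exp (2 * ξ i) * A i^2) := by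
    intro i
    rw [show -(-2 * ξ i - Real.log (Real.pi * A i^2)) = 2 * ξ i + Real.log (Real.pi * A i^2) by ring,
      Real.exp_add, Real.exp_log (by have := hA i; positivity)]
    ring
  have e2 : Real.exp (-((u - ∑ i, (-2 * ξ i - Real.log (Real.pi * A i^2))) / 2)) =
      2 * Real.pi * (Real.exp (s - ∑ i, ξ i) * B^2) := by
    have hl : ∀ i, Real.log (Real.pi * A i^2) = Real.log Real.pi + 2 * Real.log (A i) := by
      intro i
      rw [Real.log_mul hpi.ne' (by have := hA i; positivity), Real.log_pow]; norm_num
    have : -((u - ∑ i, (-2 * ξ i - Real.log (Real.pi * A i^2))) / 2) =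
        Real.log 2 + Real.log Real.pi + (s - ∑ i, ξ i) + 2 * Real.log B := by
      rw [hu, Real.log_mul (by norm_num) (by positivity), Real.log_pow,
        Real.log_mul (Finset.prod_pos fun i _ => hA i).ne' (by positivity),
        Real.log_prod (fun i _ => (hA i).ne'), Real.log_pow, show (4:ℝ) = 2^2 by norm_num, Real.log_pow]
      simp_rw [hl]
      simp only [Fin.sum_univ_five]
      push_cast
      ring
    rw [this, Real.exp_add, Real.exp_add, Real.exp_add, Real.exp_log hpi, Real.exp_log (by norm_num),
      mul_comm 2 (Real.log B), Real.exp_mul, Real.exp_log hB]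
    norm_num
    ring
  simp_rw [e1]
  rw [e2, Finset.sum_neg_distrib, ← Finset.mul_sum]
  ring

end RegB
end

section
open MeasureTheory Set Filter Topology NumberField Matrix
open scoped ENNReal
namespace RegB

structure PD (K : Type*) [Field K] [NumberField K] where
  wc : InfinitePlace K
  e5 : {w : InfinitePlace K // w ≠ wc} ≃ Fin 5
  hc : wc.IsComplex
  hr : ∀ w, w ≠ wc → w.IsReal
  hk : Units.rank K = 5

lemma exists_PD (K : Type*) [Field K] [NumberField K] (hdeg : Module.finrank ℚ K = 7)
    (hreal : InfinitePlace.nrRealPlaces K = 5) : Nonempty (PD K) := by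
  classical
  have h1 := InfinitePlace.card_add_two_mul_card_eq_rank K
  have h2 := InfinitePlace.card_eq_nrRealPlaces_add_nrComplexPlaces K
  have h3 : InfinitePlace.nrComplexPlaces K = 1 := by omega
  obtain ⟨⟨wc, hc⟩, huniq⟩ := Fintype.card_eq_one_iff.1 h3
  have h4 : Fintype.card (InfinitePlace K) = 6 := by omega
  refine ⟨⟨wc, Fintype.equivFinOfCardEq ?_, hc, ?_, ?_⟩⟩
  · rw [Fintype.card_subtype_compl, Fintype.card_subtype_eq, h4]
  · intro w hw
    rw [← InfinitePlace.not_isComplex_iff_isReal]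
    intro h
    exact hw (congrArg Subtype.val (huniq ⟨w, h⟩))
  · rw [Units.rank, h4]

namespace PD
variable {K : Type*} [Field K] [NumberField K] (P : PD K)

noncomputable def wr (i : Fin 5) : InfinitePlace K := (P.e5.symm i).1

lemma wr_ne (i : Fin 5) : P.wr i ≠ P.wc := (P.e5.symm i).2
lemma mult_wr (i : Fin 5) : (P.wr i).mult = 1 := (P.hr _ (P.wr_ne i)).mult_eq_one
lemma mult_wc : P.wc.mult = 2 := by
  rw [InfinitePlace.mult, if_neg (InfinitePlace.not_isReal_iff_isComplex.2 P.hc)]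

lemma sum_places {M : Type*} [AddCommMonoid M] (f : InfinitePlace K → M) :
    ∑ w, f w = f P.wc + ∑ i, f (P.wr i) := by
  classical
  rw [Fintype.sum_eq_add_sum_subtype_ne _ P.wc]
  congr 1
  exact (Equiv.sum_comp P.e5.symm (fun w => f w.1)).symm

lemma sum_emb (f : InfinitePlace K → ℝ) :
    ∑ φ : K →+* ℂ, f (InfinitePlace.mk φ) = ∑ i, f (P.wr i) + 2 * f P.wc := by
  classical
  rw [← Finset.sum_fiberwise (s := Finset.univ) (g := InfinitePlace.mk)]
  have : ∀ w : InfinitePlace K, ∑ φ : K →+* ℂ with InfinitePlace.mk φ = w, f (InfinitePlace.mk φ) =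
      w.mult * f w := by
    intro w
    rw [← InfinitePlace.card_filter_mk_eq, ← nsmul_eq_mul, ← Finset.sum_const]
    exact Finset.sum_congr rfl fun φ hφ => by rw [(Finset.mem_filter.1 hφ).2]
  simp_rw [this]
  rw [P.sum_places]
  simp [mult_wr, mult_wc, add_comm]

noncomputable def tt (ξ : Fin 5 → ℝ) (s : ℝ) : InfinitePlace K → ℝ := by
  classical exact fun w => if h : w = P.wc then Real.exp (s - ∑ i, ξ i)
    else Real.exp (2 * ξ (P.e5 ⟨w, h⟩))

lemma tt_wc (ξ : Fin 5 → ℝ) (s : ℝ) : P.tt ξ s P.wc = Real.exp (s - ∑ i, ξ i) := by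
  simp [tt]

lemma tt_wr (ξ : Fin 5 → ℝ) (s : ℝ) (i : Fin 5) : P.tt ξ s (P.wr i) = Real.exp (2 * ξ i) := by
  have := P.wr_ne i
  unfold tt
  rw [dif_neg this]
  simp [wr]

lemma tt_pos (ξ : Fin 5 → ℝ) (s : ℝ) (w : InfinitePlace K) : 0 < P.tt ξ s w := by
  unfold tt; split_ifs <;> positivity

lemma tt_inv (ξ : Fin 5 → ℝ) (s : ℝ) : (fun w => (P.tt ξ s w)⁻¹) = P.tt (-ξ) (-s) := by
  ext w
  unfold tt; split_ifs
  · rw [← Real.exp_neg]; congr 1; simp; ring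
  · rw [← Real.exp_neg]; congr 1; simp

lemma qf_tt (ξ : Fin 5 → ℝ) (s : ℝ) (x : K) : qf (P.tt ξ s) x =
    ∑ i, Real.exp (2 * ξ i) * (P.wr i x)^2 + 2 * (Real.exp (s - ∑ i, ξ i) * (P.wc x)^2) := by
  have := P.sum_emb (fun w => P.tt ξ s w * (w x)^2)
  simp only [tt_wc, tt_wr] at this
  rw [← this, qf]
  rfl

lemma prod_tt (ξ : Fin 5 → ℝ) (s : ℝ) : ∏ φ : K →+* ℂ, P.tt ξ s (InfinitePlace.mk φ) =
    Real.exp (2 * s) := by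
  have : ∀ φ : K →+* ℂ, P.tt ξ s (InfinitePlace.mk φ) = Real.exp (Real.log (P.tt ξ s (InfinitePlace.mk φ))) :=
    fun φ => (Real.exp_log (P.tt_pos _ _ _)).symm
  rw [Finset.prod_congr rfl (fun φ _ => this φ), ← Real.exp_sum,
    P.sum_emb (fun w => Real.log (P.tt ξ s w))]
  congr 1
  simp only [tt_wc, tt_wr, Real.log_exp, ← Finset.mul_sum]
  ring

/-- norm -/
lemma norm_eq (x : K) : (∏ i, P.wr i x) * (P.wc x)^2 = |((Algebra.norm ℚ x : ℚ) : ℝ)| := by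
  have h := InfinitePlace.prod_eq_abs_norm x
  classical
  rw [Fintype.prod_eq_mul_prod_subtype_ne _ P.wc, mult_wc] at h
  rw [← Rat.cast_abs, ← h, mul_comm]
  congr 1
  rw [← Equiv.prod_comp P.e5.symm]
  refine Finset.prod_congr rfl fun i _ => ?_
  have := P.mult_wr i
  rw [wr] at this
  rw [this, pow_one]; rfl

noncomputable def un (j : Fin 5) : (𝓞 K)ˣ := Units.fundSystem K (Fin.cast P.hk.symm j)

noncomputable def eps (g : Fin 5 → ℤ) : (𝓞 K)ˣ := ∏ j, P.un j ^ g j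

noncomputable def Lm : Matrix (Fin 5) (Fin 5) ℝ :=
  Matrix.of fun j i => Real.log (P.wr i (P.un j : K))

lemma Lm_det : |P.Lm.det| = Units.regulator K := by
  classical
  rw [Units.regulator_eq_det K P.wc (P.e5.trans (finCongr P.hk.symm)),
    ← Matrix.det_submatrix_equiv_self P.e5.symm]
  congr 2
  ext j i
  simp only [Lm, Matrix.of_apply, Matrix.submatrix_apply]
  have := P.mult_wr i
  rw [wr] at this
  rw [this]
  simp [un, wr, finCongr]

lemma Lm_ne : P.Lm.det ≠ 0 := by
  intro h
  have := P.Lm_det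
  rw [h, abs_zero] at this
  exact (Units.regulator_ne_zero K) this.symm

noncomputable def LB : Module.Basis (Fin 5) ℝ (Fin 5 → ℝ) :=
  basisOfLinearIndependentOfCardEqFinrank
    (Matrix.linearIndependent_rows_of_det_ne_zero P.Lm_ne) (by simp)

lemma LB_apply (j i : Fin 5) : P.LB j i = Real.log (P.wr i (P.un j : K)) := by
  simp [LB, Lm]

lemma vol_FD : volume (ZSpan.fundamentalDomain P.LB) = ENNReal.ofReal (Units.regulator K) := by
  rw [ZSpan.volume_fundamentalDomain, ← P.Lm_det]
  congr 3
  ext j i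
  rw [Matrix.of_apply, LB_apply]; rfl

lemma w_unit_pos (w : InfinitePlace K) (u : (𝓞 K)ˣ) : 0 < w (u : K) := by
  rw [InfinitePlace.pos_iff]
  exact_mod_cast Units.coe_ne_zero u

lemma log_eps (g : Fin 5 → ℤ) (i : Fin 5) :
    Real.log (P.wr i (P.eps g : K)) = (∑ j, (g j : ℝ) • P.LB j) i := by
  have : ((P.eps g : (𝓞 K)ˣ) : K) = ∏ j, ((P.un j : K)) ^ g j := by
    rw [eps, Units.coe_prod]
    simp [Units.coe_zpow]
  rw [this, map_prod, Real.log_prod]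
  · simp [LB_apply]
  · intro j _
    rw [map_zpow₀]
    exact (zpow_pos (w_unit_pos _ _) _).ne'

lemma log_wc (u : (𝓞 K)ˣ) : 2 * Real.log (P.wc (u : K)) = - ∑ i, Real.log (P.wr i (u : K)) := by
  have := Units.sum_mult_mul_log u
  rw [P.sum_places] at this
  simp only [mult_wr, mult_wc] at this
  push_cast at this
  simp only [one_mul] at this
  linarith

lemma qf_eps (g : Fin 5 → ℤ) (ξ : Fin 5 → ℝ) (s : ℝ) (x : K) :
    qf (P.tt ξ s) ((P.eps g : K) * x) = qf (P.tt (ξ + ∑ j, (g j : ℝ) • P.LB j) s) x := by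
  rw [qf_tt, qf_tt]
  have h2 : ∀ (w : InfinitePlace K), (w (P.eps g : K))^2 = Real.exp (2 * Real.log (w (P.eps g : K))) := by
    intro w
    rw [mul_comm, Real.exp_mul, Real.exp_log (w_unit_pos _ _)]; norm_num
  congr 1
  · refine Finset.sum_congr rfl fun i _ => ?_
    rw [map_mul, mul_pow, h2, log_eps, ← mul_assoc, ← Real.exp_add, Pi.add_apply]
    congr 2; ring
  · rw [map_mul, mul_pow, h2, log_wc, ← mul_assoc (Real.exp _), ← Real.exp_add]
    simp_rw [log_eps]
    congr 3
    simp only [Pi.add_apply, Finset.sum_add_distrib]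
    ring

lemma eps_add (g h : Fin 5 → ℤ) : P.eps (g + h) = P.eps g * P.eps h := by
  simp [eps, _root_.zpow_add, Finset.prod_mul_distrib]

lemma eps_zero : P.eps 0 = 1 := by simp [eps]

lemma eps_inj (g : Fin 5 → ℤ) (h : ∀ i, Real.log (P.wr i (P.eps g : K)) = 0) : g = 0 := by
  have h1 : ∑ j, (g j : ℝ) • P.LB j = 0 := by
    ext i
    rw [← log_eps, h i]; rfl
  have h2 := Fintype.linearIndependent_iff.1 P.LB.linearIndependent _ h1
  ext j
  have := h2 j
  exact_mod_cast this

end PD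
end RegB
end

section
open MeasureTheory Set Filter Topology NumberField Matrix
open scoped ENNReal
namespace RegB
namespace PD
variable {K : Type*} [Field K] [NumberField K] (P : PD K)

abbrev Lat {n : ℕ} (b : Module.Basis (Fin n) ℚ K) : Submodule ℤ K := Submodule.span ℤ (Set.range b)

noncomputable def gs (t : InfinitePlace K → ℝ) (x : K) : ℝ≥0∞ :=
  ENNReal.ofReal (Real.exp (-(Real.pi * qf t x)))

lemma lat_countable {n : ℕ} (b : Module.Basis (Fin n) ℚ K) : Countable (Lat b) := by
  have : Countable (Fin n → ℤ) := inferInstance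
  have e := (b.restrictScalars ℤ).equivFun.toEquiv
  exact e.countable_iff.2 this

lemma theta_gram {n : ℕ} (b : Module.Basis (Fin n) ℚ K) (t : InfinitePlace K → ℝ) :
    theta (gram b t) = 1 + ∑' x : {x : Lat b // x ≠ 0}, gs t (x : K) := by
  have h1 : theta (gram b t) = ∑' x : Lat b, gs t x := by
    rw [theta, ← ((b.restrictScalars ℤ).equivFun.symm.toEquiv).tsum_eq]
    refine tsum_congr fun m => ?_
    rw [gram_quad_int, gs]
    congr 5
    simp [Module.Basis.equivFun_symm_apply]
  rw [h1, ← Summable.tsum_add_tsum_compl (s := {(0 : Lat b)}) ENNReal.summable ENNReal.summable]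
  congr 1
  simp [gs, qf]

lemma lat_unfold (b : Module.Basis (Fin 7) ℚ K)
    (hΛ : ∀ (r : 𝓞 K) (x : K), x ∈ Lat b → (r : K) * x ∈ Lat b) (σ : ℤ) (hσ : σ = 1 ∨ σ = -1) :
    ∃ S : Set {x : Lat b // x ≠ 0}, (∀ x : {x : Lat b // x ≠ 0}, ∃ y ∈ S, ∃ g, ((y : Lat b) : K) = P.eps g * (x : K)) ∧
      ∀ s : ℝ, ∫⁻ ξ in ZSpan.fundamentalDomain P.LB, theta (gram b (P.tt ((σ : ℝ) • ξ) s)) =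
        ENNReal.ofReal (Units.regulator K) + ∑' x : S, ENNReal.ofReal (1/32) *
          cf (-(Real.log (4 * Real.pi^7) + 2 * s + 2 * Real.log |((Algebra.norm ℚ ((x : Lat b) : K) : ℚ) : ℝ)|)) := by
  have hσ2 : σ * σ = 1 := by rcases hσ with rfl | rfl <;> norm_num
  have hne : ∀ u : (𝓞 K)ˣ, (u : K) ≠ 0 := fun u => by exact_mod_cast Units.coe_ne_zero u
  let act : (Fin 5 → ℤ) → {x : Lat b // x ≠ 0} → {x : Lat b // x ≠ 0} := fun g x =>
    ⟨⟨(P.eps (σ • g) : K) * (x : K), hΛ _ _ x.1.2⟩, by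
      intro h
      have h1 := congrArg Subtype.val h
      simp only [ZeroMemClass.coe_zero, mul_eq_zero] at h1
      rcases h1 with h1 | h1
      · exact hne _ h1
      · exact x.2 (Subtype.ext h1)⟩
  have hact : ∀ g x, ((act g x : Lat b) : K) = (P.eps (σ • g) : K) * (x : K) := fun _ _ => rfl
  have := lat_countable b
  obtain ⟨S, hS, hF⟩ := unfold P.LB act
    (by
      intro x
      apply Subtype.ext; apply Subtype.ext
      rw [hact, smul_zero, eps_zero]; simp)
    (by
      intro g h x
      apply Subtype.ext; apply Subtype.ext
      rw [hact, hact, hact, smul_add, eps_add]; push_cast; ring)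
    (by
      intro g x h
      have h1 := congrArg (fun y : {x : Lat b // x ≠ 0} => ((y : Lat b) : K)) h
      simp only [hact] at h1
      have hx : (x : K) ≠ 0 := fun h0 => x.2 (Subtype.ext h0)
      have h2 : (P.eps (σ • g) : K) = 1 := by
        rw [← sub_eq_zero] at h1 ⊢
        have : ((P.eps (σ • g) : K) - 1) * (x : K) = 0 := by rw [← h1]; ring
        exact (mul_eq_zero.1 this).resolve_right hx
      have h3 := P.eps_inj (σ • g) (fun i => by rw [h2]; simp)
      have : σ • (σ • g) = 0 := by rw [h3, smul_zero]
      rwa [smul_smul, hσ2, one_smul] at this)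
  refine ⟨S, ?_, ?_⟩
  · intro x
    obtain ⟨g, hg⟩ := hS x
    exact ⟨_, hg, σ • g, rfl⟩
  · intro s
    have hmeas : ∀ x : K, Measurable fun ξ : Fin 5 → ℝ => gs (P.tt ((σ : ℝ) • ξ) s) x := by
      intro x
      unfold gs
      simp only [qf_tt]
      simp only [Pi.smul_apply]
      fun_prop
    have h1 := hF (fun ξ x => gs (P.tt ((σ : ℝ) • ξ) s) (x : K)) (fun x => hmeas x) (by
      intro g x ξ
      simp only [hact]
      rw [gs, gs, qf_eps]
      congr 6
      rw [smul_add, Finset.smul_sum]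
      congr 1
      refine Finset.sum_congr rfl fun j _ => ?_
      simp [mul_smul])
    simp_rw [theta_gram]
    rw [lintegral_add_left measurable_const, lintegral_const, Measure.restrict_apply MeasurableSet.univ,
      univ_inter, vol_FD, one_mul, h1]
    congr 1
    refine tsum_congr fun x => ?_
    have hx : (x : K) ≠ 0 := fun h0 => x.1.2 (Subtype.ext h0)
    have h2 : ∫⁻ ξ : Fin 5 → ℝ, gs (P.tt ((σ : ℝ) • ξ) s) (x : K) = ∫⁻ ξ, gs (P.tt ξ s) (x : K) := by
      rcases hσ with rfl | rfl
      · simp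
      · have := lintegral_neg_eq_self (μ := (volume : Measure (Fin 5 → ℝ))) (fun ξ => gs (P.tt ξ s) (x : K))
        rw [← this]
        simp
    rw [h2, ← P.norm_eq, ← single_int _ (fun i => ?_) _ ?_]
    · apply lintegral_congr
      intro ξ
      rw [gs, qf_tt]
    · exact InfinitePlace.pos_iff.2 hx
    · exact InfinitePlace.pos_iff.2 hx

lemma theta_fin (e : Fin 7 ≃ (K →+* ℂ)) (b : Module.Basis (Fin 7) ℚ K) (s : ℝ) :
    ∫⁻ ξ in ZSpan.fundamentalDomain P.LB, theta (gram b (P.tt ((1:ℝ) • ξ) s)) < ⊤ := by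
  obtain ⟨B, hB, hG⟩ := posDef_factor _ (gram_posDef e b (fun _ => 1) (fun _ => one_pos))
  obtain ⟨c, hc, hl⟩ := exists_lower B hB
  obtain ⟨M, hM⟩ := isBounded_iff_forall_norm_le.1 (ZSpan.fundamentalDomain_isBounded P.LB)
  have hbd : ∀ ξ ∈ ZSpan.fundamentalDomain P.LB, ∀ w, Real.exp (-(|s| + 5 * M)) ≤ P.tt ξ s w := by
    intro ξ hξ w
    have h1 : ∀ i, |ξ i| ≤ M := fun i => (norm_le_pi_norm ξ i).trans (hM ξ hξ)
    have hM0 : 0 ≤ M := (abs_nonneg _).trans (h1 0)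
    unfold tt
    split_ifs
    · rw [Real.exp_le_exp]
      have : ∑ i, ξ i ≤ ∑ i : Fin 5, M := Finset.sum_le_sum fun i _ => (le_abs_self _).trans (h1 i)
      simp at this
      have := neg_abs_le s
      linarith
    · rw [Real.exp_le_exp]
      have := neg_abs_le (ξ (P.e5 ⟨w, by assumption⟩))
      have := h1 (P.e5 ⟨w, by assumption⟩)
      have := abs_nonneg s
      linarith
  set c0 := Real.exp (-(|s| + 5 * M)) with hc0
  have hc0p : 0 < c0 := Real.exp_pos _
  set T := ∑' m : Fin 7 → ℤ, ENNReal.ofReal (Real.exp (-(Real.pi * (c0 * c)) * ∑ i, (m i : ℝ)^2)) with hT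
  have hTf : T < ⊤ := gauss_tsum_lt_top 7 (by positivity)
  calc _ ≤ ∫⁻ ξ in ZSpan.fundamentalDomain P.LB, T := by
        apply setLIntegral_mono measurable_const
        intro ξ hξ
        apply theta_lt_top
        intro x
        rw [one_smul, gram_quad]
        have h1 := hl x
        rw [← quad_factor, ← hG, gram_quad] at h1
        have h2 : c0 * ∑ φ : K →+* ℂ, 1 * ‖∑ i, (x i : ℂ) * φ (b i)‖^2 ≤
            ∑ φ : K →+* ℂ, P.tt ξ s (InfinitePlace.mk φ) * ‖∑ i, (x i : ℂ) * φ (b i)‖^2 := by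
          rw [Finset.mul_sum]
          refine Finset.sum_le_sum fun φ _ => ?_
          rw [one_mul]
          exact mul_le_mul_of_nonneg_right (hbd ξ hξ _) (by positivity)
        calc _ = c0 * (c * ∑ i, x i ^2) := by ring
          _ ≤ _ := (mul_le_mul_of_nonneg_left h1 hc0p.le).trans h2
    _ < ⊤ := by
      rw [lintegral_const, Measure.restrict_apply MeasurableSet.univ, univ_inter, vol_FD]
      exact ENNReal.mul_lt_top hTf ENNReal.ofReal_lt_top

lemma theta_id (e : Fin 7 ≃ (K →+* ℂ)) (b : Module.Basis (Fin 7) ℚ K) (ξ : Fin 5 → ℝ) (s D : ℝ)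
    (hD : D = |((Algebra.discr ℚ b : ℚ) : ℝ)|) (hD0 : 0 < D) :
    ENNReal.ofReal (Real.exp (s + Real.log D / 2)) * theta (gram b (P.tt ((1:ℝ) • ξ) s)) =
      theta (gram (dualB b) (P.tt ((-1:ℝ) • ξ) (-s))) := by
  have h := theta_poisson _ (gram_posDef e b (P.tt ξ s) (P.tt_pos ξ s))
  rw [gram_inv e b _ (P.tt_pos ξ s), tt_inv, gram_det e, prod_tt, Rat.cast_abs, ← hD] at h
  rw [one_smul, neg_one_smul, h, ← mul_assoc, ← ENNReal.ofReal_mul (Real.exp_pos _).le]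
  have : √(Real.exp (2 * s) * D) = Real.exp (s + Real.log D / 2) := by
    rw [Real.sqrt_eq_iff_mul_self_eq (by positivity) (by positivity), ← Real.exp_add,
      show s + Real.log D / 2 + (s + Real.log D / 2) = 2 * s + Real.log D by ring, Real.exp_add,
      Real.exp_log hD0]
  rw [this, mul_inv_cancel₀ (Real.exp_pos _).ne', ENNReal.ofReal_one, one_mul]

end PD
end RegB
end

section
open MeasureTheory Set Filter Topology NumberField Matrix
open scoped ENNReal
namespace RegB
namespace PD
variable {K : Type*} [Field K] [NumberField K]

lemma exists_intBasis (hdeg : Module.finrank ℚ K = 7) : ∃ b : Module.Basis (Fin 7) ℚ K,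
    (∀ x : K, x ∈ Lat b ↔ ∃ y : 𝓞 K, (y : K) = x) ∧ Algebra.discr ℚ b = (discr K : ℚ) := by
  have hc : Fintype.card (Module.Free.ChooseBasisIndex ℤ (𝓞 K)) = 7 := by
    rw [← Module.finrank_eq_card_basis (integralBasis K), hdeg]
  let e := Fintype.equivFinOfCardEq hc
  refine ⟨(integralBasis K).reindex e, ?_, ?_⟩
  · intro x
    rw [Lat, Module.Basis.range_reindex, mem_span_integralBasis]
    rfl
  · rw [Module.Basis.coe_reindex, Algebra.discr_reindex, coe_discr]

lemma mem_dual {b : Module.Basis (Fin 7) ℚ K} {x : K} : x ∈ Lat (dualB b) ↔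
    ∀ y ∈ Lat b, ∃ n : ℤ, (n : ℚ) = Algebra.trace ℚ K (x * y) := by
  have h := LinearMap.BilinForm.dualSubmodule_span_of_basis (R := ℤ) (Algebra.traceForm ℚ K)
    (traceForm_nondegenerate ℚ K) b
  rw [Lat, dualB, ← h, LinearMap.BilinForm.mem_dualSubmodule]
  refine forall₂_congr fun y _ => ?_
  rw [Submodule.mem_one, Algebra.traceForm_apply]
  rfl

lemma norm_dual {b : Module.Basis (Fin 7) ℚ K} (hb : ∀ x : K, x ∈ Lat b ↔ ∃ y : 𝓞 K, (y : K) = x)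
    {x : K} (hx : x ∈ Lat (dualB b)) (hx0 : x ≠ 0) :
    1 ≤ |((Algebra.norm ℚ x : ℚ) : ℝ)| * |((Algebra.discr ℚ b : ℚ) : ℝ)| := by
  have hbm : ∀ i, b i ∈ Lat b := fun i => Submodule.subset_span ⟨i, rfl⟩
  have h1 : ∀ i j, ∃ n : ℤ, (n : ℚ) = Algebra.trace ℚ K (x * (b i * b j)) := by
    intro i j
    apply mem_dual.1 hx
    obtain ⟨y, hy⟩ := (hb _).1 (hbm i)
    obtain ⟨z, hz⟩ := (hb _).1 (hbm j)
    rw [hb]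
    exact ⟨y * z, by rw [← hy, ← hz]; simp⟩
  choose N hN using h1
  have h2 : (Matrix.of N).map (Int.castRingHom ℚ) = (Algebra.leftMulMatrix b x)ᵀ * Algebra.traceMatrix ℚ b := by
    ext i j
    rw [Matrix.map_apply, Matrix.of_apply, eq_intCast, hN, Matrix.mul_apply]
    simp only [transpose_apply, Algebra.traceMatrix_apply, Algebra.traceForm_apply]
    have h3 : x * b i = ∑ k, Algebra.leftMulMatrix b x k i • b k := by
      simp_rw [Algebra.leftMulMatrix_eq_repr_mul]
      exact (b.sum_repr (x * b i)).symm
    rw [← mul_assoc, h3, Finset.sum_mul, map_sum]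
    refine Finset.sum_congr rfl fun k _ => ?_
    rw [smul_mul_assoc, map_smul, smul_eq_mul]
  have h3 : (((Matrix.of N).det : ℤ) : ℚ) = Algebra.norm ℚ x * Algebra.discr ℚ b := by
    have := congrArg Matrix.det h2
    rw [← RingHom.mapMatrix_apply, ← RingHom.map_det, eq_intCast, det_mul, det_transpose,
      ← Algebra.norm_eq_matrix_det, ← Algebra.discr_def] at this
    exact this
  have h4 : (Matrix.of N).det ≠ 0 := by
    intro h
    rw [h] at h3
    have h5 : Algebra.norm ℚ x ≠ 0 := Algebra.norm_ne_zero_iff.2 hx0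
    have h6 : Algebra.discr ℚ b ≠ 0 := Algebra.discr_not_zero_of_basis ℚ b
    exact mul_ne_zero h5 h6 (by rw [← h3]; simp)
  have h5 := Int.one_le_abs h4
  have h6 : (1:ℚ) ≤ |Algebra.norm ℚ x| * |Algebra.discr ℚ b| := by
    rw [← abs_mul, ← h3]
    exact_mod_cast h5
  exact_mod_cast h6

lemma norm_int {x : K} (hx : ∃ y : 𝓞 K, (y : K) = x) (hx0 : x ≠ 0) :
    1 ≤ |((Algebra.norm ℚ x : ℚ) : ℝ)| := by
  obtain ⟨y, rfl⟩ := hx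
  have h1 : Algebra.norm ℚ (y : K) = ((Algebra.norm ℤ y : ℤ) : ℚ) := (Algebra.coe_norm_int y).symm
  have h2 : Algebra.norm ℤ y ≠ 0 := by
    intro h
    rw [h] at h1
    exact (Algebra.norm_ne_zero_iff.2 hx0) (by rw [h1]; simp)
  rw [h1]
  have := Int.one_le_abs h2
  exact_mod_cast this

theorem NF_id.{u} {K : Type u} [Field K] [NumberField K] (P : PD K) (hdeg : Module.finrank ℚ K = 7) (D : ℝ) (hD : D = |((discr K : ℤ) : ℝ)|) :
    ∃ (I : Type u) (J : Type u) (α : I → ℝ) (β : J → ℝ) (i1 i2 : I), i1 ≠ i2 ∧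
      α i1 = Real.log D - Real.log (4 * Real.pi^7) ∧ α i2 = Real.log D - Real.log (4 * Real.pi^7) ∧
      (∀ i, α i ≤ Real.log D - Real.log (4 * Real.pi^7)) ∧
      (∀ j, β j ≤ Real.log D - Real.log (4 * Real.pi^7)) ∧
      ∀ v : ℝ, ENNReal.ofReal (Real.exp (v/2)) * (ENNReal.ofReal (32 * Units.regulator K) + ∑' i, cf (α i - v)) =
        ENNReal.ofReal (32 * Units.regulator K) + ∑' j, cf (β j + v) ∧
        ENNReal.ofReal (32 * Units.regulator K) + ∑' i, cf (α i - v) < ⊤ := by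
  obtain ⟨b, hb, hdisc⟩ := exists_intBasis (K := K) hdeg
  have hD0 : 0 < D := by
    rw [hD]; exact abs_pos.2 (by exact_mod_cast discr_ne_zero K)
  have hDb : D = |((Algebra.discr ℚ b : ℚ) : ℝ)| := by rw [hdisc, hD]; simp
  have hcard : Fintype.card (K →+* ℂ) = 7 := by rw [Embeddings.card, hdeg]
  let e : Fin 7 ≃ (K →+* ℂ) := (Fintype.equivFinOfCardEq hcard).symm
  have hl1 : ∀ (r : 𝓞 K) (x : K), x ∈ Lat b → (r : K) * x ∈ Lat b := by
    intro r x hx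
    rw [hb] at hx ⊢
    obtain ⟨y, rfl⟩ := hx
    exact ⟨r * y, by simp⟩
  have hl2 : ∀ (r : 𝓞 K) (x : K), x ∈ Lat (dualB b) → (r : K) * x ∈ Lat (dualB b) := by
    intro r x hx
    rw [mem_dual] at hx ⊢
    intro y hy
    obtain ⟨n, hn⟩ := hx _ (hl1 r y hy)
    exact ⟨n, by rw [hn]; congr 1; ring⟩
  obtain ⟨S1, hS1, h1⟩ := P.lat_unfold b hl1 1 (Or.inl rfl)
  obtain ⟨S2, hS2, h2⟩ := P.lat_unfold (dualB b) hl2 (-1) (Or.inr rfl)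
  have m1 : (1 : K) ∈ Lat b := (hb _).2 ⟨1, by simp⟩
  have m2 : (-1 : K) ∈ Lat b := (hb _).2 ⟨-1, by simp⟩
  obtain ⟨y1, hy1, g1, hg1⟩ := hS1 ⟨⟨1, m1⟩, by
    intro h; have := congrArg Subtype.val h; simp at this⟩
  obtain ⟨y2, hy2, g2, hg2⟩ := hS1 ⟨⟨-1, m2⟩, by
    intro h; have := congrArg Subtype.val h; simp at this⟩
  simp only at hg1 hg2
  have hN : ∀ u : (𝓞 K)ˣ, |((Algebra.norm ℚ (u : K) : ℚ) : ℝ)| = 1 := by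
    intro u
    have := NumberField.isUnit_iff_norm.1 u.isUnit
    rw [RingOfIntegers.coe_norm] at this
    exact_mod_cast this
  set c7 := Real.log (4 * Real.pi^7) with hc7
  refine ⟨S1, S2, fun x => Real.log D - c7 - 2 * Real.log |((Algebra.norm ℚ ((x : Lat b) : K) : ℚ) : ℝ)|,
    fun x => Real.log D - c7 - 2 * (Real.log D + Real.log |((Algebra.norm ℚ ((x : Lat (dualB b)) : K) : ℚ) : ℝ)|),
    ⟨y1, hy1⟩, ⟨y2, hy2⟩, ?_, ?_, ?_, ?_, ?_, ?_⟩
  · intro h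
    have h' : y1 = y2 := congrArg Subtype.val h
    have h3 : (P.eps g1 : K) * 1 = P.eps g2 * (-1) := by rw [← hg1, ← hg2, h']
    have h4 : P.eps (g1 - g2) * P.eps g2 = P.eps g1 := by rw [← eps_add, sub_add_cancel]
    have hne : (P.eps g2 : K) ≠ 0 := by exact_mod_cast Units.coe_ne_zero (P.eps g2)
    have h5 : (P.eps (g1 - g2) : K) = -1 := by
      rw [← h4] at h3
      push_cast at h3
      apply mul_right_cancel₀ hne
      rw [mul_one] at h3
      rw [h3]; ring
    have h6 := P.eps_inj (g1 - g2) (fun i => by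
      rw [h5, show ((P.wr i) (-1 : K)) = 1 by rw [← InfinitePlace.norm_embedding_eq]; simp, Real.log_one])
    rw [h6, eps_zero] at h5
    have : (1 : K) = -1 := by simpa using h5
    norm_num at this
  · simp only [hg1, mul_one, hN, Real.log_one]; ring
  · simp only [hg2, mul_neg, mul_one]
    have : |((Algebra.norm ℚ (-(P.eps g2 : K)) : ℚ) : ℝ)| = 1 := by
      have := hN (-P.eps g2)
      simpa using this
    rw [this, Real.log_one]; ring
  · intro x
    have := Real.log_nonneg (norm_int ((hb _).1 x.1.1.2) (fun h0 => x.1.2 (Subtype.ext h0)))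
    linarith
  · intro x
    have h3 := norm_dual hb x.1.1.2 (fun h0 => x.1.2 (Subtype.ext h0))
    rw [← hDb] at h3
    have hn : |((Algebra.norm ℚ ((x : Lat (dualB b)) : K) : ℚ) : ℝ)| ≠ 0 := by
      intro h; rw [h] at h3; norm_num at h3
    have := Real.log_nonneg h3
    rw [Real.log_mul hn hD0.ne'] at this
    linarith
  · intro v
    set s := (v - Real.log D) / 2 with hs
    have t1 := h1 s
    have t2 := h2 (-s)
    push_cast at t1 t2
    have t3 : ENNReal.ofReal (Real.exp (v/2)) * ∫⁻ ξ in ZSpan.fundamentalDomain P.LB, theta (gram b (P.tt ((1:ℝ) • ξ) s)) =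
        ∫⁻ ξ in ZSpan.fundamentalDomain P.LB, theta (gram (dualB b) (P.tt ((-1:ℝ) • ξ) (-s))) := by
      rw [← lintegral_const_mul' _ _ ENNReal.ofReal_ne_top]
      apply lintegral_congr
      intro ξ
      rw [← P.theta_id e b ξ s D hDb hD0]
      congr 3
      rw [hs]; ring
    have t4 := P.theta_fin e b s
    rw [t1] at t3 t4
    rw [t2] at t3
    rw [ENNReal.tsum_mul_left] at t3 t4
    rw [ENNReal.tsum_mul_left] at t3
    have hcc : ∀ X Y : ℝ≥0∞, ENNReal.ofReal 32 * (X + ENNReal.ofReal (1/32) * Y) = ENNReal.ofReal 32 * X + Y := by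
      intro X Y
      rw [mul_add, ← mul_assoc, ← ENNReal.ofReal_mul (by norm_num)]
      norm_num
    have e1 : ∀ x : S1, -(c7 + 2 * s + 2 * Real.log |((Algebra.norm ℚ ((x : Lat b) : K) : ℚ) : ℝ)|) =
        Real.log D - c7 - 2 * Real.log |((Algebra.norm ℚ ((x : Lat b) : K) : ℚ) : ℝ)| - v := by
      intro x; rw [hs]; ring
    have e2 : ∀ x : S2, -(c7 + 2 * -s + 2 * Real.log |((Algebra.norm ℚ ((x : Lat (dualB b)) : K) : ℚ) : ℝ)|) =
        Real.log D - c7 - 2 * (Real.log D + Real.log |((Algebra.norm ℚ ((x : Lat (dualB b)) : K) : ℚ) : ℝ)|) + v := by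
      intro x; rw [hs]; ring
    simp_rw [e1] at t3 t4
    simp_rw [e2] at t3
    rw [ENNReal.ofReal_mul (by norm_num)]
    constructor
    · rw [← hcc, ← hcc, ← t3, ← mul_assoc, ← mul_assoc, mul_comm (ENNReal.ofReal 32)]
    · rw [← hcc]
      exact ENNReal.mul_lt_top ENNReal.ofReal_lt_top t4

end PD
end RegB
end

section
open MeasureTheory Set Filter Topology NumberField
open scoped ENNReal
namespace RegB

lemma MI_core {I J : Type*} (α : I → ℝ) (β : J → ℝ) (i1 i2 : I) (hi : i1 ≠ i2) (u : ℝ)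
    (h1 : α i1 = u) (h2 : α i2 = u) (hα : ∀ i, α i ≤ u) (hβ : ∀ j, β j ≤ u)
    (c : ℝ → ℝ) (c0 : ∀ x, 0 ≤ c x)
    (lc : ∀ x y v, x ≤ y → 0 ≤ v → c x * c (y+v) ≤ c (x+v) * c y) (S : ℝ)
    (sA : ∀ v, Summable fun i => c (α i - v)) (sB : ∀ v, Summable fun j => c (β j + v))
    (hid : ∀ v, Real.exp (v/2) * (S + ∑' i, c (α i - v)) = S + ∑' j, c (β j + v))
    (q d pb ρ : ℝ) (hd : 0 ≤ d) (hpb : 2*u - q - d ≤ pb) (hρ : 0 ≤ ρ)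
    (cp : 0 < c (pb + d)) (cq : 0 < c (q+d)) (hp : ρ * c pb ≤ c (pb+d))
    (hq : c q ≤ ρ * Real.exp (-d/2) * c (q+d)) :
    2 * (ρ * Real.exp (-d/2) * c (q+d) - c q) ≤
      S * (1 - ρ * Real.exp (-d/2) + (ρ - 1) * Real.exp (-(u-q)/2)) := by
  set σ := ρ * Real.exp (-d/2) with hσ
  have hσ0 : 0 ≤ σ := by positivity
  have k1 : ∀ x ≤ pb, ρ * c x ≤ c (x+d) := by
    intro x hx
    have := lc x pb d hx hd
    have t2 := mul_le_mul_of_nonneg_left this hρ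
    have t3 := mul_le_mul_of_nonneg_left hp (c0 (x+d))
    refine le_of_mul_le_mul_right ?_ cp
    nlinarith
  have k2 : ∀ x ≤ q, c x ≤ σ * c (x+d) := by
    intro x hx
    have := lc x q d hx hd
    have t3 := mul_le_mul_of_nonneg_left hq (c0 (x+d))
    refine le_of_mul_le_mul_right ?_ cq
    nlinarith
  set v2 := u - q with hv2
  have hB : ρ * ∑' j, c (β j + (v2 - d)) ≤ ∑' j, c (β j + v2) := by
    rw [← tsum_mul_left]
    refine Summable.tsum_le_tsum (fun j => ?_) ((sB _).mul_left _) (sB _)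
    have := k1 (β j + (v2 - d)) (by have := hβ j; linarith)
    rwa [show β j + (v2 - d) + d = β j + v2 by ring] at this
  have hA : 2 * (σ * c (q+d) - c q) ≤ σ * ∑' i, c (α i - (v2 - d)) - ∑' i, c (α i - v2) := by
    rw [← tsum_mul_left, ← Summable.tsum_sub ((sA _).mul_left _) (sA _)]
    have hs := ((sA (v2-d)).mul_left σ).sub (sA v2)
    classical
    have := hs.sum_le_tsum {i1, i2} (fun i _ => by
      have := k2 (α i - v2) (by have := hα i; linarith)
      rw [show α i - v2 + d = α i - (v2 - d) by ring] at this
      linarith)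
    rw [Finset.sum_pair hi] at this
    simp only [h1, h2] at this
    rw [show u - (v2 - d) = q + d by rw [hv2]; ring, show u - v2 = q by rw [hv2]; ring] at this
    linarith
  have e1 := hid (v2 - d)
  have e2 := hid v2
  set A1 := ∑' i, c (α i - (v2 - d))
  set A2 := ∑' i, c (α i - v2)
  set B1 := ∑' j, c (β j + (v2 - d))
  set B2 := ∑' j, c (β j + v2)
  have x1 : Real.exp ((v2 - d)/2) = Real.exp (v2/2) * Real.exp (-d/2) := by
    rw [← Real.exp_add]; congr 1; ring
  have x2 : Real.exp (-v2/2) * Real.exp (v2/2) = 1 := by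
    rw [← Real.exp_add]; simp [neg_div]
  set a2 := Real.exp (v2/2)
  set b2 := Real.exp (-v2/2)
  have hb2 : 0 < b2 := Real.exp_pos _
  rw [x1] at e1
  have f1 : ρ * (a2 * Real.exp (-d/2) * (S + A1) - S) ≤ a2 * (S + A2) - S := by
    rw [e1, e2]; linarith
  have f2 := mul_le_mul_of_nonneg_left f1 hb2.le
  have f3 : b2 * (ρ * (a2 * Real.exp (-d/2) * (S + A1) - S)) = σ * (S + A1) - b2 * ρ * S := by
    rw [hσ]; linear_combination (ρ * Real.exp (-d/2) * (S + A1)) * x2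
  have f4 : b2 * (a2 * (S + A2) - S) = S + A2 - b2 * S := by
    linear_combination (S + A2) * x2
  rw [f3, f4] at f2
  nlinarith

/-- real-valued version of `cf` -/
noncomputable def cr (w : ℝ) : ℝ := (cf w).toReal

theorem MI {K : Type*} [Field K] [NumberField K] (P : PD K) (hdeg : Module.finrank ℚ K = 7)
    (hreg : Units.regulator K ≤ 3.2) (u : ℝ)
    (hu : u = Real.log |((discr K : ℤ) : ℝ)| - Real.log (4 * Real.pi^7))
    (ua ub q d pb ρ el eu qU qdL pU pdL : ℝ) (h1 : ua ≤ u) (h2 : u ≤ ub)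
    (hd : 0 ≤ d) (hpb : 2*ub - q - d ≤ pb) (hρ : 1 ≤ ρ)
    (hel : el ≤ Real.exp (-d/2)) (heu : Real.exp (-(ua-q)/2) ≤ eu)
    (b1 : cf q ≤ ENNReal.ofReal qU) (b2 : ENNReal.ofReal qdL ≤ cf (q+d))
    (b3 : cf pb ≤ ENNReal.ofReal pU) (b4 : ENNReal.ofReal pdL ≤ cf (pb+d))
    (hqU : 0 ≤ qU) (hqdL : 0 < qdL) (hpU : 0 ≤ pU) (hpdL : 0 < pdL)
    (n1 : ρ * pU ≤ pdL) (n2 : qU < ρ * el * qdL)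
    (n3 : 51.2 * (1 - ρ * el + (ρ - 1) * eu) < ρ * el * qdL - qU) : False := by
  obtain ⟨I, J, α, β, i1, i2, hi, a1, a2, hα, hβ, hid⟩ := P.NF_id hdeg _ rfl
  rw [← hu] at a1 a2 hα hβ
  have R0 : 0 ≤ Units.regulator K := (Units.regulator_pos K).le
  have S0 : 0 ≤ 32 * Units.regulator K := by positivity
  have fA : ∀ v, ∑' i, cf (α i - v) ≠ ⊤ := fun v =>
    ((le_add_left le_rfl).trans_lt (hid v).2).ne
  have fB : ∀ v, ∑' j, cf (β j + v) ≠ ⊤ := fun v => by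
    refine ((le_add_left le_rfl).trans_lt ((hid v).1 ▸ ENNReal.mul_lt_top ENNReal.ofReal_lt_top (hid v).2)).ne
  have fc : ∀ w, cf w ≠ ⊤ := by
    intro w
    have := ENNReal.ne_top_of_tsum_ne_top (fA (u - w)) i1
    rwa [a1, sub_sub_cancel] at this
  have c0 : ∀ x, 0 ≤ cr x := fun x => ENNReal.toReal_nonneg
  have lo : ∀ L w, ENNReal.ofReal L ≤ cf w → L ≤ cr w := fun L w h =>
    (ENNReal.ofReal_le_iff_le_toReal (fc w)).1 h
  have hi' : ∀ U w, 0 ≤ U → cf w ≤ ENNReal.ofReal U → cr w ≤ U := fun U w h0 h =>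
    ENNReal.toReal_le_of_le_ofReal h0 h
  have lc : ∀ x y v, x ≤ y → 0 ≤ v → cr x * cr (y+v) ≤ cr (x+v) * cr y := by
    intro x y v hxy hv
    have := LC_cf x y v hxy hv
    have := ENNReal.toReal_mono (ENNReal.mul_ne_top (fc _) (fc _)) this
    rwa [ENNReal.toReal_mul, ENNReal.toReal_mul] at this
  have sA : ∀ v, Summable fun i => cr (α i - v) := fun v => ENNReal.summable_toReal (fA v)
  have sB : ∀ v, Summable fun j => cr (β j + v) := fun v => ENNReal.summable_toReal (fB v)
  have rid : ∀ v, Real.exp (v/2) * (32 * Units.regulator K + ∑' i, cr (α i - v)) =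
      32 * Units.regulator K + ∑' j, cr (β j + v) := by
    intro v
    have := congrArg ENNReal.toReal (hid v).1
    rw [ENNReal.toReal_mul, ENNReal.toReal_add ENNReal.ofReal_ne_top (fA v),
      ENNReal.toReal_add ENNReal.ofReal_ne_top (fB v), ENNReal.toReal_ofReal S0,
      ENNReal.toReal_ofReal (Real.exp_pos _).le, ENNReal.tsum_toReal_eq (fun _ => fc _),
      ENNReal.tsum_toReal_eq (fun _ => fc _)] at this
    exact this
  have l2 := lo _ _ b2
  have l4 := lo _ _ b4
  have l1 := hi' _ _ hqU b1
  have l3 := hi' _ _ hpU b3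
  have hρ0 : 0 ≤ ρ := by linarith
  have s1 : ρ * el ≤ ρ * Real.exp (-d/2) := mul_le_mul_of_nonneg_left hel hρ0
  have s2 : ρ * el * qdL ≤ ρ * Real.exp (-d/2) * cr (q+d) := by
    refine (mul_le_mul_of_nonneg_right s1 hqdL.le).trans ?_
    exact mul_le_mul_of_nonneg_left l2 (by positivity)
  have s3 : Real.exp (-(u-q)/2) ≤ eu := by
    refine le_trans (Real.exp_le_exp.2 ?_) heu
    linarith
  have main := MI_core α β i1 i2 hi u a1 a2 hα hβ cr c0 lc _ sA sB rid q d pb ρ hd (by linarith) hρ0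
    (by linarith) (by linarith) (by nlinarith) (by linarith)
  have s4 : (ρ - 1) * Real.exp (-(u-q)/2) ≤ (ρ - 1) * eu := mul_le_mul_of_nonneg_left s3 (by linarith)
  have s5 : 32 * Units.regulator K * (1 - ρ * Real.exp (-d/2) + (ρ - 1) * Real.exp (-(u-q)/2)) ≤
    32 * Units.regulator K * (1 - ρ * el + (ρ - 1) * eu) := mul_le_mul_of_nonneg_left (by linarith) S0
  rcases le_or_gt 0 (1 - ρ * el + (ρ - 1) * eu) with h | h
  · nlinarith
  · nlinarith

end RegB
end

section
open MeasureTheory Set Filter Topology NumberField Matrix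
open scoped ENNReal ComplexOrder
namespace RegB

lemma hadamard7 (A : Matrix (Fin 7) (Fin 7) ℂ) (t : Fin 7 → ℝ) (ht : ∀ k, 0 < t k)
    (h : ∀ k, ∑ i, ‖A i k‖^2 ≤ t k) : ‖A.det‖^2 ≤ ∏ k, t k := by
  set M : Matrix (Fin 7) (Fin 7) ℂ := A * diagonal (fun k => (((Real.sqrt (t k))⁻¹ : ℝ) : ℂ)) with hM
  have hG := Matrix.posSemidef_conjTranspose_mul_self M
  have h1 := hG.1.det_eq_prod_eigenvalues
  have h2 := hG.1.trace_eq_sum_eigenvalues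
  have htr : (Mᴴ * M).trace = ((∑ k, ∑ i, ‖A i k‖^2 * (t k)⁻¹ : ℝ) : ℂ) := by
    simp only [Matrix.trace, Matrix.diag, Matrix.mul_apply, conjTranspose_apply]
    push_cast
    refine Finset.sum_congr rfl fun k _ => Finset.sum_congr rfl fun i _ => ?_
    rw [hM, mul_diagonal, star_mul', Complex.star_def, Complex.conj_ofReal]
    have e1 : ((starRingEnd ℂ) (A i k)) * A i k = (‖A i k‖:ℂ)^2 := Complex.conj_mul' _
    have e2 : (((Real.sqrt (t k))⁻¹ : ℝ) : ℂ) * (((Real.sqrt (t k))⁻¹ : ℝ) : ℂ) = (t k : ℂ)⁻¹ := by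
      rw [← Complex.ofReal_mul, ← mul_inv, Real.mul_self_sqrt (ht k).le, Complex.ofReal_inv]
    linear_combination ((((Real.sqrt (t k))⁻¹ : ℝ) : ℂ) * (((Real.sqrt (t k))⁻¹ : ℝ) : ℂ)) * e1 + (‖A i k‖:ℂ)^2 * e2
  have hsum : ∑ i, hG.1.eigenvalues i ≤ 7 := by
    have e : ((∑ i, hG.1.eigenvalues i : ℝ) : ℂ) = ((∑ k, ∑ i, ‖A i k‖^2 * (t k)⁻¹ : ℝ) : ℂ) := by
      rw [← htr, h2]; push_cast; rfl
    have e' := Complex.ofReal_injective e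
    rw [e']
    calc ∑ k, ∑ i, ‖A i k‖^2 * (t k)⁻¹ ≤ ∑ k : Fin 7, (1:ℝ) := by
          refine Finset.sum_le_sum fun k _ => ?_
          rw [← Finset.sum_mul, ← div_eq_mul_inv]
          exact (div_le_one (ht k)).2 (h k)
      _ = 7 := by simp
  have hprod : ∏ i, hG.1.eigenvalues i ≤ 1 := by
    calc ∏ i, hG.1.eigenvalues i ≤ ∏ i, Real.exp (hG.1.eigenvalues i - 1) := by
          refine Finset.prod_le_prod (fun i _ => hG.eigenvalues_nonneg i) fun i _ => ?_
          have := Real.add_one_le_exp (hG.1.eigenvalues i - 1)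
          linarith
      _ = Real.exp (∑ i, (hG.1.eigenvalues i - 1)) := (Real.exp_sum _ _).symm
      _ ≤ 1 := by
          rw [Real.exp_le_one_iff, Finset.sum_sub_distrib]
          simp; linarith
  have hdet : (Mᴴ * M).det = ((‖A.det‖^2 * ∏ k, (t k)⁻¹ : ℝ) : ℂ) := by
    rw [det_mul, det_conjTranspose, Complex.star_def, Complex.conj_mul', hM, det_mul, det_diagonal]
    rw [← Complex.ofReal_prod, norm_mul, Complex.norm_real, ← Complex.ofReal_pow, mul_pow,
      Real.norm_eq_abs, sq_abs, ← Finset.prod_pow]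
    simp_rw [inv_pow, Real.sq_sqrt (ht _).le]
  have hfin : ‖A.det‖^2 * ∏ k, (t k)⁻¹ ≤ 1 := by
    have e : ((‖A.det‖^2 * ∏ k, (t k)⁻¹ : ℝ) : ℂ) = ((∏ i, hG.1.eigenvalues i : ℝ) : ℂ) := by
      rw [← hdet, h1]; push_cast; rfl
    rw [Complex.ofReal_injective e]; exact hprod
  have hp : 0 < ∏ k, t k := Finset.prod_pos fun k _ => ht k
  rw [Finset.prod_inv_distrib, ← div_eq_mul_inv, div_le_one hp] at hfin
  exact hfin

lemma vol_ell (r : ℝ) (hr : 0 < r) : volume {ξ : Fin 5 → ℝ | ∑ i, (ξ i + 7/40 * ∑ j, ξ j)^2 < r^2} =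
    ENNReal.ofReal (r^5 * (8 * Real.pi^2 / 15) / 1.875) := by
  let C1 : Matrix (Fin 5) Unit ℝ := replicateCol Unit (fun _ => (7/40:ℝ))
  let C2 : Matrix Unit (Fin 5) ℝ := replicateRow Unit (fun _ => (1:ℝ))
  let B : Matrix (Fin 5) (Fin 5) ℝ := 1 + C1 * C2
  have hdet : LinearMap.det (Matrix.toLin' B) = 1.875 := by
    rw [LinearMap.det_toLin']
    refine (det_one_add_replicateCol_mul_replicateRow (ι := Unit) _ _).trans ?_
    simp [dotProduct]; norm_num
  have happ : ∀ ξ i, Matrix.toLin' B ξ i = ξ i + 7/40 * ∑ j, ξ j := by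
    intro ξ i
    simp only [B, toLin'_apply, add_mulVec, one_mulVec, Pi.add_apply, ← mulVec_mulVec]
    simp [C1, C2, mulVec, dotProduct]
  have hset : {ξ : Fin 5 → ℝ | ∑ i, (ξ i + 7/40 * ∑ j, ξ j)^2 < r^2} =
      Matrix.toLin' B ⁻¹' ((WithLp.toLp 2) ⁻¹' (Metric.ball (0 : EuclideanSpace ℝ (Fin 5)) r)) := by
    ext ξ
    simp only [mem_ofPred_eq, mem_preimage, mem_ball_zero_iff]
    rw [EuclideanSpace.norm_eq, Real.sqrt_lt' hr]
    simp only [Real.norm_eq_abs, sq_abs, happ]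
  rw [hset, Measure.addHaar_preimage_linearMap _ (by rw [hdet]; norm_num), hdet,
    (PiLp.volume_preserving_toLp (Fin 5)).measure_preimage measurableSet_ball.nullMeasurableSet,
    InnerProductSpace.volume_ball_of_dim_odd (k := 2) (by simp)]
  rw [finrank_euclideanSpace_fin, ← ENNReal.ofReal_pow hr.le, ← ENNReal.ofReal_mul (by positivity),
    ← ENNReal.ofReal_mul (by positivity)]
  congr 1
  rw [show Nat.doubleFactorial 5 = 15 by rfl, abs_of_pos (by norm_num)]
  push_cast
  ring

lemma sumsq_le (ξ : Fin 5 → ℝ) : ∑ i, ξ i^2 + 1/2 * (∑ i, ξ i)^2 ≤ ∑ i, (ξ i + 7/40 * ∑ j, ξ j)^2 := by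
  set s := ∑ j, ξ j with hs
  have : ∑ i, (ξ i + 7/40 * s)^2 = ∑ i, ξ i^2 + 2 * (7/40) * s * s + 5 * (7/40*s)^2 := by
    calc ∑ i, (ξ i + 7/40 * s)^2 = ∑ i, (ξ i^2 + 2 * (7/40) * s * ξ i + (7/40*s)^2) :=
          Finset.sum_congr rfl fun i _ => by ring
      _ = _ := by
          rw [Finset.sum_add_distrib, Finset.sum_add_distrib, ← Finset.mul_sum, ← hs]
          simp
  rw [this]
  nlinarith [sq_nonneg s]

namespace PD
variable {K : Type*} [Field K] [NumberField K] (P : PD K)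

lemma exists_unit (hreg : Units.regulator K ≤ 3.2) : ∃ g : Fin 5 → ℤ, g ≠ 0 ∧
    ∑ i, (Real.log (P.wr i (P.eps g : K)))^2 + 1/2 * (∑ i, Real.log (P.wr i (P.eps g : K)))^2 ≤ 2.054^2 := by
  set s := {ξ : Fin 5 → ℝ | ∑ i, (ξ i + 7/40 * ∑ j, ξ j)^2 < 2.054^2} with hs
  have hconv : Convex ℝ s := by
    have : ConvexOn ℝ univ (fun ξ : Fin 5 → ℝ => ∑ i, (ξ i + 7/40 * ∑ j, ξ j)^2) := by
      let l : Fin 5 → ((Fin 5 → ℝ) →ₗ[ℝ] ℝ) := fun i => LinearMap.proj i + (7/40:ℝ) • ∑ j, LinearMap.proj j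
      have hl : ∀ i ξ, l i ξ = ξ i + 7/40 * ∑ j, ξ j := by intro i ξ; simp [l]
      have hc : ∀ i, ConvexOn ℝ univ (fun ξ : Fin 5 → ℝ => (l i ξ)^2) := fun i =>
        ((even_two.convexOn_pow (𝕜 := ℝ)).comp_linearMap (l i))
      simp_rw [← hl]
      simp_rw [Fin.sum_univ_five]
      exact ((((hc 0).add (hc 1)).add (hc 2)).add (hc 3)).add (hc 4)
    have h2 := this.convex_lt (2.054^2)
    simpa [hs] using h2
  have hsymm : ∀ x ∈ s, -x ∈ s := by
    intro x hx
    simp only [hs, mem_ofPred_eq] at hx ⊢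
    convert hx using 2
    simp only [Pi.neg_apply, Finset.sum_neg_distrib]; ring
  have hcnt : Countable (Submodule.span ℤ (range P.LB)).toAddSubgroup :=
    inferInstanceAs (Countable (Submodule.span ℤ (range P.LB)))
  obtain ⟨x, hx0, hxs⟩ := exists_ne_zero_mem_lattice_of_measure_mul_two_pow_lt_measure
    (ZSpan.isAddFundamentalDomain' P.LB volume) hsymm hconv (by
      rw [P.vol_FD, vol_ell _ (by norm_num), Module.finrank_fin_fun,
        show (2:ℝ≥0∞)^5 = ENNReal.ofReal 32 by norm_num, ← ENNReal.ofReal_mul (Units.regulator_pos K).le]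
      rw [ENNReal.ofReal_lt_ofReal_iff (by positivity)]
      have := Real.pi_gt_d6
      have h2 : (3.141592:ℝ)^2 < Real.pi^2 := by gcongr
      refine lt_of_le_of_lt (mul_le_mul_of_nonneg_right hreg (by norm_num)) ?_
      norm_num at h2 ⊢
      linarith)
  obtain ⟨x, hx⟩ := x
  obtain ⟨g, hg⟩ : ∃ g : Fin 5 → ℤ, ∑ j, (g j : ℝ) • P.LB j = x := by
    have := (Submodule.mem_span_range_iff_exists_fun ℤ).1 hx
    obtain ⟨g, hg⟩ := this
    exact ⟨g, by rw [← hg]; exact Finset.sum_congr rfl fun j _ => Int.cast_smul_eq_zsmul ℝ _ _⟩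
  refine ⟨g, ?_, ?_⟩
  · rintro rfl
    apply hx0
    have : x = 0 := by rw [← hg]; simp
    exact Subtype.ext this
  · simp_rw [P.log_eps, hg]
    exact (sumsq_le x).trans (le_of_lt hxs)

lemma discr_le (ε : (𝓞 K)ˣ) (hdeg : Module.finrank ℚ K = 7) (hε : ∀ r : ℚ, (algebraMap ℚ K r) ≠ (ε : K)) :
    |((discr K : ℤ) : ℝ)| ≤ |((Algebra.discr ℚ (fun k : Fin 7 => ((ε ^ ((k : ℤ) - 3) : (𝓞 K)ˣ) : K)) : ℚ) : ℝ)| := by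
  obtain ⟨b, hb, hdisc⟩ := exists_intBasis (K := K) hdeg
  set p : Fin 7 → K := fun k : Fin 7 => ((ε ^ ((k : ℤ) - 3) : (𝓞 K)ˣ) : K) with hp
  have hε0 : (ε : K) ≠ 0 := by exact_mod_cast Units.coe_ne_zero ε
  have hpk : ∀ k, p k = (ε : K)^(-3 : ℤ) * (ε : K)^(k : ℕ) := by
    intro k
    rw [hp]
    simp only
    rw [Units.coe_zpow, sub_eq_neg_add, zpow_add₀ hε0, zpow_natCast]
  have hdegm : (minpoly ℚ (ε : K)).natDegree = 7 := by
    have hint : IsIntegral ℚ (ε : K) := IsIntegral.of_finite ℚ _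
    have h1 := minpoly.degree_dvd hint
    rw [hdeg] at h1
    rcases (Nat.dvd_prime (by norm_num : Nat.Prime 7)).1 h1 with h | h
    · exfalso
      obtain ⟨r, hr⟩ := minpoly.natDegree_eq_one_iff.1 h
      exact hε r hr
    · exact h
  have hli : LinearIndependent ℚ p := by
    have h1 := linearIndependent_pow (K := ℚ) (ε : K)
    rw [hdegm] at h1
    have h2 := h1.map' (LinearMap.mulLeft ℚ ((ε : K)^(-3 : ℤ))) (by
      rw [LinearMap.ker_eq_bot]
      exact fun x y hxy => mul_left_cancel₀ (zpow_ne_zero _ hε0) hxy)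
    have h3 : p = (LinearMap.mulLeft ℚ ((ε : K)^(-3 : ℤ))) ∘ fun i : Fin 7 => (ε : K)^(i : ℕ) := by
      ext k
      rw [hpk]; rfl
    rw [h3]; exact h2
  have hp0 : Algebra.discr ℚ p ≠ 0 := by
    have := Algebra.discr_not_zero_of_basis ℚ (basisOfLinearIndependentOfCardEqFinrank hli (by simp [hdeg]))
    simpa using this
  have hM : ∀ k, ∃ m : Fin 7 → ℤ, ∑ j, m j • b j = p k := by
    intro k
    have : p k ∈ Lat b := (hb _).2 ⟨_, rfl⟩
    exact (Submodule.mem_span_range_iff_exists_fun ℤ).1 this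
  choose M hM using hM
  have h1 : p = ((Matrix.of M).map (Int.cast : ℤ → ℚ)).map (algebraMap ℚ K) *ᵥ b := by
    ext k
    rw [← hM k]
    simp [mulVec, dotProduct]
  have h2 := Algebra.discr_of_matrix_mulVec (b : Fin 7 → K) ((Matrix.of M).map (Int.cast : ℤ → ℚ))
  rw [← h1] at h2
  have h3 : ((Matrix.of M).map (Int.cast : ℤ → ℚ)).det = ((Matrix.of M).det : ℤ) := by
    have := RingHom.map_det (Int.castRingHom ℚ) (Matrix.of M)
    rw [eq_intCast] at this
    rw [this]; rfl
  rw [h3, hdisc] at h2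
  have h4 : (Matrix.of M).det ≠ 0 := by
    intro h; rw [h] at h2; apply hp0; rw [h2]; simp
  have h5 : 1 ≤ |(Matrix.of M).det| := Int.one_le_abs h4
  generalize (Matrix.of M).det = m at h2 h5
  rw [h2]
  push_cast
  rw [abs_mul, abs_pow]
  have h6 : (1:ℝ) ≤ |(m : ℝ)| := by exact_mod_cast h5
  exact le_mul_of_one_le_left (abs_nonneg _) (one_le_pow₀ h6)

theorem log_discr_le (P : PD K) (hdeg : Module.finrank ℚ K = 7) (hreg : Units.regulator K ≤ 3.2) :
    |((discr K : ℤ) : ℝ)| ≤ 7^7 * Real.exp 32.61 := by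
  obtain ⟨g, hg0, hg⟩ := P.exists_unit hreg
  set ε := P.eps g with hεd
  have hε : ∀ r : ℚ, (algebraMap ℚ K r) ≠ (ε : K) := by
    intro r hr
    apply hg0
    have hw : ∀ w : InfinitePlace K, w (ε : K) = |(r : ℝ)| := by
      intro w
      rw [← hr, ← InfinitePlace.norm_embedding_eq, eq_ratCast, map_ratCast, Complex.norm_ratCast]
    have hn := P.norm_eq (ε : K)
    have hl := P.log_wc ε
    simp only [hw] at hl
    simp at hl
    refine P.eps_inj g fun i => ?_
    rw [← hεd, hw, Real.log_abs]
    linarith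
  refine (discr_le ε hdeg hε).trans ?_
  set p : Fin 7 → K := fun k : Fin 7 => ((ε ^ ((k : ℤ) - 3) : (𝓞 K)ˣ) : K) with hp
  have hcard : Fintype.card (K →+* ℂ) = 7 := by rw [Embeddings.card, hdeg]
  let e : Fin 7 ≃ (K →+* ℂ) := (Fintype.equivFinOfCardEq hcard).symm
  have h1 : |((Algebra.discr ℚ p : ℚ) : ℝ)| = ‖(emb e p).det‖^2 := by
    rw [← norm_pow, ← emb_det_sq, Complex.norm_ratCast]
  rw [h1]
  set x : InfinitePlace K → ℝ := fun w => Real.log (w (ε : K)) with hx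
  have h2 := hadamard7 (emb e p) (fun k => 7 * Real.exp (6 * |x (InfinitePlace.mk (e k))|))
    (fun k => by positivity) (by
      intro k
      have hb : ∀ i : Fin 7, ‖emb e p i k‖^2 ≤ Real.exp (6 * |x (InfinitePlace.mk (e k))|) := by
        intro i
        have hpos := w_unit_pos (InfinitePlace.mk (e k)) ε
        have e1 : ‖emb e p i k‖ = Real.exp (x (InfinitePlace.mk (e k)))^((i:ℤ)-3) := by
          rw [hx]
          simp only
          rw [Real.exp_log hpos]
          simp only [emb, of_apply, hp]
          rw [← InfinitePlace.apply, Units.coe_zpow, map_zpow₀]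
        rw [e1, ← Real.rpow_intCast, ← Real.exp_mul, ← Real.exp_nat_mul, Real.exp_le_exp]
        have hi1 : ((i:ℤ):ℝ) ≤ 6 := by have := i.2; norm_cast; omega
        have hi2 : (0:ℝ) ≤ ((i:ℤ):ℝ) := by positivity
        push_cast
        push_cast at hi1 hi2
        generalize x (InfinitePlace.mk (e k)) = y
        rcases abs_cases y with ⟨h, _⟩ | ⟨h, _⟩ <;> rw [h] <;> nlinarith
      refine (Finset.sum_le_sum fun i _ => hb i).trans ?_
      simp)
  refine h2.trans ?_
  rw [Finset.prod_mul_distrib, ← Real.exp_sum, ← Finset.mul_sum]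
  simp only [Finset.prod_const, Finset.card_univ, Fintype.card_fin]
  have h3 : ∑ k, |x (InfinitePlace.mk (e k))| = ∑ φ : K →+* ℂ, |x (InfinitePlace.mk φ)| :=
    Equiv.sum_comp e (fun φ => |x (InfinitePlace.mk φ)|)
  have h4 : (∑ k, |x (InfinitePlace.mk (e k))|)^2 ≤ 7 * ∑ k, |x (InfinitePlace.mk (e k))|^2 := by
    have := sq_sum_le_card_mul_sum_sq (s := (Finset.univ : Finset (Fin 7))) (f := fun k => |x (InfinitePlace.mk (e k))|)
    simpa using this
  have h5 : ∑ k, |x (InfinitePlace.mk (e k))|^2 = ∑ φ : K →+* ℂ, |x (InfinitePlace.mk φ)|^2 :=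
    Equiv.sum_comp e (fun φ => |x (InfinitePlace.mk φ)|^2)
  have h6 := P.sum_emb (fun w => |x w|^2)
  have h7 : ∑ k, |x (InfinitePlace.mk (e k))|^2 ≤ 2.054^2 := by
    rw [h5, h6]
    have hl := P.log_wc ε
    simp only [sq_abs, hx]
    refine le_trans (le_of_eq ?_) hg
    rw [show Real.log (P.wc (ε:K)) = -(∑ i, Real.log (P.wr i (ε:K)))/2 by linarith]
    ring
  have h8 : ∑ k, |x (InfinitePlace.mk (e k))| ≤ 5.435 := by
    refine abs_le_of_sq_le_sq' ?_ (by norm_num) |>.2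
    refine h4.trans ((mul_le_mul_of_nonneg_left h7 (by norm_num)).trans ?_)
    norm_num
  gcongr
  linarith

end PD
end RegB
end

section
open MeasureTheory Set Filter Topology NumberField
open scoped ENNReal
namespace RegB

/-- running integral -/
noncomputable def Ji (g : ℝ → ℝ≥0∞) (z : ℝ) : ℝ≥0∞ := ∫⁻ b in Iic z, g b

lemma Ji_eq (g : ℝ → ℝ≥0∞) (w x : ℝ) : ∫⁻ a in Ici x, g (w - a) = Ji g (w - x) := by
  unfold Ji
  rw [← lintegral_indicator measurableSet_Ici, ← lintegral_indicator measurableSet_Iic,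
    ← lintegral_sub_left_eq_self _ w]
  apply lintegral_congr
  intro a
  simp only [indicator, mem_Ici, mem_Iic, sub_sub_cancel]
  have : x ≤ w - a ↔ a ≤ w - x := by constructor <;> intro h <;> linarith
  simp [this]

lemma sp_ci (f : ℝ → ℝ≥0∞) {y z : ℝ} (h : y ≤ z) :
    ∫⁻ a in Ici y, f a = (∫⁻ a in Ico y z, f a) + ∫⁻ a in Ici z, f a := by
  rw [← Ico_union_Ici_eq_Ici h, lintegral_union measurableSet_Ici
      (Set.disjoint_left.2 fun a h1 h2 => absurd h1.2 (not_lt.2 h2))]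

lemma sp_cc (f : ℝ → ℝ≥0∞) {x y z : ℝ} (h : x ≤ y) (h' : y ≤ z) :
    ∫⁻ a in Ico x z, f a = (∫⁻ a in Ico x y, f a) + ∫⁻ a in Ico y z, f a := by
  rw [← Ico_union_Ico_eq_Ico h h', lintegral_union measurableSet_Ico
      (Set.disjoint_left.2 fun a h1 h2 => absurd h1.2 (not_lt.2 h2.1))]

lemma sp_J (g : ℝ → ℝ≥0∞) (w : ℝ) {y z : ℝ} (h : y ≤ z) :
    Ji g (w - y) = (∫⁻ a in Ico y z, g (w - a)) + Ji g (w - z) := by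
  rw [← Ji_eq, ← Ji_eq, sp_ci _ h]

lemma cell_split (f : ℝ → ℝ≥0∞) (hf : Measurable f) (x h : ℝ) (hh : 0 < h) :
    ∫⁻ a in Ico x (x + h), f a = ∫⁻ a in Ioo x (x + h/2), (f a + f (2*x + h - a)) := by
  rw [lintegral_add_left hf]
  have e : ∫⁻ a in Ioo x (x + h/2), f (2*x + h - a) = ∫⁻ a in Ioo (x + h/2) (x + h), f a := by
    rw [← lintegral_indicator measurableSet_Ioo, ← lintegral_indicator measurableSet_Ioo,
      ← lintegral_sub_left_eq_self _ (2*x+h)]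
    apply lintegral_congr
    intro a
    have : 2*x+h-a ∈ Ioo x (x+h/2) ↔ a ∈ Ioo (x+h/2) (x+h) := by
      simp only [mem_Ioo]; constructor <;> rintro ⟨h1, h2⟩ <;> constructor <;> linarith
    simp only [indicator, this, sub_sub_cancel]
    congr
  rw [e, sp_cc f (show x ≤ x + h/2 by linarith) (show x+h/2 ≤ x+h by linarith),
    setLIntegral_congr Ioo_ae_eq_Ico, setLIntegral_congr Ioo_ae_eq_Ico]

lemma cell_up {κ g : ℝ → ℝ≥0∞} (hκ : Monotone κ) (hg : Monotone g) (w x h : ℝ) (hh : 0 < h)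
    (U : ℝ≥0∞)
    (H : ∀ a, x ≤ a → a ≤ x + h/2 → κ a + κ (2*x + h - a) ≤ 2 * U) :
    ∫⁻ a in Ico x (x+h), κ a * g (w - a) ≤ U * ∫⁻ a in Ico x (x+h), g (w - a) := by
  have mk := hκ.measurable
  have mg := hg.measurable
  rw [cell_split _ (by fun_prop) x h hh, cell_split (fun a => g (w - a)) (by fun_prop) x h hh,
    ← lintegral_const_mul _ (by fun_prop)]
  apply setLIntegral_mono (by fun_prop)
  intro a ha
  have h1 := H a ha.1.le ha.2.le
  have k1 : κ a ≤ κ (2*x+h-a) := hκ (by linarith [ha.2])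
  have g1 : g (w - (2*x+h-a)) ≤ g (w - a) := hg (by linarith [ha.2])
  have r := rearr (P := κ a) (Q := κ (2*x+h-a)) (A := g (w - (2*x+h-a))) (B := g (w - a))
    (Or.inr ⟨k1, g1⟩)
  refine (ENNReal.mul_le_mul_iff_right (a := 2) (by norm_num) (by norm_num)).1 ?_
  calc 2 * (κ a * g (w - a) + κ (2*x+h-a) * g (w - (2*x+h-a)))
      = κ a * g (w - a) + κ (2*x+h-a) * g (w - (2*x+h-a)) +
        (κ a * g (w - a) + κ (2*x+h-a) * g (w - (2*x+h-a))) := two_mul _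
    _ ≤ (κ a * g (w - (2*x+h-a)) + κ (2*x+h-a) * g (w - a)) +
        (κ a * g (w - a) + κ (2*x+h-a) * g (w - (2*x+h-a))) := by gcongr
    _ = (κ a + κ (2*x+h-a)) * (g (w - a) + g (w - (2*x+h-a))) := by ring
    _ ≤ (2 * U) * (g (w - a) + g (w - (2*x+h-a))) := by gcongr
    _ = _ := by ring

lemma cell_low {κ g : ℝ → ℝ≥0∞} (hκ : Monotone κ) (hg : Monotone g) (w x h : ℝ) (hh : 0 < h)
    (L c : ℝ≥0∞) (H0 : L ≤ κ x)
    (H : ∀ a, x ≤ a → a ≤ x + h/2 → L + (L + c) ≤ κ a + κ (2*x + h - a)) :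
    L * Ji g (w - x) + c * Ji g (w - (x + h/2)) ≤
      (∫⁻ a in Ico x (x+h), κ a * g (w - a)) + (L + c) * Ji g (w - (x + h)) := by
  have mk := hκ.measurable
  have mg := hg.measurable
  have e : ∫⁻ a in Ico (x+h/2) (x + h), g (w - a) =
      ∫⁻ a in Ioo x (x + h/2), g (w - (2*x + h - a)) := by
    rw [← setLIntegral_congr Ioo_ae_eq_Ico]
    rw [← lintegral_indicator measurableSet_Ioo, ← lintegral_indicator measurableSet_Ioo,
      ← lintegral_sub_left_eq_self _ (2*x+h)]
    apply lintegral_congr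
    intro a
    have : 2*x+h-a ∈ Ioo (x+h/2) (x+h) ↔ a ∈ Ioo x (x+h/2) := by
      simp only [mem_Ioo]; constructor <;> rintro ⟨h1, h2⟩ <;> constructor <;> linarith
    simp only [indicator, this]
  rw [sp_J g w (y := x) (z := x+h/2) (by linarith), sp_J g w (y := (x+h/2)) (z := x+h) (by linarith), e,
    ← setLIntegral_congr Ioo_ae_eq_Ico, cell_split _ (by fun_prop) x h hh]
  have key : L * (∫⁻ a in Ioo x (x+h/2), g (w - a)) +
      (L + c) * (∫⁻ a in Ioo x (x + h/2), g (w - (2*x + h - a))) ≤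
      ∫⁻ a in Ioo x (x + h/2), (κ a * g (w - a) + κ (2*x+h-a) * g (w - (2*x+h-a))) := by
    rw [← lintegral_const_mul _ (by fun_prop), ← lintegral_const_mul _ (by fun_prop),
      ← lintegral_add_left (by fun_prop)]
    apply setLIntegral_mono (by fun_prop)
    intro a ha
    have h1 := H a ha.1.le ha.2.le
    have k1 : L ≤ κ a := H0.trans (hκ ha.1.le)
    have g1 : g (w - (2*x+h-a)) ≤ g (w - a) := hg (by linarith [ha.2])
    obtain ⟨δ, hδ⟩ := exists_add_of_le g1
    rw [hδ]
    calc L * (g (w - (2*x+h-a)) + δ) + (L + c) * g (w - (2*x+h-a))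
        = (L + (L + c)) * g (w - (2*x+h-a)) + L * δ := by ring
      _ ≤ (κ a + κ (2*x+h-a)) * g (w - (2*x+h-a)) + κ a * δ := by gcongr
      _ = _ := by ring
  calc _ = L * (∫⁻ a in Ioo x (x+h/2), g (w - a)) +
      (L + c) * (∫⁻ a in Ioo x (x + h/2), g (w - (2*x + h - a))) +
      (L + c) * Ji g (w - (x+h)) := by ring
    _ ≤ _ := by gcongr

theorem op_up {κ g : ℝ → ℝ≥0∞} (hκ : Monotone κ) (hg : Monotone g) (s h : ℝ) (hh : 0 < h)
    (c : ℕ → ℝ≥0∞) (N : ℕ)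
    (H : ∀ j < N, ∀ a, s + j*h ≤ a → a ≤ s + j*h + h/2 →
      κ a + κ (2*(s+j*h) + h - a) ≤ 2 * ∑ i ∈ Finset.range (j+1), c i)
    (H2 : ∀ a, κ a ≤ ∑ i ∈ Finset.range (N+1), c i) (w : ℝ) :
    cv κ g w ≤ ∑ i ∈ Finset.range (N+1), c i * Ji g (w - (s + i*h)) +
      ∫⁻ a in Iio s, κ a * g (w - a) := by
  have mk := hκ.measurable
  have mg := hg.measurable
  have claim : ∀ n ≤ N, (∫⁻ a in Ico s (s + n*h), κ a * g (w - a)) +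
      (∑ i ∈ Finset.range (n+1), c i) * Ji g (w - (s + n*h)) ≤
      ∑ i ∈ Finset.range (n+1), c i * Ji g (w - (s + i*h)) := by
    intro n
    induction n with
    | zero => intro _; simp
    | succ n ih =>
      intro hn
      have ih := ih (by omega)
      rw [Finset.sum_range_succ (fun i => c i * Ji g (w - (s + i*h))),
        Finset.sum_range_succ c]
      have e1 : s + ((n+1 : ℕ) : ℝ)*h = s + n*h + h := by push_cast; ring
      have hnh : 0 ≤ n * h := by positivity
      rw [e1, add_mul, ← add_assoc]
      gcongr
      refine le_trans ?_ ih
      rw [sp_J g w (y := (s+n*h)) (z := s+n*h+h) (by linarith), mul_add, ← add_assoc]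
      gcongr
      rw [sp_cc _ (show s ≤ s + n*h by linarith) (show s+n*h ≤ s+n*h+h by linarith)]
      gcongr
      exact cell_up hκ hg w _ h hh _ (H n (by omega))
  have hNh : 0 ≤ N * h := by positivity
  have e : cv κ g w = (∫⁻ a in Ico s (s + N*h), κ a * g (w - a)) +
      (∫⁻ a in Ici (s + N*h), κ a * g (w - a)) + ∫⁻ a in Iio s, κ a * g (w - a) := by
    unfold cv
    rw [← sp_ci _ (by linarith), ← lintegral_union (A := Ici s) measurableSet_Iio
      (Set.disjoint_left.2 fun a h1 h2 => absurd (mem_Ici.1 h1) (not_le.2 h2)), Ici_union_Iio,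
      setLIntegral_univ]
  rw [e]
  gcongr
  refine le_trans ?_ (claim N le_rfl)
  gcongr
  rw [← Ji_eq, ← lintegral_const_mul _ (by fun_prop)]
  gcongr with a
  exact H2 a

theorem op_low {κ g : ℝ → ℝ≥0∞} (hκ : Monotone κ) (hg : Monotone g) (s h : ℝ) (hh : 0 < h)
    (c : ℕ → ℝ≥0∞) (N : ℕ)
    (H0 : ∀ j ≤ N, ∑ i ∈ Finset.range j, c i ≤ κ (s + j*h))
    (H : ∀ j < N, ∀ a, s + j*h ≤ a → a ≤ s + j*h + h/2 →
      ∑ i ∈ Finset.range j, c i + ∑ i ∈ Finset.range (j+1), c i ≤ κ a + κ (2*(s+j*h) + h - a))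
    (w : ℝ) :
    ∑ i ∈ Finset.range N, c i * Ji g (w - (s + i*h + h/2)) ≤ cv κ g w := by
  have mk := hκ.measurable
  have mg := hg.measurable
  have claim : ∀ n ≤ N, ∑ i ∈ Finset.range n, c i * Ji g (w - (s + i*h + h/2)) ≤
      (∫⁻ a in Ico s (s + n*h), κ a * g (w - a)) +
      (∑ i ∈ Finset.range n, c i) * Ji g (w - (s + n*h)) := by
    intro n
    induction n with
    | zero => intro _; simp
    | succ n ih =>
      intro hn
      have ih := ih (by omega)
      rw [Finset.sum_range_succ, Finset.sum_range_succ c]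
      have e1 : s + ((n+1 : ℕ) : ℝ)*h = s + n*h + h := by push_cast; ring
      have hnh : 0 ≤ n * h := by positivity
      have cl := cell_low hκ hg w (s+n*h) h hh (∑ i ∈ Finset.range n, c i) (c n)
        (H0 n (by omega)) (fun a h1 h2 => by
          have := H n (by omega) a h1 h2
          rwa [Finset.sum_range_succ] at this)
      rw [e1]
      calc _ ≤ ((∫⁻ a in Ico s (s + n*h), κ a * g (w - a)) +
          (∑ i ∈ Finset.range n, c i) * Ji g (w - (s + n*h))) +
            c n * Ji g (w - (s+n*h+h/2)) := by gcongr
        _ = (∫⁻ a in Ico s (s + n*h), κ a * g (w - a)) +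
          ((∑ i ∈ Finset.range n, c i) * Ji g (w - (s + n*h)) +
            c n * Ji g (w - (s+n*h+h/2))) := by rw [add_assoc]
        _ ≤ _ := add_le_add le_rfl cl
        _ = _ := by
          rw [sp_cc _ (show s ≤ s + n*h by linarith) (show s+n*h ≤ s+n*h+h by linarith),
            ← add_assoc]
  have hNh : 0 ≤ N * h := by positivity
  refine (claim N le_rfl).trans ?_
  calc _ ≤ (∫⁻ a in Ico s (s + N*h), κ a * g (w - a)) +
      ∫⁻ a in Ici (s + N*h), κ a * g (w - a) := by
        gcongr
        rw [← Ji_eq, ← lintegral_const_mul _ (by fun_prop)]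
        apply setLIntegral_mono (by fun_prop)
        intro a ha
        gcongr
        exact (H0 N le_rfl).trans (hκ ha)
    _ = ∫⁻ a in Ici s, κ a * g (w - a) := by
        rw [← sp_ci _ (by linarith)]
    _ ≤ _ := setLIntegral_le_lintegral _ _

end RegB
end

section
open MeasureTheory Set Filter Topology NumberField Polynomial
open scoped ENNReal
namespace RegB

lemma cv_symm (k g : ℝ → ℝ≥0∞) : cv k g = cv g k := by
  funext w
  rw [cv_comm, cv]
  simp_rw [mul_comm]

lemma cv_lcomm {k l g : ℝ → ℝ≥0∞} (hk : Measurable k) (hl : Measurable l) (hg : Measurable g) :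
    cv k (cv l g) = cv l (cv k g) := by
  funext w
  unfold cv
  have e1 : ∀ a, k a * ∫⁻ b, l b * g (w - a - b) = ∫⁻ b, k a * (l b * g (w - a - b)) :=
    fun a => (lintegral_const_mul _ (by fun_prop)).symm
  have e2 : ∀ b, l b * ∫⁻ a, k a * g (w - b - a) = ∫⁻ a, l b * (k a * g (w - b - a)) :=
    fun a => (lintegral_const_mul _ (by fun_prop)).symm
  simp_rw [e1, e2]
  rw [lintegral_lintegral_swap]
  · apply lintegral_congr; intro b; apply lintegral_congr; intro a
    rw [show w - a - b = w - b - a by ring]; ring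
  · apply Measurable.aemeasurable
    simp only [Function.uncurry_def]
    fun_prop

lemma cv_iter_lcomm {k l g : ℝ → ℝ≥0∞} (hk : Measurable k) (hl : Measurable l)
    (hg : Measurable g) (n : ℕ) : cv l ((cv k)^[n] g) = (cv k)^[n] (cv l g) := by
  induction n with
  | zero => rfl
  | succ n ih =>
    rw [Function.iterate_succ_apply', Function.iterate_succ_apply', ← ih,
      cv_lcomm hl hk (measurable_cv_iter hk hg n)]

lemma cv_monotone {k g : ℝ → ℝ≥0∞} (hg : Monotone g) : Monotone (cv k g) := by
  intro x y h
  unfold cv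
  gcongr
  exact hg (by linarith)

lemma cv_iter_monotone {k g : ℝ → ℝ≥0∞} (hg : Monotone g) (n : ℕ) : Monotone ((cv k)^[n] g) := by
  induction n with
  | zero => exact hg
  | succ n ih => rw [Function.iterate_succ_apply']; exact cv_monotone ih

/-- Heaviside -/
noncomputable def Hv (z : ℝ) : ℝ≥0∞ := (Ici (0:ℝ)).indicator 1 z

lemma Hv_mono : Monotone Hv := by
  intro x y h
  unfold Hv
  by_cases hx : 0 ≤ x
  · have hy : 0 ≤ y := hx.trans h
    simp [hx, hy]
  · simp [hx]

lemma cv_Hv (g : ℝ → ℝ≥0∞) : cv Hv g = Ji g := by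
  funext w
  have := Ji_eq g w 0
  rw [sub_zero] at this
  rw [← this, cv, ← lintegral_indicator measurableSet_Ici]
  apply lintegral_congr
  intro a
  unfold Hv
  by_cases h : 0 ≤ a <;> simp [indicator, h]

lemma kf_mono : Monotone kf := by
  intro x y h
  unfold kf
  gcongr

lemma ke_mono : Monotone ke := fun _ _ h => ENNReal.ofReal_le_ofReal (kf_mono h)
lemma k2e_mono : Monotone k2e := fun _ _ h => ENNReal.ofReal_le_ofReal (kf_mono (by linarith))

lemma cf_eq : cf = cv k2e ((cv ke)^[4] ke) := by
  rw [cv_iter_lcomm measurable_ke measurable_k2e measurable_ke, cv_symm k2e ke]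
  rfl

lemma Ji_G : Ji ((cv ke)^[4] ke) = (cv ke)^[5] Hv := by
  rw [← cv_Hv, cv_iter_lcomm measurable_ke Hv_mono.measurable measurable_ke, cv_symm Hv ke]
  rfl

noncomputable def ee (z : ℝ) : ℝ≥0∞ := ENNReal.ofReal (Real.exp z)
lemma measurable_ee : Measurable ee := by unfold ee; fun_prop
lemma ee_add (x y : ℝ) : ee (x + y) = ee x * ee y := by
  unfold ee; rw [Real.exp_add, ENNReal.ofReal_mul (Real.exp_pos _).le]

lemma hasDerivAt_kf (x : ℝ) : HasDerivAt kf (kf x * Real.exp (-x)) x := by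
  have : HasDerivAt kf (Real.exp (-Real.exp (-x)) * -(Real.exp (-x) * -1)) x :=
    ((hasDerivAt_neg x).exp.neg).exp
  exact this.congr_deriv (by unfold kf; ring)

lemma lint_ke : ∫⁻ a, ke a * ee (-a) ≤ 1 := by
  have hd : ∀ x ∈ (univ : Set ℝ), HasDerivWithinAt kf (kf x * Real.exp (-x)) univ x := by
    intro x _
    apply HasDerivAt.hasDerivWithinAt
    exact hasDerivAt_kf x
  have inj : InjOn kf univ := by
    intro x _ y _ h
    unfold kf at h
    have := Real.exp_injective h
    have := Real.exp_injective (neg_injective this)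
    linarith
  have := lintegral_image_eq_lintegral_abs_deriv_mul MeasurableSet.univ hd inj (fun _ => 1)
  have e : ∫⁻ a, ke a * ee (-a) =
      ∫⁻ x in univ, ENNReal.ofReal |kf x * Real.exp (-x)| * 1 := by
    rw [setLIntegral_univ]
    apply lintegral_congr
    intro a
    unfold ke ee
    rw [abs_of_pos (mul_pos (kf_pos a) (Real.exp_pos _)), ENNReal.ofReal_mul (kf_pos a).le, mul_one]
  rw [e, ← this, setLIntegral_one]
  have : kf '' univ ⊆ Icc 0 1 := by
    rintro _ ⟨x, _, rfl⟩
    refine ⟨(kf_pos x).le, ?_⟩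
    unfold kf
    rw [Real.exp_le_one_iff]
    linarith [Real.exp_pos (-x)]
  calc _ ≤ volume (Icc (0:ℝ) 1) := measure_mono this
    _ = 1 := by simp

lemma cv_le_ee {g : ℝ → ℝ≥0∞} (hg : ∀ z, g z ≤ ee z) (w : ℝ) : cv ke g w ≤ ee w := by
  have mk := measurable_ke
  have me := measurable_ee
  calc cv ke g w ≤ ∫⁻ a, ee w * (ke a * ee (-a)) := by
        unfold cv
        apply lintegral_mono
        intro a
        calc ke a * g (w - a) ≤ ke a * ee (w - a) := by gcongr; exact hg _
          _ = _ := by rw [sub_eq_add_neg, ee_add]; ring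
    _ = ee w * ∫⁻ a, ke a * ee (-a) := lintegral_const_mul _ (by fun_prop)
    _ ≤ ee w * 1 := by gcongr; exact lint_ke
    _ = _ := mul_one _

lemma iter_le_ee {g : ℝ → ℝ≥0∞} (hg : ∀ z, g z ≤ ee z) (n : ℕ) (w : ℝ) :
    (cv ke)^[n] g w ≤ ee w := by
  induction n generalizing w with
  | zero => exact hg w
  | succ n ih => rw [Function.iterate_succ_apply']; exact cv_le_ee ih w

lemma ke_le_ee (z : ℝ) : ke z ≤ ee z := by
  unfold ke ee kf
  apply ENNReal.ofReal_le_ofReal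
  rw [Real.exp_le_exp]
  linarith [Real.add_one_le_exp (-z)]

lemma Hv_le_ee (z : ℝ) : Hv z ≤ ee z := by
  unfold Hv ee
  by_cases h : 0 ≤ z
  · simp [h]
  · simp [h]

lemma Ji_ee : Ji ee = ee := by
  funext z
  unfold Ji ee
  rw [← ofReal_integral_eq_lintegral_ofReal (integrableOn_exp_Iic z)
    (Eventually.of_forall fun x => (Real.exp_pos x).le), integral_exp_Iic]

/-- shift operators attached to polynomials -/
noncomputable def Dp (s h : ℝ) (p : ℕ[X]) (g : ℝ → ℝ≥0∞) (w : ℝ) : ℝ≥0∞ :=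
  p.sum fun i c => (c : ℝ≥0∞) * g (w - (s + i * h))

lemma Dp_add (s h : ℝ) (p q : ℕ[X]) (g : ℝ → ℝ≥0∞) (w : ℝ) :
    Dp s h (p + q) g w = Dp s h p g w + Dp s h q g w := by
  unfold Dp
  apply Polynomial.sum_add_index
  · simp
  · intro a b c; push_cast; ring

lemma Dp_monomial (s h : ℝ) (n c : ℕ) (g : ℝ → ℝ≥0∞) (w : ℝ) :
    Dp s h (monomial n c) g w = c * g (w - (s + n * h)) := by
  unfold Dp
  apply Polynomial.sum_monomial_index
  simp

lemma Dp_mono (s h : ℝ) (p : ℕ[X]) {g g' : ℝ → ℝ≥0∞} (H : ∀ z, g z ≤ g' z) (w : ℝ) :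
    Dp s h p g w ≤ Dp s h p g' w := by
  unfold Dp Polynomial.sum
  apply Finset.sum_le_sum
  intro i _
  dsimp only
  gcongr
  exact H _

lemma Dp_lin (s h : ℝ) (p : ℕ[X]) (g g' : ℝ → ℝ≥0∞) (E : ℝ≥0∞) (w : ℝ) :
    Dp s h p (fun z => g z + E * g' z) w = Dp s h p g w + E * Dp s h p g' w := by
  unfold Dp Polynomial.sum
  rw [Finset.mul_sum, ← Finset.sum_add_distrib]
  apply Finset.sum_congr rfl
  intros; ring

lemma Dp_smul (s h : ℝ) (p : ℕ[X]) (g : ℝ → ℝ≥0∞) (E : ℝ≥0∞) (w : ℝ) :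
    Dp s h p (fun z => E * g z) w = E * Dp s h p g w := by
  unfold Dp Polynomial.sum
  rw [Finset.mul_sum]
  apply Finset.sum_congr rfl
  intros; ring

lemma Dp_mul (s t h : ℝ) (p q : ℕ[X]) (g : ℝ → ℝ≥0∞) (w : ℝ) :
    Dp s h p (Dp t h q g) w = Dp (s + t) h (p * q) g w := by
  induction p using Polynomial.induction_on' with
  | add p p' h1 h2 => rw [Dp_add, h1, h2, add_mul, Dp_add]
  | monomial n c =>
    rw [Dp_monomial]
    induction q using Polynomial.induction_on' with
    | add p p' h1 h2 => rw [Dp_add, mul_add, h1, h2, mul_add, Dp_add]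
    | monomial m d =>
      rw [monomial_mul_monomial, Dp_monomial, Dp_monomial]
      push_cast
      rw [mul_assoc]
      congr 3
      ring

lemma Dp_expand (s h : ℝ) (p : ℕ[X]) (g : ℝ → ℝ≥0∞) (w : ℝ) :
    Dp s (2 * h) p g w = Dp s h (expand ℕ 2 p) g w := by
  induction p using Polynomial.induction_on' with
  | add p p' h1 h2 => rw [Dp_add, h1, h2, map_add, Dp_add]
  | monomial n c =>
    rw [expand_monomial, Dp_monomial, Dp_monomial]
    push_cast
    congr 3
    ring

lemma Ji_lin {g g' : ℝ → ℝ≥0∞} (hg : Measurable g) (hg' : Measurable g') (E : ℝ≥0∞) (w : ℝ) :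
    Ji (fun z => g z + E * g' z) w = Ji g w + E * Ji g' w := by
  unfold Ji
  rw [lintegral_add_left hg, lintegral_const_mul _ hg']

lemma Ji_mono {g g' : ℝ → ℝ≥0∞} (H : ∀ z, g z ≤ g' z) (w : ℝ) : Ji g w ≤ Ji g' w := by
  unfold Ji
  gcongr
  exact H _

lemma measurable_Dp (s h : ℝ) (p : ℕ[X]) {g : ℝ → ℝ≥0∞} (hg : Measurable g) :
    Measurable (Dp s h p g) := by
  unfold Dp Polynomial.sum
  fun_prop

lemma Ji_Dp (s h : ℝ) (p : ℕ[X]) {g : ℝ → ℝ≥0∞} (hg : Measurable g) (w : ℝ) :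
    Ji (Dp s h p g) w = Dp s h p (Ji g) w := by
  unfold Dp Polynomial.sum
  conv_lhs => unfold Ji
  rw [lintegral_finsetSum _ (by intros; fun_prop)]
  apply Finset.sum_congr rfl
  intro i _
  rw [lintegral_const_mul _ (by fun_prop)]
  congr 1
  unfold Ji
  rw [← lintegral_indicator measurableSet_Iic, ← lintegral_indicator measurableSet_Iic,
    ← lintegral_sub_right_eq_self (fun a => indicator (Iic (w - (s + i*h))) g a) (s + i * h)]
  apply lintegral_congr
  intro a
  simp [indicator]

lemma measurable_Ji {g : ℝ → ℝ≥0∞} (hg : Measurable g) : Measurable (Ji g) := by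
  rw [← cv_Hv]; exact measurable_cv Hv_mono.measurable hg

lemma measurable_JH (n : ℕ) : Measurable (Ji^[n] Hv) := by
  induction n with
  | zero => exact Hv_mono.measurable
  | succ n ih => rw [Function.iterate_succ_apply']; exact measurable_Ji ih

theorem chain_up (T δ m : ℝ≥0∞) (p : ℕ[X]) (s h : ℝ)
    (HU : ∀ g, Monotone g → (∀ z, g z ≤ ee z) → ∀ w,
      T * cv ke g w ≤ Dp s h p (Ji g) w + T * δ * ee w)
    (HU2 : ∀ g, Monotone g → (∀ z, g z ≤ ee z) → ∀ w,
      T * cv k2e g w ≤ Dp (2*s) (2*h) p (Ji g) w + T * δ * ee w)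
    (Hm : ∀ w, Dp s h p ee w ≤ T * m * ee w)
    (Hm2 : ∀ w, Dp (2*s) (2*h) p ee w ≤ T * m^2 * ee w) (w : ℝ) :
    T^6 * cf w ≤ Dp (7*s) h (p^5 * expand ℕ 2 p) (Ji^[5] Hv) w +
      T^6 * (m^2 * ((1+m+m^2+m^3+m^4) * δ) + δ) * ee w := by
  have A : ∀ n : ℕ, ∀ w, T^n * (cv ke)^[n] Hv w ≤ Dp (n*s) h (p^n) (Ji^[n] Hv) w +
      (T^n * ((∑ i ∈ Finset.range n, m^i) * δ)) * ee w := by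
    intro n
    induction n with
    | zero => intro w; simp [← monomial_zero_one, Dp_monomial, - monomial_zero_left]
    | succ n ih =>
      intro w
      rw [Function.iterate_succ_apply', Function.iterate_succ_apply']
      set G := (cv ke)^[n] Hv
      have mG : Measurable G := measurable_cv_iter measurable_ke Hv_mono.measurable n
      set E := T^n * ((∑ i ∈ Finset.range n, m^i) * δ)
      have me := measurable_ee
      have mJ := measurable_JH n
      have mD := measurable_Dp (n*s) h (p^n) mJ
      have h1 := HU G (cv_iter_monotone Hv_mono n) (iter_le_ee Hv_le_ee n) w
      have h2 : ∀ z, T^n * Ji G z ≤ Dp (n*s) h (p^n) (Ji (Ji^[n] Hv)) z + E * ee z := by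
        intro z
        have e1 : T^n * Ji G z = Ji (fun y => T^n * G y) z := by
          unfold Ji; rw [lintegral_const_mul _ mG]
        rw [e1]
        refine (Ji_mono ih z).trans ?_
        rw [Ji_lin mD me, Ji_Dp _ _ _ mJ, Ji_ee]
      calc T^(n+1) * cv ke G w = T^n * (T * cv ke G w) := by ring
        _ ≤ T^n * (Dp s h p (Ji G) w + T * δ * ee w) := by gcongr
        _ = Dp s h p (fun z => T^n * Ji G z) w + T^(n+1) * δ * ee w := by
            rw [Dp_smul]; ring
        _ ≤ Dp s h p (fun z => Dp (n*s) h (p^n) (Ji (Ji^[n] Hv)) z + E * ee z) w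
            + T^(n+1) * δ * ee w := by gcongr; exact Dp_mono _ _ _ h2 w
        _ ≤ Dp s h p (Dp (n*s) h (p^n) (Ji (Ji^[n] Hv))) w + E * (T * m * ee w)
            + T^(n+1) * δ * ee w := by rw [Dp_lin]; gcongr; exact Hm w
        _ = _ := by
            rw [Dp_mul, ← pow_succ', Finset.sum_range_succ']
            simp only [pow_succ m, ← Finset.sum_mul, E, pow_zero]
            have : s + n * s = ((n+1 : ℕ) : ℝ) * s := by push_cast; ring
            rw [this]; ring
  have A5 := A 5
  rw [cf_eq]
  have h1 := HU2 ((cv ke)^[4] ke) (cv_iter_monotone ke_mono 4) (iter_le_ee ke_le_ee 4) w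
  rw [Ji_G] at h1
  set G := (cv ke)^[5] Hv
  set E := T^5 * ((∑ i ∈ Finset.range 5, m^i) * δ) with hE
  calc T^6 * cv k2e ((cv ke)^[4] ke) w = T^5 * (T * cv k2e ((cv ke)^[4] ke) w) := by ring
    _ ≤ T^5 * (Dp (2*s) (2*h) p G w + T * δ * ee w) := by gcongr
    _ = Dp (2*s) (2*h) p (fun z => T^5 * G z) w + T^6 * δ * ee w := by rw [Dp_smul]; ring
    _ ≤ Dp (2*s) (2*h) p (fun z => Dp ((5:ℕ)*s) h (p^5) (Ji^[5] Hv) z + E * ee z) w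
        + T^6 * δ * ee w := by gcongr; exact Dp_mono _ _ _ A5 w
    _ ≤ Dp (2*s) (2*h) p (Dp ((5:ℕ)*s) h (p^5) (Ji^[5] Hv)) w + E * (T * m^2 * ee w)
        + T^6 * δ * ee w := by rw [Dp_lin]; gcongr; exact Hm2 w
    _ = _ := by
      rw [Dp_expand, Dp_mul, mul_comm (expand ℕ 2 p)]
      have : 2*s + ((5:ℕ):ℝ)*s = 7 * s := by push_cast; ring
      rw [this, hE]
      simp only [Finset.sum_range_succ, Finset.sum_range_zero]
      ring

theorem chain_low (T : ℝ≥0∞) (p : ℕ[X]) (s s2 h : ℝ)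
    (HU : ∀ g, Monotone g → ∀ w, Dp s h p (Ji g) w ≤ T * cv ke g w)
    (HU2 : ∀ g, Monotone g → ∀ w, Dp s2 (2*h) p (Ji g) w ≤ T * cv k2e g w) (w : ℝ) :
    Dp (s2 + 5*s) h (p^5 * expand ℕ 2 p) (Ji^[5] Hv) w ≤ T^6 * cf w := by
  have A : ∀ n : ℕ, ∀ w, Dp (n*s) h (p^n) (Ji^[n] Hv) w ≤ T^n * (cv ke)^[n] Hv w := by
    intro n
    induction n with
    | zero => intro w; simp [← monomial_zero_one, Dp_monomial, - monomial_zero_left]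
    | succ n ih =>
      intro w
      rw [Function.iterate_succ_apply', Function.iterate_succ_apply']
      set G := (cv ke)^[n] Hv
      have mG : Measurable G := measurable_cv_iter measurable_ke Hv_mono.measurable n
      have mJ := measurable_JH n
      have h1 := HU G (cv_iter_monotone Hv_mono n) w
      have h2 : ∀ z, Dp (n*s) h (p^n) (Ji (Ji^[n] Hv)) z ≤ T^n * Ji G z := by
        intro z
        have e1 : T^n * Ji G z = Ji (fun y => T^n * G y) z := by
          unfold Ji; rw [lintegral_const_mul _ mG]
        rw [e1, ← Ji_Dp _ _ _ mJ]
        exact Ji_mono ih z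
      calc _ = Dp s h p (Dp (n*s) h (p^n) (Ji (Ji^[n] Hv))) w := by
            rw [Dp_mul, ← pow_succ']
            have : s + n * s = ((n+1 : ℕ) : ℝ) * s := by push_cast; ring
            rw [this]
        _ ≤ Dp s h p (fun z => T^n * Ji G z) w := Dp_mono _ _ _ h2 w
        _ = T^n * Dp s h p (Ji G) w := Dp_smul _ _ _ _ _ _
        _ ≤ T^n * (T * cv ke G w) := by gcongr
        _ = _ := by ring
  have A5 := A 5
  rw [cf_eq]
  have h1 := HU2 ((cv ke)^[4] ke) (cv_iter_monotone ke_mono 4) w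
  rw [Ji_G] at h1
  set G := (cv ke)^[5] Hv
  calc _ = Dp s2 (2*h) p (Dp ((5:ℕ)*s) h (p^5) (Ji^[5] Hv)) w := by
        rw [Dp_expand, Dp_mul, mul_comm (expand ℕ 2 p)]; push_cast; rfl
    _ ≤ Dp s2 (2*h) p (fun z => T^5 * G z) w := Dp_mono _ _ _ A5 w
    _ = T^5 * Dp s2 (2*h) p G w := Dp_smul _ _ _ _ _ _
    _ ≤ T^5 * (T * cv k2e ((cv ke)^[4] ke) w) := by gcongr
    _ = _ := by ring

end RegB
end

section
open MeasureTheory Set Filter Topology NumberField Polynomial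
open scoped ENNReal
namespace RegB

def thl : ℕ := 1270259160956978426042664240876631
def tl (r : ℕ) : ℕ := Nat.rec (2^110) (fun _ t => t * thl / 2^110) r
def th (r : ℕ) : ℕ := Nat.rec (2^110) (fun _ t => t * (thl + 1) / 2^110 + 1) r
def sl (x n : ℕ) : ℕ := Nat.rec x (fun _ t => t * t / 2^110) n
def sh (x n : ℕ) : ℕ := Nat.rec x (fun _ t => t * t / 2^110 + 1) n
def lo0 (r : ℕ) : ℕ := 2^110 - (th r / 2^44 + 1)
def hi0 (r : ℕ) : ℕ := 2^110 - tl r / 2^44 + (th r / 2^44 + 1) * (th r / 2^44 + 1) / 2^111 + 1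
def vl (i : ℕ) : ℕ := sl (lo0 (i % 32)) (51 - i / 32) / 2^70
def vh (i : ℕ) : ℕ := sh (hi0 (i % 32)) (51 - i / 32) / 2^70 + 1
/-- upper levels -/
def Uj (j : ℕ) : ℕ :=
  bif Nat.blt j 112 then (vh (2*j) + vh (2*j+2) + 1) / 2
  else bif Nat.blt j 368 then vh (2*j+1) else 2^40
def tj (j : ℕ) : ℕ :=
  bif Nat.blt j 112 then (vl (2*j) + vl (2*j+2) + 1) / 2 + 1 - vl (2*j+1) else 0
/-- lower levels -/
def Lj (j : ℕ) : ℕ := bif Nat.beq j 0 then 0 else vl (2*j) - Nat.max (tj (j-1)) (tj j)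
def cu (j : ℕ) : ℕ := Nat.rec (Uj 0) (fun i _ => Uj (i+1) - Uj i) j
def cl (j : ℕ) : ℕ := Lj (j+1) - Lj j
def allb (f : ℕ → Bool) (n : ℕ) : Bool := Nat.rec true (fun i b => f i && b) n
def bj (j : ℕ) : ℕ := bif Nat.blt j 112 then 2 * vl (2*j+1) else vl (2*j) + vl (2*j+2)
def chkL (j : ℕ) : Bool := Nat.ble (Lj j) (Lj (j+1)) && Nat.ble (Lj j + Lj (j+1)) (bj j)
def chkU (j : ℕ) : Bool := Nat.ble (Uj j) (Uj (j+1))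
theorem chkL_all : allb chkL 368 = true := by decide +kernel
theorem chkU_all : allb chkU 368 = true := by decide +kernel

lemma allb_spec {f : ℕ → Bool} {n : ℕ} (h : allb f n = true) : ∀ j < n, f j = true := by
  induction n with
  | zero => intro j hj; omega
  | succ n ih =>
    intro j hj
    have h' : (f n && allb f n) = true := h
    rw [Bool.and_eq_true] at h'
    rcases Nat.lt_succ_iff_lt_or_eq.1 hj with h1 | h1
    · exact ih h'.2 j h1
    · rw [h1]; exact h'.1

/-- half mesh -/
noncomputable def eta : ℝ := Real.log 2 / 32

lemma eta_pos : 0 < eta := div_pos (Real.log_pos (by norm_num)) (by norm_num)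

lemma exp_eta_pow : (Real.exp (-eta))^32 = 1/2 := by
  rw [← Real.exp_nat_mul]
  have : ((32:ℕ):ℝ) * -eta = -Real.log 2 := by unfold eta; push_cast; ring
  rw [this, Real.exp_neg, Real.exp_log (by norm_num)]; norm_num

lemma thl_le : (thl:ℝ) ≤ 2^110 * Real.exp (-eta) := by
  apply le_of_pow_le_pow_left₀ (n := 32) (by norm_num) (by positivity)
  rw [mul_pow, exp_eta_pow]
  unfold thl; norm_num

lemma le_thh : 2^110 * Real.exp (-eta) ≤ ((thl + 1 : ℕ):ℝ) := by
  apply le_of_pow_le_pow_left₀ (n := 32) (by norm_num) (by positivity)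
  rw [mul_pow, exp_eta_pow]
  unfold thl; norm_num

lemma div_lo (a b : ℕ) (_hb : 0 < b) : ((a / b : ℕ):ℝ) ≤ a / b := Nat.cast_div_le
lemma div_hi (a b : ℕ) (hb : 0 < b) : (a:ℝ) / b ≤ ((a / b + 1 : ℕ):ℝ) := by
  rw [div_le_iff₀ (by positivity)]
  have := (Nat.lt_div_mul_add hb (a := a)).le
  have h2 : a ≤ (a/b+1) * b := by rw [add_mul, one_mul]; exact this
  exact_mod_cast h2

lemma mul_lo {a b : ℕ} {x y : ℝ} (hx : (a:ℝ) ≤ 2^110 * x) (hy : (b:ℝ) ≤ 2^110 * y) :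
    ((a * b / 2^110 : ℕ):ℝ) ≤ 2^110 * (x * y) := by
  refine (div_lo _ _ (by positivity)).trans ?_
  simp only [Nat.cast_mul, Nat.cast_pow, Nat.cast_ofNat]
  rw [div_le_iff₀ (by positivity)]
  calc (a:ℝ) * b ≤ (2^110 * x) * (2^110 * y) := by
        apply mul_le_mul hx hy (by positivity) (le_trans (by positivity) hx)
    _ = _ := by ring

lemma mul_hi {a b : ℕ} {x y : ℝ} (y0 : 0 ≤ y) (hx : 2^110 * x ≤ a) (hy : 2^110 * y ≤ b) :
    2^110 * (x * y) ≤ ((a * b / 2^110 + 1 : ℕ):ℝ) := by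
  refine le_trans ?_ (div_hi _ _ (by positivity))
  simp only [Nat.cast_mul, Nat.cast_pow, Nat.cast_ofNat]
  rw [le_div_iff₀ (by positivity)]
  calc 2^110 * (x * y) * 2^110 = (2^110 * x) * (2^110 * y) := by ring
    _ ≤ (a:ℝ) * b := mul_le_mul hx hy (by positivity) (by positivity)

lemma tl_spec (r : ℕ) : (tl r : ℝ) ≤ 2^110 * Real.exp (-(r * eta)) := by
  induction r with
  | zero => simp [tl]; norm_num
  | succ r ih =>
    have e : -(((r+1:ℕ):ℝ) * eta) = -(r*eta) + -eta := by push_cast; ring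
    rw [e, Real.exp_add]
    exact mul_lo ih thl_le

lemma th_spec (r : ℕ) : 2^110 * Real.exp (-(r * eta)) ≤ (th r : ℝ) := by
  induction r with
  | zero => simp [th]; norm_num
  | succ r ih =>
    have e : -(((r+1:ℕ):ℝ) * eta) = -(r*eta) + -eta := by push_cast; ring
    rw [e, Real.exp_add]
    exact mul_hi (Real.exp_pos _).le ih le_thh

lemma exp44 (r : ℕ) : Real.exp (-(44 * Real.log 2 + r * eta)) = Real.exp (-(r*eta)) / 2^44 := by
  have : -(44 * Real.log 2 + r * eta) = -(r*eta) - Real.log (2^44) := by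
    rw [Real.log_pow]; push_cast; ring
  rw [this, Real.exp_sub, Real.exp_log (by positivity)]

lemma lo0_spec (r : ℕ) : (lo0 r : ℝ) ≤ 2^110 * kf (44 * Real.log 2 + r * eta) := by
  unfold kf
  rw [exp44]
  set X := Real.exp (-(r*eta)) / 2^44 with hX
  have h1 : 2^110 * X ≤ ((th r / 2^44 + 1 : ℕ) : ℝ) := by
    refine le_trans ?_ (div_hi _ _ (by positivity))
    simp only [Nat.cast_mul, Nat.cast_pow, Nat.cast_ofNat]
    rw [hX, mul_div_assoc']
    gcongr
    exact th_spec r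
  have h2 := Real.add_one_le_exp (-X)
  unfold lo0
  rcases le_total (2^110) (th r / 2^44 + 1) with h | h
  · rw [Nat.sub_eq_zero_of_le h]; push_cast; positivity
  · rw [Nat.cast_sub h]; push_cast at h1 ⊢; nlinarith

lemma hi0_spec (r : ℕ) : 2^110 * kf (44 * Real.log 2 + r * eta) ≤ (hi0 r : ℝ) := by
  unfold kf
  rw [exp44]
  set X := Real.exp (-(r*eta)) / 2^44 with hX
  have X0 : 0 ≤ X := by positivity
  have h1 : 2^110 * X ≤ ((th r / 2^44 + 1 : ℕ) : ℝ) := by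
    refine le_trans ?_ (div_hi _ _ (by positivity))
    simp only [Nat.cast_mul, Nat.cast_pow, Nat.cast_ofNat]
    rw [hX, mul_div_assoc']
    gcongr
    exact th_spec r
  have h0 : ((tl r / 2^44 : ℕ) : ℝ) ≤ 2^110 * X := by
    refine (div_lo _ _ (by positivity)).trans ?_
    simp only [Nat.cast_mul, Nat.cast_pow, Nat.cast_ofNat]
    rw [hX, mul_div_assoc']
    gcongr
    exact tl_spec r
  have hq : Real.exp (-X) ≤ 1 - X + X^2/2 := by
    have := Real.quadratic_le_exp_of_nonneg X0
    rw [Real.exp_neg, inv_le_iff_one_le_mul₀ (Real.exp_pos X)]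
    have p : 0 ≤ 1 - X + X^2/2 := by nlinarith [sq_nonneg (X-1)]
    nlinarith [mul_le_mul_of_nonneg_left this p, sq_nonneg (X^2)]
  set Y := th r / 2^44 + 1 with hY
  have h3 := div_hi (Y*Y) (2^111) (by positivity)
  have h4 : 2^110 * (X^2/2) ≤ ((Y*Y/2^111 + 1 : ℕ):ℝ) := by
    refine le_trans ?_ h3
    simp only [Nat.cast_mul, Nat.cast_pow, Nat.cast_ofNat]
    rw [le_div_iff₀ (by positivity)]
    calc 2^110 * (X^2/2) * 2^111 = (2^110*X) * (2^110 * X) := by ring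
      _ ≤ (Y:ℝ) * Y := by gcongr
  have h5 : (2:ℝ)^110 - ((tl r / 2^44 : ℕ):ℝ) ≤ ((2^110 - tl r / 2^44 : ℕ):ℝ) := by
    have : 2^110 ≤ (2^110 - tl r / 2^44) + tl r / 2^44 := by omega
    have : ((2^110 : ℕ):ℝ) ≤ (((2^110 - tl r / 2^44) + tl r / 2^44 : ℕ):ℝ) := by exact_mod_cast this
    rw [Nat.cast_add] at this
    rw [sub_le_iff_le_add]
    refine le_trans (by norm_num) this
  unfold hi0
  rw [← hY]
  calc 2^110 * Real.exp (-X) ≤ 2^110 * (1 - X + X^2/2) := by gcongr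
    _ = (2^110 - 2^110 * X) + 2^110 * (X^2/2) := by ring
    _ ≤ ((2^110 - tl r / 2^44 : ℕ):ℝ) + ((Y*Y/2^111 + 1 : ℕ):ℝ) :=
        add_le_add ((by linarith : (2:ℝ)^110 - 2^110 * X ≤ _).trans h5) h4
    _ = _ := by rw [add_assoc (2^110 - tl r / 2^44), ← Nat.cast_add]

lemma kf_sub_log (a : ℝ) : kf (a - Real.log 2) = kf a * kf a := by
  unfold kf
  rw [← Real.exp_add, neg_sub, sub_eq_add_neg, Real.exp_add, Real.exp_log (by norm_num)]
  congr 1; ring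

lemma sl_spec {x : ℕ} {a : ℝ} (h : (x:ℝ) ≤ 2^110 * kf a) (n : ℕ) :
    (sl x n : ℝ) ≤ 2^110 * kf (a - n * Real.log 2) := by
  induction n with
  | zero => simpa [sl] using h
  | succ n ih =>
    have e : a - ((n+1:ℕ):ℝ) * Real.log 2 = a - n * Real.log 2 - Real.log 2 := by push_cast; ring
    rw [e, kf_sub_log]
    exact mul_lo ih ih

lemma sh_spec {x : ℕ} {a : ℝ} (h : 2^110 * kf a ≤ (x:ℝ)) (n : ℕ) :
    2^110 * kf (a - n * Real.log 2) ≤ (sh x n : ℝ) := by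
  induction n with
  | zero => simpa [sh] using h
  | succ n ih =>
    have e : a - ((n+1:ℕ):ℝ) * Real.log 2 = a - n * Real.log 2 - Real.log 2 := by push_cast; ring
    rw [e, kf_sub_log]
    exact mul_hi (kf_pos _).le ih ih

lemma idx (i : ℕ) (hi : i ≤ 1600) :
    44 * Real.log 2 + (i % 32 : ℕ) * eta - (51 - i / 32 : ℕ) * Real.log 2 = (i - 224) * eta := by
  have h1 : i / 32 ≤ 51 := by omega
  have h2 : (i:ℝ) = 32 * (i/32 : ℕ) + (i % 32 : ℕ) := by exact_mod_cast (Nat.div_add_mod i 32).symm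
  rw [Nat.cast_sub h1]
  conv_rhs => rw [h2]
  unfold eta
  push_cast
  ring

lemma vl_spec (i : ℕ) (hi : i ≤ 1600) : (vl i : ℝ) ≤ 2^40 * kf ((i - 224) * eta) := by
  rw [← idx i hi]
  have := sl_spec (lo0_spec (i % 32)) (51 - i / 32)
  unfold vl
  refine (div_lo _ _ (by positivity)).trans ?_
  simp only [Nat.cast_mul, Nat.cast_pow, Nat.cast_ofNat]
  rw [div_le_iff₀ (by positivity)]
  refine this.trans (le_of_eq (by ring))

lemma vh_spec (i : ℕ) (hi : i ≤ 1600) : 2^40 * kf ((i - 224) * eta) ≤ (vh i : ℝ) := by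
  rw [← idx i hi]
  have := sh_spec (hi0_spec (i % 32)) (51 - i / 32)
  unfold vh
  refine le_trans ?_ (div_hi _ _ (by positivity))
  simp only [Nat.cast_mul, Nat.cast_pow, Nat.cast_ofNat]
  rw [le_div_iff₀ (by positivity)]
  refine le_trans (le_of_eq (by ring)) this

lemma deriv_kf : deriv kf = fun x => kf x * Real.exp (-x) := funext fun x => (hasDerivAt_kf x).deriv

lemma kf_convex : ConvexOn ℝ (Iic 0) kf := by
  apply MonotoneOn.convexOn_of_deriv (convex_Iic 0)
  · exact fun x _ => (hasDerivAt_kf x).continuousAt.continuousWithinAt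
  · exact fun x _ => (hasDerivAt_kf x).differentiableAt.differentiableWithinAt
  · rw [deriv_kf, interior_Iic]
    intro x hx y hy hxy
    have hy : y < 0 := hy
    simp only [kf, ← Real.exp_add]
    rw [Real.exp_le_exp]
    have e : Real.exp (-x) = Real.exp (-y) * Real.exp (y - x) := by rw [← Real.exp_add]; ring_nf
    have h1 := Real.add_one_le_exp (y - x)
    have h2 : 1 ≤ Real.exp (-y) := Real.one_le_exp (by linarith)
    nlinarith [mul_le_mul_of_nonneg_left h1 (Real.exp_pos (-y)).le]

lemma kf_concave : ConcaveOn ℝ (Ici 0) kf := by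
  apply AntitoneOn.concaveOn_of_deriv (convex_Ici 0)
  · exact fun x _ => (hasDerivAt_kf x).continuousAt.continuousWithinAt
  · exact fun x _ => (hasDerivAt_kf x).differentiableAt.differentiableWithinAt
  · rw [deriv_kf, interior_Ici]
    intro x hx y hy hxy
    have hx : 0 < x := hx
    simp only [kf, ← Real.exp_add]
    rw [Real.exp_le_exp]
    have e : Real.exp (-y) = Real.exp (-x) * Real.exp (x - y) := by rw [← Real.exp_add]; ring_nf
    have h1 := Real.add_one_le_exp (x - y)
    have h2 : Real.exp (-x) ≤ 1 := Real.exp_le_one_iff.2 (by linarith)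
    nlinarith [mul_le_mul_of_nonneg_left h1 (Real.exp_pos (-x)).le]

lemma conv_pair {f : ℝ → ℝ} {S : Set ℝ} (hf : ConvexOn ℝ S f) {x h a : ℝ} (hh : 0 < h)
    (hx : x ∈ S) (hy : x + h ∈ S) (h1 : x ≤ a) (h2 : a ≤ x + h/2) :
    f a + f (2*x + h - a) ≤ f x + f (x+h) ∧ 2 * f (x + h/2) ≤ f a + f (2*x+h-a) := by
  have t0 : 0 ≤ (a - x)/h := div_nonneg (by linarith) hh.le
  have t1 : (a - x)/h ≤ 1 := by rw [div_le_one hh]; linarith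
  set t := (a-x)/h with ht
  have ta : t * h = a - x := by rw [ht]; field_simp
  have ea : (1-t) • x + t • (x+h) = a := by simp only [smul_eq_mul]; linarith
  have eb : t • x + (1-t) • (x+h) = 2*x+h-a := by simp only [smul_eq_mul]; linarith
  have c1 := hf.2 hx hy (by linarith : 0 ≤ 1 - t) t0 (by ring)
  have c2 := hf.2 hx hy t0 (by linarith : 0 ≤ 1 - t) (by ring)
  rw [ea] at c1
  rw [eb] at c2
  have ma : a ∈ S := by rw [← ea]; exact hf.1 hx hy (by linarith) t0 (by ring)
  have mb : 2*x+h-a ∈ S := by rw [← eb]; exact hf.1 hx hy t0 (by linarith) (by ring)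
  have c3 := hf.2 ma mb (by norm_num : (0:ℝ) ≤ 1/2) (by norm_num : (0:ℝ) ≤ 1/2) (by norm_num)
  have ec : (1/2:ℝ) • a + (1/2:ℝ) • (2*x+h-a) = x + h/2 := by simp only [smul_eq_mul]; ring
  rw [ec] at c3
  simp only [smul_eq_mul] at c1 c2 c3
  constructor <;> linarith

/-- cell points -/
lemma cell_pts (j : ℕ) : (-(7 * Real.log 2) + j * (Real.log 2/16) = (((2*j : ℕ):ℝ) - 224) * eta) ∧
    (-(7 * Real.log 2) + j * (Real.log 2/16) + (Real.log 2/16)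
      = (((2*j+2 : ℕ):ℝ) - 224) * eta) ∧
    (-(7 * Real.log 2) + j * (Real.log 2/16) + (Real.log 2/16)/2
      = (((2*j+1 : ℕ):ℝ) - 224) * eta) := by
  unfold eta
  push_cast
  refine ⟨by ring, by ring, by ring⟩

lemma cell_bounds (j : ℕ) (hj : j < 368) (a : ℝ)
    (h1 : -(7 * Real.log 2) + j * (Real.log 2/16) ≤ a)
    (h2 : a ≤ -(7 * Real.log 2) + j * (Real.log 2/16) + (Real.log 2/16)/2) :
    2^40 * kf a + 2^40 * kf (2 * (-(7 * Real.log 2) + j * (Real.log 2/16)) + Real.log 2/16 - a)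
      ≤ 2 * (Uj j : ℝ) ∧
    (bj j : ℝ) ≤
    2^40 * kf a + 2^40 * kf (2 * (-(7 * Real.log 2) + j * (Real.log 2/16)) + Real.log 2/16 - a) := by
  obtain ⟨p0, p2, p1⟩ := cell_pts j
  set x := -(7 * Real.log 2) + j * (Real.log 2/16) with hx
  set h := Real.log 2/16 with hh
  have hpos : 0 < h := div_pos (Real.log_pos (by norm_num)) (by norm_num)
  have ep := eta_pos
  have l0 := vl_spec (2*j) (by omega)
  have l1 := vl_spec (2*j+1) (by omega)
  have l2 := vl_spec (2*j+2) (by omega)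
  have u0 := vh_spec (2*j) (by omega)
  have u1 := vh_spec (2*j+1) (by omega)
  have u2 := vh_spec (2*j+2) (by omega)
  rw [← p0] at l0 u0
  rw [← p1] at l1 u1
  rw [← p2] at l2 u2
  by_cases hc : j < 112
  · have hy : x + h ≤ 0 := by
      rw [p2]
      have : ((2*j+2:ℕ):ℝ) ≤ 224 := by exact_mod_cast (by omega : 2*j+2 ≤ 224)
      nlinarith
    obtain ⟨c1, c2⟩ := conv_pair kf_convex hpos (show x ∈ Iic 0 from (by linarith : x ≤ 0)) hy h1 h2
    have hb : Nat.blt j 112 = true := by rw [Nat.blt_eq]; exact hc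
    simp only [Uj, bj, hb, cond_true]
    constructor
    · have : vh (2*j) + vh (2*j+2) ≤ 2 * ((vh (2*j) + vh (2*j+2) + 1)/2) := by omega
      have : (vh (2*j) : ℝ) + vh (2*j+2) ≤ 2 * (((vh (2*j) + vh (2*j+2) + 1)/2 : ℕ):ℝ) := by
        exact_mod_cast this
      linarith
    · push_cast; linarith
  · have hy : 0 ≤ x := by
      rw [p0]
      have : (224:ℝ) ≤ ((2*j:ℕ):ℝ) := by exact_mod_cast (by omega : 224 ≤ 2*j)
      nlinarith
    obtain ⟨c1, c2⟩ := conv_pair kf_concave.neg hpos (show x ∈ Ici 0 from hy)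
      (show x + h ∈ Ici 0 from (by linarith : 0 ≤ x + h)) h1 h2
    simp only [Pi.neg_apply] at c1 c2
    have hb : Nat.blt j 112 = false := by
      rw [Bool.eq_false_iff]; intro h; rw [Nat.blt_eq] at h; exact hc h
    have hb' : Nat.blt j 368 = true := by rw [Nat.blt_eq]; exact hj
    simp only [Uj, bj, hb, hb', cond_true, cond_false]
    constructor
    · linarith
    · push_cast; linarith

lemma sum_cu (j : ℕ) : Uj j ≤ ∑ i ∈ Finset.range (j+1), cu i := by
  induction j with
  | zero => simp [cu]
  | succ j ih =>
    rw [Finset.sum_range_succ]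
    have : cu (j+1) = Uj (j+1) - Uj j := rfl
    omega

lemma sum_cu_eq (j : ℕ) (hj : j ≤ 368) : ∑ i ∈ Finset.range (j+1), cu i = Uj j := by
  induction j with
  | zero => simp [cu]
  | succ j ih =>
    rw [Finset.sum_range_succ, ih (by omega)]
    have : cu (j+1) = Uj (j+1) - Uj j := rfl
    have h2 := allb_spec chkU_all j (by omega)
    have h3 : Uj j ≤ Uj (j+1) := Nat.le_of_ble_eq_true h2
    omega

lemma Uj_last : Uj 368 = 2^40 := by decide +kernel

lemma chkL_spec (j : ℕ) (hj : j < 368) : Lj j ≤ Lj (j+1) ∧ Lj j + Lj (j+1) ≤ bj j := by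
  have h := allb_spec chkL_all j hj
  unfold chkL at h
  rw [Bool.and_eq_true] at h
  exact ⟨Nat.le_of_ble_eq_true h.1, Nat.le_of_ble_eq_true h.2⟩

lemma sum_cl (j : ℕ) (hj : j ≤ 368) : ∑ i ∈ Finset.range j, cl i = Lj j := by
  induction j with
  | zero => rfl
  | succ j ih =>
    rw [Finset.sum_range_succ, ih (by omega)]
    have := (chkL_spec j (by omega)).1
    unfold cl
    omega

lemma Lj_le (j : ℕ) : Lj j ≤ vl (2*j) := by
  unfold Lj
  cases h : Nat.beq j 0
  · simp only [cond_false]; exact Nat.sub_le _ _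
  · simp

end RegB
end

section
open MeasureTheory Set Filter Topology NumberField Polynomial
open scoped ENNReal
namespace RegB

noncomputable def PS (f : ℕ → ℕ) (N : ℕ) : ℕ[X] := ∑ i ∈ Finset.range N, monomial i (f i)

lemma PS_succ (f : ℕ → ℕ) (N : ℕ) : PS f (N+1) = PS f N + monomial N (f N) := Finset.sum_range_succ _ _

lemma Dp_PS (s h : ℝ) (f : ℕ → ℕ) (N : ℕ) (g : ℝ → ℝ≥0∞) (w : ℝ) :
    Dp s h (PS f N) g w = ∑ i ∈ Finset.range N, (f i : ℝ≥0∞) * g (w - (s + i * h)) := by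
  induction N with
  | zero => simp [PS, Dp]
  | succ N ih => rw [PS_succ, Dp_add, Dp_monomial, Finset.sum_range_succ, ih]

lemma eval_PS (f : ℕ → ℕ) (N B : ℕ) : (PS f N).eval B = ∑ i ∈ Finset.range N, f i * B^i := by
  simp [PS, eval_finsetSum]

lemma coeff_PS (f : ℕ → ℕ) (N m : ℕ) (hm : m < N) : (PS f N).coeff m = f m := by
  simp [PS, coeff_monomial, hm]

lemma eval_kron (B : ℕ) (n : ℕ) : ∀ p : ℕ[X], p.eval 1 < B → p.coeff n = p.eval B / B^n % B := by
  have dec : ∀ (p : ℕ[X]) (x : ℕ), p.eval x = x * (divX p).eval x + p.coeff 0 := by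
    intro p x
    conv_lhs => rw [← X_mul_divX_add p]
    simp
  induction n with
  | zero =>
    intro p hp
    have h1 := dec p 1
    rw [pow_zero, Nat.div_one, dec p B, Nat.mul_add_mod, Nat.mod_eq_of_lt (by omega)]
  | succ n ih =>
    intro p hp
    have h1 := dec p 1
    rw [← coeff_divX, ih (divX p) (by omega), dec p B, pow_succ', ← Nat.div_div_eq_div_mul,
      Nat.mul_add_div (by omega), Nat.div_eq_of_lt (by omega : p.coeff 0 < B), add_zero]

def Rb (f : ℕ → ℕ) (B k : ℕ) : ℕ → ℕ :=
  Nat.rec (fun a => f a) (fun k r a => r a + B^(2^k) * r (a + 2^k)) k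
lemma Rb_succ (f : ℕ → ℕ) (B k a : ℕ) :
    Rb f B (k+1) a = Rb f B k a + B^(2^k) * Rb f B k (a + 2^k) := rfl
lemma Rb_eq (f : ℕ → ℕ) (B k : ℕ) : ∀ a, Rb f B k a = ∑ i ∈ Finset.range (2^k), f (a+i) * B^i := by
  induction k with
  | zero => intro a; simp [Rb]
  | succ k ih =>
    intro a
    rw [Rb_succ, ih, ih, pow_succ, mul_two, Finset.sum_range_add, Finset.mul_sum]
    congr 1
    apply Finset.sum_congr rfl
    intro i _
    rw [pow_add, add_assoc]; ring

def cu' (j : ℕ) : ℕ := bif Nat.blt j 369 then cu j else 0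
def cl' (j : ℕ) : ℕ := bif Nat.blt j 368 then cl j else 0

lemma PS_trunc (f : ℕ → ℕ) (N M : ℕ) (h : N ≤ M) :
    PS (fun j => bif Nat.blt j N then f j else 0) M = PS f N := by
  unfold PS
  rw [← Finset.sum_subset (Finset.range_mono h)]
  · apply Finset.sum_congr rfl
    intro i hi
    have : Nat.blt i N = true := by rw [Nat.blt_eq]; exact Finset.mem_range.1 hi
    simp only [this, cond_true]
  · intro i _ hi
    have : Nat.blt i N = false := by
      rw [Bool.eq_false_iff]; intro h; rw [Nat.blt_eq] at h; exact hi (Finset.mem_range.2 h)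
    simp only [this, cond_false, monomial_zero_right]

lemma PS_cu : PS cu' 512 = PS cu 369 := PS_trunc cu 369 512 (by norm_num)
lemma PS_cl : PS cl' 512 = PS cl 368 := PS_trunc cl 368 512 (by norm_num)

lemma Rb_PS (f : ℕ → ℕ) (B k : ℕ) : Rb f B k 0 = (PS f (2^k)).eval B := by
  rw [Rb_eq, eval_PS]; simp

def gU (m : ℕ) : ℕ := m^5
def gL (m : ℕ) : ℕ := (2*m+1)^5
def zU : ℕ := (Rb cu' (2^336) 9 0)^5 * Rb cu' (2^672) 9 0 * Rb gU (2^336) 12 0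
def zL : ℕ := (Rb cl' (2^336) 9 0)^5 * Rb cl' (2^672) 9 0 * Rb gL (2^336) 12 0
def dig (z n : ℕ) : ℕ := z / 2^(336*n) % 2^336

lemma dig_gen (f G : ℕ → ℕ) (p : ℕ[X]) (hp : PS f 512 = p) (hs : p.eval 1 ≤ 2^40)
    (hG : ∀ m < 4096, G m ≤ 2^70) (n : ℕ) :
    (p^5 * expand ℕ 2 p * PS G 4096).coeff n =
      dig ((Rb f (2^336) 9 0)^5 * Rb f (2^672) 9 0 * Rb G (2^336) 12 0) n := by
  have e1 : (expand ℕ 2 p).eval 1 = p.eval 1 := by rw [expand_eval, one_pow]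
  have eG : (PS G 4096).eval 1 ≤ 2^82 := by
    rw [eval_PS]
    calc _ ≤ ∑ i ∈ Finset.range 4096, 2^70 := by
          apply Finset.sum_le_sum; intro i hi; rw [one_pow, mul_one]; exact hG i (Finset.mem_range.1 hi)
      _ = 2^82 := by rw [Finset.sum_const, Finset.card_range]; norm_num
  rw [eval_kron (2^336) n]
  · unfold dig
    rw [pow_mul, Rb_PS, Rb_PS, Rb_PS]
    simp only [eval_mul, eval_pow, expand_eval]
    rw [show (2^9:ℕ) = 512 by norm_num, show (2^12:ℕ) = 4096 by norm_num, hp, ← pow_mul]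
  · simp only [eval_mul, eval_pow, e1]
    calc (p.eval 1)^5 * p.eval 1 * (PS G 4096).eval 1 ≤ (2^40)^5 * 2^40 * 2^82 := by gcongr
      _ = 2^322 := by rw [← pow_mul, ← pow_add, ← pow_add]
      _ < 2^336 := Nat.pow_lt_pow_right (by norm_num) (by norm_num)

lemma sum_one (f : ℕ → ℕ) (N : ℕ) : (PS f N).eval 1 = ∑ i ∈ Finset.range N, f i := by
  rw [eval_PS]; simp

lemma sumU : (PS cu 369).eval 1 = 2^40 := by rw [sum_one, sum_cu_eq 368 le_rfl, Uj_last]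
lemma Lj_last : Lj 368 ≤ 2^40 := by decide +kernel
lemma sumL : (PS cl 368).eval 1 ≤ 2^40 := by rw [sum_one, sum_cl 368 le_rfl]; exact Lj_last

lemma digU (n : ℕ) : ((PS cu 369)^5 * expand ℕ 2 (PS cu 369) * PS gU 4096).coeff n = dig zU n := by
  refine dig_gen cu' gU _ PS_cu sumU.le ?_ n
  intro m hm
  calc m^5 ≤ 4096^5 := by gcongr
    _ ≤ _ := by norm_num
lemma digL (n : ℕ) : ((PS cl 368)^5 * expand ℕ 2 (PS cl 368) * PS gL 4096).coeff n = dig zL n := by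
  refine dig_gen cl' gL _ PS_cl sumL ?_ n
  intro m hm
  calc (2*m+1)^5 ≤ (2*4096+1)^5 := by gcongr
    _ ≤ _ := by norm_num

lemma JH (m : ℕ) (z : ℝ) : Ji^[m+1] Hv z = ENNReal.ofReal ((max z 0)^(m+1) / (m+1).factorial) := by
  induction m generalizing z with
  | zero =>
    have : Ji Hv z = volume (Icc 0 z) := by
      unfold Ji Hv
      rw [lintegral_indicator_one₀ (measurableSet_Ici.nullMeasurableSet), Measure.restrict_apply measurableSet_Ici]
      rfl
    simp [this]
  | succ m ih =>
    rw [Function.iterate_succ_apply']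
    have e : Ji (Ji^[m+1] Hv) z = ∫⁻ b in Iic z, ENNReal.ofReal ((max b 0)^(m+1) / (m+1).factorial) := by
      unfold Ji
      exact lintegral_congr fun b => ih b
    rw [e]
    have z0 : ∀ y ≤ (0:ℝ), ∫⁻ b in Iic y, ENNReal.ofReal ((max b 0)^(m+1) / (m+1).factorial) = 0 := by
      intro y hy
      rw [setLIntegral_congr_fun (g := fun _ => 0) measurableSet_Iic]
      · simp
      · intro b hb
        have : max b 0 = 0 := max_eq_right (le_trans hb hy)
        simp [this]
    rcases le_total z 0 with hz | hz
    · rw [z0 z hz, max_eq_right hz]; simp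
    · have hdj : Disjoint (Iic (0:ℝ)) (Ioc 0 z) :=
        Set.disjoint_left.2 fun a h1 h2 => absurd h2.1 (not_lt.2 h1)
      rw [← Iic_union_Ioc_eq_Iic hz, lintegral_union measurableSet_Ioc hdj, z0 0 le_rfl, zero_add,
        ← ofReal_integral_eq_lintegral_ofReal, ← intervalIntegral.integral_of_le hz]
      · congr 1
        rw [intervalIntegral.integral_congr (g := fun b => b^(m+1) / (m+1).factorial)]
        · rw [intervalIntegral.integral_div, integral_pow, max_eq_left hz, Nat.factorial_succ (m+1)]
          push_cast
          have : ((m+1).factorial : ℝ) ≠ 0 := by positivity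
          have : (m+1+1 : ℝ) ≠ 0 := by positivity
          field_simp
          ring
        · intro b hb
          rw [uIcc_of_le hz] at hb
          simp only [max_eq_left hb.1]
      · apply Continuous.integrableOn_Ioc; fun_prop
      · exact Eventually.of_forall fun b => by positivity

end RegB
end

section
open MeasureTheory Set Filter Topology NumberField Polynomial
open scoped ENNReal
namespace RegB

/-- scaled kernel -/
noncomputable def kk (l : ℝ) (a : ℝ) : ℝ≥0∞ := ENNReal.ofReal (2^40 * kf (a / l))

lemma kk_mono {l : ℝ} (hl : 0 < l) : Monotone (kk l) := fun _ _ h =>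
  ENNReal.ofReal_le_ofReal (mul_le_mul_of_nonneg_left (kf_mono (by gcongr)) (by positivity))

lemma kk_tail {l : ℝ} (hl : 1 ≤ l) (hl2 : l ≤ 2) (a : ℝ) (ha : a < l * (-(7 * Real.log 2))) :
    kk l a ≤ 2^40 * ENNReal.ofReal (1/2^151) * ee (2*a) := by
  unfold kk ee
  have t : (2:ℝ≥0∞)^40 = ENNReal.ofReal (2^40) := by
    rw [ENNReal.ofReal_pow (by norm_num)]; norm_num
  rw [t, ← ENNReal.ofReal_mul (by positivity), ← ENNReal.ofReal_mul (by positivity), mul_assoc]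
  apply ENNReal.ofReal_le_ofReal
  gcongr
  have hl0 : 0 < l := by linarith
  set b := a / l with hb
  have hab : a = l * b := by rw [hb]; field_simp
  have hb7 : b < -(7 * Real.log 2) := by
    rw [hab] at ha; exact lt_of_mul_lt_mul_left ha hl0.le
  have hl2' : 0 < Real.log 2 := Real.log_pos (by norm_num)
  have h1 : Real.exp (4*b) ≤ Real.exp (2*a) := by
    rw [Real.exp_le_exp, hab]; nlinarith
  refine le_trans ?_ (mul_le_mul_of_nonneg_left h1 (by positivity))
  unfold kf
  set X := Real.exp (-b) with hX
  have e4 : Real.exp (4*b) = (X^4)⁻¹ := by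
    rw [hX, ← Real.exp_nat_mul, ← Real.exp_neg]; congr 1; push_cast; ring
  have hX128 : 128 ≤ X := by
    have : Real.log 128 ≤ -b := by
      rw [show (128:ℝ) = 2^7 by norm_num, Real.log_pow]; push_cast; linarith
    rw [hX, ← Real.log_le_iff_le_exp (by norm_num)]; exact this
  have X0 : 0 < X := by linarith
  have h2 := Real.pow_div_factorial_le_exp X X0.le 128
  rw [e4, Real.exp_neg, one_div, ← mul_inv]
  apply inv_anti₀ (by positivity)
  refine le_trans ?_ h2
  rw [le_div_iff₀ (by positivity)]
  have f1 : (2:ℝ)^151 * (Nat.factorial 128 : ℝ) ≤ (128:ℝ)^124 := by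
    have : 2^151 * Nat.factorial 128 ≤ 128^124 := by decide +kernel
    exact_mod_cast this
  calc (2:ℝ)^151 * X^4 * (Nat.factorial 128 : ℝ) = X^4 * (2^151 * (Nat.factorial 128 : ℝ)) := by ring
    _ ≤ X^4 * 128^124 := by gcongr
    _ ≤ X^4 * X^124 := by gcongr
    _ = X^128 := by rw [← pow_add]

lemma hpos : 0 < Real.log 2/16 := div_pos (Real.log_pos (by norm_num)) (by norm_num)

lemma cast_ofReal (n : ℕ) : (n : ℝ≥0∞) = ENNReal.ofReal (n:ℝ) := (ENNReal.ofReal_natCast n).symm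

lemma kk_up {l : ℝ} (hl : 1 ≤ l) (hl2 : l ≤ 2) {g : ℝ → ℝ≥0∞} (hg : Monotone g)
    (hge : ∀ z, g z ≤ ee z) (w : ℝ) :
    cv (kk l) g w ≤ Dp (l * (-(7 * Real.log 2))) (l * (Real.log 2/16)) (PS cu 369) (Ji g) w +
      2^40 * ENNReal.ofReal (1/2^151) * ee w := by
  have hl0 : 0 < l := by linarith
  have hh := hpos
  have := op_up (kk_mono hl0) hg (l * (-(7 * Real.log 2))) (l * (Real.log 2/16)) (by positivity)
    (fun i => (cu i : ℝ≥0∞)) 368 ?_ ?_ w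
  · rw [Dp_PS]
    refine this.trans ?_
    gcongr
    calc ∫⁻ a in Iio (l * (-(7 * Real.log 2))), kk l a * g (w - a)
        ≤ ∫⁻ a in Iio (l * (-(7 * Real.log 2))),
            (2^40 * ENNReal.ofReal (1/2^151) * ee w) * ee a := by
          apply setLIntegral_mono (measurable_ee.const_mul _)
          intro a ha
          calc kk l a * g (w - a) ≤ (2^40 * ENNReal.ofReal (1/2^151) * ee (2*a)) * ee (w - a) := by
                gcongr
                · exact kk_tail hl hl2 a ha
                · exact hge _
            _ = 2^40 * ENNReal.ofReal (1/2^151) * (ee (2*a) * ee (w-a)) := by ring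
            _ = 2^40 * ENNReal.ofReal (1/2^151) * (ee w * ee a) := by
                rw [← ee_add, ← ee_add]; ring_nf
            _ = _ := by ring
      _ ≤ ∫⁻ a in Iic 0, (2^40 * ENNReal.ofReal (1/2^151) * ee w) * ee a := by
          apply lintegral_mono_set
          intro a ha
          have : a < l * (-(7 * Real.log 2)) := ha
          have : a ≤ 0 := by nlinarith
          exact this
      _ = (2^40 * ENNReal.ofReal (1/2^151) * ee w) * Ji ee 0 := by
          rw [lintegral_const_mul _ measurable_ee]; rfl
      _ = _ := by rw [Ji_ee]; simp [ee]
  · intro j hj a h1 h2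
    have c := (cell_bounds j hj (a/l) (by rw [le_div_iff₀ hl0]; linarith)
      (by rw [div_le_iff₀ hl0]; linarith)).1
    unfold kk
    rw [← Nat.cast_sum, sum_cu_eq j hj.le, ← ENNReal.ofReal_add (by have := kf_pos (a/l); positivity)
      (by have := kf_pos ((2 * (l * -(7 * Real.log 2) + j * (l * (Real.log 2 / 16))) + l * (Real.log 2 / 16) - a)/l); positivity)]
    rw [cast_ofReal, show (2:ℝ≥0∞) = ENNReal.ofReal 2 by norm_num, ← ENNReal.ofReal_mul (by norm_num)]
    apply ENNReal.ofReal_le_ofReal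
    refine le_trans (le_of_eq ?_) c
    congr 3
    field_simp
  · intro a
    unfold kk
    rw [← Nat.cast_sum, sum_cu_eq 368 le_rfl, Uj_last, cast_ofReal]
    apply ENNReal.ofReal_le_ofReal
    have : kf (a/l) ≤ 1 := by
      unfold kf; rw [Real.exp_le_one_iff]; linarith [Real.exp_pos (-(a/l))]
    push_cast
    linarith

lemma kk_low {l : ℝ} (hl0 : 0 < l) {g : ℝ → ℝ≥0∞} (hg : Monotone g) (w : ℝ) :
    Dp (l * (-(7 * Real.log 2) + Real.log 2/32)) (l * (Real.log 2/16)) (PS cl 368) (Ji g) w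
      ≤ cv (kk l) g w := by
  have hh := hpos
  have := op_low (kk_mono hl0) hg (l * (-(7 * Real.log 2))) (l * (Real.log 2/16)) (by positivity)
    (fun i => (cl i : ℝ≥0∞)) 368 ?_ ?_ w
  · rw [Dp_PS]
    refine le_trans (le_of_eq ?_) this
    apply Finset.sum_congr rfl
    intro i _
    congr 2
    ring
  · intro j hj
    rw [← Nat.cast_sum, sum_cl j hj, cast_ofReal]
    unfold kk
    apply ENNReal.ofReal_le_ofReal
    have h1 : (Lj j : ℝ) ≤ vl (2*j) := by exact_mod_cast Lj_le j
    refine h1.trans ((vl_spec (2*j) (by omega)).trans (le_of_eq ?_))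
    rw [← (cell_pts j).1]
    congr 2
    field_simp
  · intro j hj a h1 h2
    have c := (cell_bounds j hj (a/l) (by rw [le_div_iff₀ hl0]; linarith)
      (by rw [div_le_iff₀ hl0]; linarith)).2
    unfold kk
    rw [← Nat.cast_sum, ← Nat.cast_sum, sum_cl j hj.le, sum_cl (j+1) hj, ← Nat.cast_add,
      ← ENNReal.ofReal_add (by have := kf_pos (a/l); positivity)
      (by have := kf_pos ((2 * (l * -(7 * Real.log 2) + j * (l * (Real.log 2 / 16))) + l * (Real.log 2 / 16) - a)/l); positivity), cast_ofReal]
    apply ENNReal.ofReal_le_ofReal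
    have h3 : ((Lj j + Lj (j+1) : ℕ) : ℝ) ≤ bj j := by exact_mod_cast (chkL_spec j hj).2
    refine h3.trans (c.trans (le_of_eq ?_))
    congr 3
    field_simp

lemma cv_kk1 (g : ℝ → ℝ≥0∞) (w : ℝ) : cv (kk 1) g w = 2^40 * cv ke g w := by
  unfold cv kk ke
  rw [← lintegral_const_mul' _ _ (by norm_num)]
  apply lintegral_congr
  intro a
  rw [ENNReal.ofReal_mul (by positivity), ENNReal.ofReal_pow (by norm_num), div_one]
  norm_num
  ring

lemma cv_kk2 (g : ℝ → ℝ≥0∞) (w : ℝ) : cv (kk 2) g w = 2^40 * cv k2e g w := by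
  unfold cv kk k2e
  rw [← lintegral_const_mul' _ _ (by norm_num)]
  apply lintegral_congr
  intro a
  rw [ENNReal.ofReal_mul (by positivity), ENNReal.ofReal_pow (by norm_num)]
  norm_num
  ring

lemma Hm_gen (l : ℝ) (hl : 0 ≤ l) (w : ℝ) :
    Dp (l * (-(7 * Real.log 2))) (l * (Real.log 2/16)) (PS cu 369) ee w
      ≤ 2^40 * ee (l * (7 * Real.log 2)) * ee w := by
  have hh := hpos
  rw [Dp_PS]
  calc _ ≤ ∑ i ∈ Finset.range 369, (cu i : ℝ≥0∞) * (ee (l * (7 * Real.log 2)) * ee w) := by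
        gcongr with i
        rw [← ee_add]
        apply ENNReal.ofReal_le_ofReal
        apply Real.exp_le_exp.2
        have : 0 ≤ (i:ℝ) * (l * (Real.log 2/16)) := by positivity
        linarith
    _ = _ := by
        rw [← Finset.sum_mul, ← Nat.cast_sum, sum_cu_eq 368 le_rfl, Uj_last]
        push_cast
        ring

lemma ee7 : ee (7 * Real.log 2) = 128 := by
  unfold ee
  rw [show 7 * Real.log 2 = Real.log (2^7) by rw [Real.log_pow]; norm_num, Real.exp_log (by norm_num)]
  norm_num

lemma ee14 : ee (2 * (7 * Real.log 2)) = 128^2 := by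
  rw [two_mul, ee_add, ee7]; norm_num

theorem cf_up (w : ℝ) : (2^40)^6 * cf w ≤
    Dp (7*(-(7 * Real.log 2))) (Real.log 2/16) ((PS cu 369)^5 * expand ℕ 2 (PS cu 369)) (Ji^[5] Hv) w +
      (2^40)^6 * (128^2 * ((1+128+128^2+128^3+128^4) * ENNReal.ofReal (1/2^151)) + ENNReal.ofReal (1/2^151)) * ee w := by
  apply chain_up
  · intro g hg hge w
    have := kk_up (le_refl 1) (by norm_num) hg hge w
    rwa [cv_kk1, one_mul, one_mul] at this
  · intro g hg hge w
    have := kk_up (l := 2) (by norm_num) (by norm_num) hg hge w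
    rwa [cv_kk2] at this
  · intro w
    have := Hm_gen 1 (by norm_num) w
    rwa [one_mul, one_mul, one_mul, ee7] at this
  · intro w
    have := Hm_gen 2 (by norm_num) w
    rwa [ee14] at this

theorem cf_low (w : ℝ) :
    Dp (2*(-(7 * Real.log 2) + Real.log 2/32) + 5 * (-(7 * Real.log 2) + Real.log 2/32)) (Real.log 2/16)
      ((PS cl 368)^5 * expand ℕ 2 (PS cl 368)) (Ji^[5] Hv) w ≤ (2^40)^6 * cf w := by
  apply chain_low
  · intro g hg w
    have := kk_low one_pos hg w
    rwa [cv_kk1, one_mul, one_mul] at this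
  · intro g hg w
    have := kk_low two_pos hg w
    rwa [cv_kk2] at this

end RegB
end

section
open MeasureTheory Set Filter Topology NumberField Polynomial
open scoped ENNReal
namespace RegB

lemma Dp_range (s h : ℝ) (p : ℕ[X]) (g : ℝ → ℝ≥0∞) (w : ℝ) (N : ℕ) (hN : p.natDegree < N) :
    Dp s h p g w = ∑ i ∈ Finset.range N, (p.coeff i : ℝ≥0∞) * g (w - (s + i * h)) := by
  unfold Dp
  exact Polynomial.sum_over_range' p (by simp) N hN

lemma coeff_conv (p : ℕ[X]) (G : ℕ → ℕ) (n : ℕ) (hn : n < 4096) :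
    (p * PS G 4096).coeff n = ∑ i ∈ Finset.range (n+1), p.coeff i * G (n - i) := by
  rw [coeff_mul, Finset.Nat.sum_antidiagonal_eq_sum_range_succ (fun a b => p.coeff a * (PS G 4096).coeff b)]
  apply Finset.sum_congr rfl
  intro i _
  rw [coeff_PS _ _ _ (by omega)]

lemma Dp_up (p : ℕ[X]) (i : ℕ) (hn : i + 784 < 4096) :
    Dp (7*(-(7 * Real.log 2))) (Real.log 2/16) p (Ji^[5] Hv) (i * (Real.log 2/16))
      = ENNReal.ofReal ((Real.log 2/16)^5/120) * ((p * PS gU 4096).coeff (i+784) : ℕ) := by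
  have hh := hpos
  set h := Real.log 2/16 with hh'
  have hl : Real.log 2 = 16 * h := by rw [hh']; ring
  rw [coeff_conv p gU _ hn, Nat.cast_sum, Finset.mul_sum]
  set n := i + 784 with hn'
  rw [Dp_range _ _ p _ _ (n + 1 + (p.natDegree + 1)) (by omega), Finset.sum_range_add _ (n+1) (p.natDegree + 1)]
  have z : ∑ x ∈ Finset.range (p.natDegree + 1), (p.coeff (n+1+x) : ℝ≥0∞) *
      Ji^[5] Hv (i * h - (7*(-(7*Real.log 2)) + ((n+1+x : ℕ):ℝ) * h)) = 0 := by
    apply Finset.sum_eq_zero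
    intro x _
    rw [JH 4, max_eq_right]
    · simp
    · rw [hl, hn']; push_cast
      have : 0 ≤ (x:ℝ) * h := by positivity
      linarith
  rw [z, add_zero]
  apply Finset.sum_congr rfl
  intro j hj
  have hj : j ≤ n := Nat.lt_succ_iff.1 (Finset.mem_range.1 hj)
  have e : i * h - (7*(-(7*Real.log 2)) + (j:ℝ) * h) = ((n - j : ℕ):ℝ) * h := by
    rw [Nat.cast_sub hj, hl, hn']; push_cast; ring
  rw [e, JH 4, max_eq_left (by positivity), Nat.cast_mul, mul_left_comm]
  congr 1
  rw [cast_ofReal (gU _), ← ENNReal.ofReal_mul (by positivity)]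
  congr 1
  unfold gU
  rw [Nat.cast_pow]
  norm_num [Nat.factorial]
  ring

lemma Dp_dn (p : ℕ[X]) (i : ℕ) (hn : i + 780 < 4096) :
    ENNReal.ofReal ((Real.log 2/16)^5/3840) * ((p * PS gL 4096).coeff (i+780) : ℕ) ≤
    Dp (2*(-(7 * Real.log 2) + Real.log 2/32) + 5 * (-(7 * Real.log 2) + Real.log 2/32))
      (Real.log 2/16) p (Ji^[5] Hv) (i * (Real.log 2/16)) := by
  have hh := hpos
  set h := Real.log 2/16 with hh'
  have hl : Real.log 2 = 16 * h := by rw [hh']; ring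
  rw [coeff_conv p gL _ hn, Nat.cast_sum, Finset.mul_sum]
  set n := i + 780 with hn'
  rw [Dp_range _ _ p _ _ (n + 1 + (p.natDegree + 1)) (by omega), Finset.sum_range_add _ (n+1) (p.natDegree + 1)]
  refine le_trans (le_of_eq ?_) le_self_add
  apply Finset.sum_congr rfl
  intro j hj
  have hj : j ≤ n := Nat.lt_succ_iff.1 (Finset.mem_range.1 hj)
  have e : i * h - (2*(-(7 * Real.log 2) + Real.log 2/32) + 5 * (-(7 * Real.log 2) + Real.log 2/32) + (j:ℝ) * h)
      = (2*((n - j : ℕ):ℝ)+1) * (h/2) := by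
    rw [Nat.cast_sub hj, hl, hn']; push_cast; ring
  rw [e, JH 4, max_eq_left (by positivity), Nat.cast_mul, mul_left_comm]
  congr 1
  rw [cast_ofReal (gL _), ← ENNReal.ofReal_mul (by positivity)]
  congr 1
  unfold gL
  rw [Nat.cast_pow]
  push_cast
  norm_num [Nat.factorial]
  ring

lemma T6 : ((2:ℝ≥0∞)^40)^6 = ENNReal.ofReal (2^240) := by
  rw [ENNReal.ofReal_pow (by norm_num), ← pow_mul]; norm_num

lemma T6c (x : ℝ≥0∞) : ENNReal.ofReal (1/2^240) * (((2:ℝ≥0∞)^40)^6 * x) = x := by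
  rw [T6, ← mul_assoc, ← ENNReal.ofReal_mul (by positivity), one_div_mul_cancel (by positivity)]; simp

theorem cf_le (i k b : ℕ) (hi : i + 784 < 4096) (hk : i ≤ 16 * k) (hb : dig zU (i+784) ≤ b) :
    cf (i * (Real.log 2/16)) ≤
      ENNReal.ofReal (b * ((0.6931471808/16)^5/120) / 2^240 + 2^k/2^108) := by
  have h := cf_up (i * (Real.log 2/16))
  rw [Dp_up _ i hi, digU] at h
  generalize dig zU (i+784) = D at hb h
  have hh := hpos
  have h1 : ENNReal.ofReal ((Real.log 2/16)^5/120) * (D : ℕ) ≤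
      ENNReal.ofReal (b * ((0.6931471808/16)^5/120)) := by
    rw [cast_ofReal, ← ENNReal.ofReal_mul (by positivity), mul_comm]
    apply ENNReal.ofReal_le_ofReal
    have : (D : ℝ) ≤ b := by exact_mod_cast hb
    have := Real.log_two_lt_d9.le
    gcongr
  have h2 : (128^2 * ((1+128+128^2+128^3+128^4) * ENNReal.ofReal (1/2^151)) + ENNReal.ofReal (1/2^151))
      ≤ ENNReal.ofReal (1/2^108) := by
    have : (128^2 * ((1+128+128^2+128^3+128^4) * ENNReal.ofReal (1/2^151)) + ENNReal.ofReal (1/2^151))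
        = ENNReal.ofReal (128^2 * (1+128+128^2+128^3+128^4) + 1) * ENNReal.ofReal (1/2^151) := by
      norm_num
      ring
    rw [this, ← ENNReal.ofReal_mul (by positivity)]
    apply ENNReal.ofReal_le_ofReal
    rw [show (2:ℝ)^151 = 2^43 * 2^108 by rw [← pow_add], one_div, one_div, mul_inv, ← mul_assoc]
    apply mul_le_of_le_one_left (by positivity)
    norm_num
  have h3 : ee (i * (Real.log 2/16)) ≤ ENNReal.ofReal (2^k) := by
    apply ENNReal.ofReal_le_ofReal
    have : (i:ℝ) ≤ 16 * k := by exact_mod_cast hk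
    calc Real.exp (i * (Real.log 2/16)) ≤ Real.exp (Real.log (2^k)) := by
          apply Real.exp_le_exp.2
          rw [Real.log_pow]
          calc (i:ℝ) * (Real.log 2/16) ≤ 16 * k * (Real.log 2/16) := by gcongr
            _ = _ := by ring
      _ = _ := Real.exp_log (by positivity)
  have h4 : ((2:ℝ≥0∞)^40)^6 * cf (i * (Real.log 2/16)) ≤ ENNReal.ofReal (b * ((0.6931471808/16)^5/120)) +
      (2^40)^6 * ENNReal.ofReal (1/2^108) * ENNReal.ofReal (2^k) :=
    h.trans (add_le_add h1 (mul_le_mul' (mul_le_mul' le_rfl h2) h3))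
  rw [← T6c (cf _)]
  calc _ ≤ ENNReal.ofReal (1/2^240) * (ENNReal.ofReal (b * ((0.6931471808/16)^5/120)) +
      (2^40)^6 * ENNReal.ofReal (1/2^108) * ENNReal.ofReal (2^k)) := by gcongr
    _ = ENNReal.ofReal (1/2^240) * ENNReal.ofReal (b * ((0.6931471808/16)^5/120)) +
       ENNReal.ofReal (1/2^108) * ENNReal.ofReal (2^k) := by
      rw [mul_add, mul_assoc (((2:ℝ≥0∞)^40)^6), T6c]
    _ = _ := by
      rw [← ENNReal.ofReal_mul (by positivity), ← ENNReal.ofReal_mul (by positivity),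
        ← ENNReal.ofReal_add (by positivity) (by positivity)]
      congr 1
      ring

theorem cf_ge (i b : ℕ) (hi : i + 780 < 4096) (hb : b ≤ dig zL (i+780)) :
    ENNReal.ofReal (b * ((0.6931471803/16)^5/3840) / 2^240) ≤ cf (i * (Real.log 2/16)) := by
  have h := cf_low (i * (Real.log 2/16))
  have h' := (Dp_dn _ i hi).trans h
  rw [digL] at h'
  generalize dig zL (i+780) = D at hb h'
  have hh := hpos
  have h1 : ENNReal.ofReal (b * ((0.6931471803/16)^5/3840)) ≤
      ENNReal.ofReal ((Real.log 2/16)^5/3840) * (D : ℕ) := by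
    rw [cast_ofReal, ← ENNReal.ofReal_mul (by positivity),
      mul_comm _ ((D : ℕ) : ℝ)]
    apply ENNReal.ofReal_le_ofReal
    have : (b:ℝ) ≤ D := by exact_mod_cast hb
    have := Real.log_two_gt_d9.le
    gcongr
  rw [← T6c (cf _)]
  calc _ = ENNReal.ofReal (1/2^240) * ENNReal.ofReal (b * ((0.6931471803/16)^5/3840)) := by
        rw [← ENNReal.ofReal_mul (by positivity)]; congr 1; ring
    _ ≤ _ := by
      gcongr
      exact h1.trans h'

end RegB
end

section
open MeasureTheory Set Filter Topology NumberField Polynomial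
open scoped ENNReal
namespace RegB

theorem zU_chk : (Nat.ble (dig zU (118+784)) 31563544217320000000000000000000000000000000000000000000000000000000000000000000000 && Nat.ble (dig zU (119+784)) 32537983912350000000000000000000000000000000000000000000000000000000000000000000000 && Nat.ble (dig zU (121+784)) 34566192437190000000000000000000000000000000000000000000000000000000000000000000000 && Nat.ble (dig zU (144+784)) 67149116193810000000000000000000000000000000000000000000000000000000000000000000000 && Nat.ble (dig zU (145+784)) 69029851653630000000000000000000000000000000000000000000000000000000000000000000000 && Nat.ble (dig zU (169+784)) 130173402504900000000000000000000000000000000000000000000000000000000000000000000000 && Nat.ble (dig zU (224+784)) 464844629225200000000000000000000000000000000000000000000000000000000000000000000000 && Nat.ble (dig zU (594+784)) 72362150727290000000000000000000000000000000000000000000000000000000000000000000000000 && Nat.ble (dig zU (1476+784)) 9289540941815000000000000000000000000000000000000000000000000000000000000000000000000000) = true := by decide +kernel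
theorem zL_chk : (Nat.ble 1664909056683000000000000000000000000000000000000000000000000000000000000000000000000 (dig zL (135+780)) && Nat.ble 1762573907395000000000000000000000000000000000000000000000000000000000000000000000000 (dig zL (137+780)) && Nat.ble 1972975079772000000000000000000000000000000000000000000000000000000000000000000000000 (dig zL (141+780)) && Nat.ble 2144805568054000000000000000000000000000000000000000000000000000000000000000000000000 (dig zL (144+780)) && Nat.ble 3952680209149000000000000000000000000000000000000000000000000000000000000000000000000 (dig zL (167+780)) && Nat.ble 4054671788899000000000000000000000000000000000000000000000000000000000000000000000000 (dig zL (168+780)) && Nat.ble 7285689380465000000000000000000000000000000000000000000000000000000000000000000000000 (dig zL (192+780)) && Nat.ble 23763883421990000000000000000000000000000000000000000000000000000000000000000000000000 (dig zL (247+780)) && Nat.ble 2839879147879000000000000000000000000000000000000000000000000000000000000000000000000000 (dig zL (617+780)) && Nat.ble 322377986237400000000000000000000000000000000000000000000000000000000000000000000000000000 (dig zL (1499+780))) = true := by decide +kernel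
lemma cu118 : cf ((118:ℕ) * (Real.log 2/16)) ≤ ENNReal.ofReal 22.7160570527 := by
  have h := zU_chk
  simp only [Bool.and_eq_true] at h
  refine (cf_le 118 8 _ (by norm_num) (by norm_num) (Nat.le_of_ble_eq_true h.1.1.1.1.1.1.1.1)).trans ?_
  apply ENNReal.ofReal_le_ofReal
  norm_num

lemma cu119 : cf ((119:ℕ) * (Real.log 2/16)) ≤ ENNReal.ofReal 23.4173543327 := by
  have h := zU_chk
  simp only [Bool.and_eq_true] at h
  refine (cf_le 119 8 _ (by norm_num) (by norm_num) (Nat.le_of_ble_eq_true h.1.1.1.1.1.1.1.2)).trans ?_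
  apply ENNReal.ofReal_le_ofReal
  norm_num

lemma cu121 : cf ((121:ℕ) * (Real.log 2/16)) ≤ ENNReal.ofReal 24.8770415037 := by
  have h := zU_chk
  simp only [Bool.and_eq_true] at h
  refine (cf_le 121 8 _ (by norm_num) (by norm_num) (Nat.le_of_ble_eq_true h.1.1.1.1.1.1.2)).trans ?_
  apply ENNReal.ofReal_le_ofReal
  norm_num

lemma cu144 : cf ((144:ℕ) * (Real.log 2/16)) ≤ ENNReal.ofReal 48.3267387209 := by
  have h := zU_chk
  simp only [Bool.and_eq_true] at h
  refine (cf_le 144 9 _ (by norm_num) (by norm_num) (Nat.le_of_ble_eq_true h.1.1.1.1.1.2)).trans ?_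
  apply ENNReal.ofReal_le_ofReal
  norm_num

lemma cu145 : cf ((145:ℕ) * (Real.log 2/16)) ≤ ENNReal.ofReal 49.6802905816 := by
  have h := zU_chk
  simp only [Bool.and_eq_true] at h
  refine (cf_le 145 10 _ (by norm_num) (by norm_num) (Nat.le_of_ble_eq_true h.1.1.1.1.2)).trans ?_
  apply ENNReal.ofReal_le_ofReal
  norm_num

lemma cu169 : cf ((169:ℕ) * (Real.log 2/16)) ≤ ENNReal.ofReal 93.6848668730 := by
  have h := zU_chk
  simp only [Bool.and_eq_true] at h
  refine (cf_le 169 11 _ (by norm_num) (by norm_num) (Nat.le_of_ble_eq_true h.1.1.1.2)).trans ?_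
  apply ENNReal.ofReal_le_ofReal
  norm_num

lemma cu224 : cf ((224:ℕ) * (Real.log 2/16)) ≤ ENNReal.ofReal 334.5453554074 := by
  have h := zU_chk
  simp only [Bool.and_eq_true] at h
  refine (cf_le 224 14 _ (by norm_num) (by norm_num) (Nat.le_of_ble_eq_true h.1.1.2)).trans ?_
  apply ENNReal.ofReal_le_ofReal
  norm_num

lemma cu594 : cf ((594:ℕ) * (Real.log 2/16)) ≤ ENNReal.ofReal 52078.5223945784 := by
  have h := zU_chk
  simp only [Bool.and_eq_true] at h
  refine (cf_le 594 38 _ (by norm_num) (by norm_num) (Nat.le_of_ble_eq_true h.1.2)).trans ?_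
  apply ENNReal.ofReal_le_ofReal
  norm_num

lemma cu1476 : cf ((1476:ℕ) * (Real.log 2/16)) ≤ ENNReal.ofReal 6685616.1835088004 := by
  have h := zU_chk
  simp only [Bool.and_eq_true] at h
  refine (cf_le 1476 93 _ (by norm_num) (by norm_num) (Nat.le_of_ble_eq_true h.2)).trans ?_
  apply ENNReal.ofReal_le_ofReal
  norm_num

lemma cl135 : ENNReal.ofReal 37.4444730468 ≤ cf ((135:ℕ) * (Real.log 2/16)) := by
  have h := zL_chk
  simp only [Bool.and_eq_true] at h
  refine le_trans ?_ (cf_ge 135 _ (by norm_num) (Nat.le_of_ble_eq_true h.1.1.1.1.1.1.1.1.1))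
  apply ENNReal.ofReal_le_ofReal
  norm_num

lemma cl137 : ENNReal.ofReal 39.6409947460 ≤ cf ((137:ℕ) * (Real.log 2/16)) := by
  have h := zL_chk
  simp only [Bool.and_eq_true] at h
  refine le_trans ?_ (cf_ge 137 _ (by norm_num) (Nat.le_of_ble_eq_true h.1.1.1.1.1.1.1.1.2))
  apply ENNReal.ofReal_le_ofReal
  norm_num

lemma cl141 : ENNReal.ofReal 44.3730015763 ≤ cf ((141:ℕ) * (Real.log 2/16)) := by
  have h := zL_chk
  simp only [Bool.and_eq_true] at h
  refine le_trans ?_ (cf_ge 141 _ (by norm_num) (Nat.le_of_ble_eq_true h.1.1.1.1.1.1.1.2))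
  apply ENNReal.ofReal_le_ofReal
  norm_num

lemma cl144 : ENNReal.ofReal 48.2375382375 ≤ cf ((144:ℕ) * (Real.log 2/16)) := by
  have h := zL_chk
  simp only [Bool.and_eq_true] at h
  refine le_trans ?_ (cf_ge 144 _ (by norm_num) (Nat.le_of_ble_eq_true h.1.1.1.1.1.1.2))
  apply ENNReal.ofReal_le_ofReal
  norm_num

lemma cl167 : ENNReal.ofReal 88.8973646700 ≤ cf ((167:ℕ) * (Real.log 2/16)) := by
  have h := zL_chk
  simp only [Bool.and_eq_true] at h
  refine le_trans ?_ (cf_ge 167 _ (by norm_num) (Nat.le_of_ble_eq_true h.1.1.1.1.1.2))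
  apply ENNReal.ofReal_le_ofReal
  norm_num

lemma cl168 : ENNReal.ofReal 91.1911962421 ≤ cf ((168:ℕ) * (Real.log 2/16)) := by
  have h := zL_chk
  simp only [Bool.and_eq_true] at h
  refine le_trans ?_ (cf_ge 168 _ (by norm_num) (Nat.le_of_ble_eq_true h.1.1.1.1.2))
  apply ENNReal.ofReal_le_ofReal
  norm_num

lemma cl192 : ENNReal.ofReal 163.8580789380 ≤ cf ((192:ℕ) * (Real.log 2/16)) := by
  have h := zL_chk
  simp only [Bool.and_eq_true] at h
  refine le_trans ?_ (cf_ge 192 _ (by norm_num) (Nat.le_of_ble_eq_true h.1.1.1.2))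
  apply ENNReal.ofReal_le_ofReal
  norm_num

lemma cl247 : ENNReal.ofReal 534.4592779477 ≤ cf ((247:ℕ) * (Real.log 2/16)) := by
  have h := zL_chk
  simp only [Bool.and_eq_true] at h
  refine le_trans ?_ (cf_ge 247 _ (by norm_num) (Nat.le_of_ble_eq_true h.1.1.2))
  apply ENNReal.ofReal_le_ofReal
  norm_num

lemma cl617 : ENNReal.ofReal 63870.0220785413 ≤ cf ((617:ℕ) * (Real.log 2/16)) := by
  have h := zL_chk
  simp only [Bool.and_eq_true] at h
  refine le_trans ?_ (cf_ge 617 _ (by norm_num) (Nat.le_of_ble_eq_true h.1.2))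
  apply ENNReal.ofReal_le_ofReal
  norm_num

lemma cl1499 : ENNReal.ofReal 7250410.3260860766 ≤ cf ((1499:ℕ) * (Real.log 2/16)) := by
  have h := zL_chk
  simp only [Bool.and_eq_true] at h
  refine le_trans ?_ (cf_ge 1499 _ (by norm_num) (Nat.le_of_ble_eq_true h.2))
  apply ENNReal.ofReal_le_ofReal
  norm_num

lemma exp_lo (d : ℕ) (el : ℝ) (h0 : 0 ≤ el) (h : el^32 ≤ (1/2)^d) :
    el ≤ Real.exp (-(d * (Real.log 2/16))/2) := by
  apply le_of_pow_le_pow_left₀ (n := 32) (by norm_num) (Real.exp_pos _).le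
  rw [← Real.exp_nat_mul]
  have : ((32:ℕ):ℝ) * (-(d * (Real.log 2/16))/2) = Real.log ((1/2)^d) := by
    rw [Real.log_pow, one_div, Real.log_inv]; push_cast; ring
  rw [this, Real.exp_log (by positivity)]
  exact h

lemma exp_hi (A q : ℕ) (eu : ℝ) (h0 : 0 ≤ eu) (h : 2^(2*q) ≤ eu^64 * 2^A) :
    Real.exp (-(A * (Real.log 2/16)/2 - q * (Real.log 2/16))/2) ≤ eu := by
  apply le_of_pow_le_pow_left₀ (n := 64) (by norm_num) h0
  rw [← Real.exp_nat_mul]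
  have : ((64:ℕ):ℝ) * (-(A * (Real.log 2/16)/2 - q * (Real.log 2/16))/2) =
      Real.log (2^(2*q) / 2^A) := by
    rw [Real.log_div (by positivity) (by positivity), Real.log_pow, Real.log_pow]; push_cast; ring
  rw [this, Real.exp_log (by positivity), div_le_iff₀ (by positivity)]
  exact h

lemma exp_hi0 (ua : ℝ) (hua : ua = Real.log 3030000 - Real.log (4 * Real.pi^7)) (eu : ℝ) (h0 : 0 ≤ eu)
    (h : 2^119 * (4 * 3.141593^7/3030000 : ℝ)^16 ≤ eu^32) :
    Real.exp (-(ua - (119:ℕ) * (Real.log 2/16))/2) ≤ eu := by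
  have hpi := Real.pi_pos
  apply le_of_pow_le_pow_left₀ (n := 32) (by norm_num) h0
  rw [← Real.exp_nat_mul]
  have : ((32:ℕ):ℝ) * (-(ua - (119:ℕ) * (Real.log 2/16))/2) =
      Real.log (2^119 * (4 * Real.pi^7/3030000)^16) := by
    rw [Real.log_mul (by positivity) (by positivity), Real.log_pow, Real.log_pow,
      Real.log_div (by positivity) (by positivity), hua]; push_cast; ring
  rw [this, Real.exp_log (by positivity)]
  refine le_trans ?_ h
  have := Real.pi_lt_d6.le
  gcongr

set_option exponentiation.threshold 1000 in
theorem final {K : Type*} [Field K] [NumberField K] (P : PD K) (hdeg : Module.finrank ℚ K = 7)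
    (hreg : Units.regulator K ≤ 3.2) (hD : 3030000 ≤ |((discr K : ℤ) : ℝ)|) : False := by
  obtain ⟨u, hu⟩ : ∃ u, u = Real.log |((discr K : ℤ) : ℝ)| - Real.log (4 * Real.pi^7) := ⟨_, rfl⟩
  obtain ⟨ua, hua⟩ : ∃ ua, ua = Real.log 3030000 - Real.log (4 * Real.pi^7) := ⟨_, rfl⟩
  have hh := hpos
  have hl1 := Real.log_two_gt_d9
  have hl2 := Real.log_two_lt_d9
  have hpi := Real.pi_pos
  have u0 : ua ≤ u := by
    rw [hu, hua]
    have := Real.log_le_log (by norm_num) hD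
    linarith
  have ue : u ≤ (1723:ℕ) * (Real.log 2/16)/2 := by
    have h1 := Real.log_le_log (by linarith) (P.log_discr_le hdeg hreg)
    rw [Real.log_mul (by positivity) (by positivity), Real.log_exp] at h1
    have h2 : Real.log (7^7) - Real.log (4 * Real.pi^7) ≤ 6.1 * Real.log 2 := by
      rw [← Real.log_div (by positivity) (by positivity)]
      have h3 : Real.log (((7:ℝ)^7 / (4 * Real.pi^7))^10) ≤ Real.log (2^61) := by
        apply Real.log_le_log (by positivity)
        have : (7:ℝ)^7 / (4 * Real.pi^7) ≤ (7:ℝ)^7 / (4 * 3.1415^7) := by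
          have := Real.pi_gt_d4.le
          gcongr
        calc ((7:ℝ)^7 / (4 * Real.pi^7))^10 ≤ ((7:ℝ)^7 / (4 * 3.1415^7))^10 := by gcongr
          _ ≤ _ := by norm_num
      rw [Real.log_pow, Real.log_pow] at h3
      push_cast at h3
      linarith
    push_cast
    linarith
  rcases le_or_gt u ((256:ℕ) * (Real.log 2/16)/2) with c1 | c1
  · exact MI P hdeg hreg u hu ua ((256:ℕ) * (Real.log 2/16)/2) ((119:ℕ) * (Real.log 2/16))
      ((16:ℕ) * (Real.log 2/16)) ((121:ℕ) * (Real.log 2/16)) 1.5934770515 0.7071067811 0.8313591860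
      23.4173543327 37.4444730468 24.8770415037 39.6409947460 u0 c1 (by positivity) (by push_cast; linarith) (by norm_num)
      (exp_lo 16 _ (by norm_num) (by norm_num)) (exp_hi0 ua hua _ (by norm_num) (by norm_num))
      cu119 (by have := cl135; rwa [show ((135:ℕ):ℝ) * (Real.log 2/16) = (119:ℕ) * (Real.log 2/16) + (16:ℕ) * (Real.log 2/16) by push_cast; ring] at this)
      cu121 (by have := cl137; rwa [show ((137:ℕ):ℝ) * (Real.log 2/16) = (121:ℕ) * (Real.log 2/16) + (16:ℕ) * (Real.log 2/16) by push_cast; ring] at this)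
      (by norm_num) (by norm_num) (by norm_num) (by norm_num) (by norm_num) (by norm_num) (by norm_num)
  rcases le_or_gt u ((262:ℕ) * (Real.log 2/16)/2) with c2 | c2
  · exact MI P hdeg hreg u hu ((256:ℕ) * (Real.log 2/16)/2) ((262:ℕ) * (Real.log 2/16)/2) ((121:ℕ) * (Real.log 2/16))
      ((23:ℕ) * (Real.log 2/16)) ((118:ℕ) * (Real.log 2/16)) 1.9533760402 0.6076236799 0.8593096491
      24.8770415037 48.2375382375 22.7160570527 44.3730015763 c1.le c2 (by positivity) (by push_cast; linarith) (by norm_num)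
      (exp_lo 23 _ (by norm_num) (by norm_num)) (exp_hi 256 121 _ (by norm_num) (by norm_num))
      cu121 (by have := cl144; rwa [show ((144:ℕ):ℝ) * (Real.log 2/16) = (121:ℕ) * (Real.log 2/16) + (23:ℕ) * (Real.log 2/16) by push_cast; ring] at this)
      cu118 (by have := cl141; rwa [show ((141:ℕ):ℝ) * (Real.log 2/16) = (118:ℕ) * (Real.log 2/16) + (23:ℕ) * (Real.log 2/16) by push_cast; ring] at this)
      (by norm_num) (by norm_num) (by norm_num) (by norm_num) (by norm_num) (by norm_num) (by norm_num)
  rcases le_or_gt u ((312:ℕ) * (Real.log 2/16)/2) with c3 | c3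
  · exact MI P hdeg hreg u hu ((262:ℕ) * (Real.log 2/16)/2) ((312:ℕ) * (Real.log 2/16)/2) ((144:ℕ) * (Real.log 2/16))
      ((23:ℕ) * (Real.log 2/16)) ((145:ℕ) * (Real.log 2/16)) 1.8355608466 0.6076236799 1.3252366432
      48.3267387209 88.8973646700 49.6802905816 91.1911962421 c2.le c3 (by positivity) (by push_cast; linarith) (by norm_num)
      (exp_lo 23 _ (by norm_num) (by norm_num)) (exp_hi 262 144 _ (by norm_num) (by norm_num))
      cu144 (by have := cl167; rwa [show ((167:ℕ):ℝ) * (Real.log 2/16) = (144:ℕ) * (Real.log 2/16) + (23:ℕ) * (Real.log 2/16) by push_cast; ring] at this)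
      cu145 (by have := cl168; rwa [show ((168:ℕ):ℝ) * (Real.log 2/16) = (145:ℕ) * (Real.log 2/16) + (23:ℕ) * (Real.log 2/16) by push_cast; ring] at this)
      (by norm_num) (by norm_num) (by norm_num) (by norm_num) (by norm_num) (by norm_num) (by norm_num)
  rcases le_or_gt u ((786:ℕ) * (Real.log 2/16)/2) with c4 | c4
  · exact MI P hdeg hreg u hu ((312:ℕ) * (Real.log 2/16)/2) ((786:ℕ) * (Real.log 2/16)/2) ((169:ℕ) * (Real.log 2/16))
      ((23:ℕ) * (Real.log 2/16)) ((594:ℕ) * (Real.log 2/16)) 1.2264177081 0.6076236799 1.3252366432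
      93.6848668730 163.8580789380 52078.5223945784 63870.0220785413 c3.le c4 (by positivity) (by push_cast; linarith) (by norm_num)
      (exp_lo 23 _ (by norm_num) (by norm_num)) (exp_hi 312 169 _ (by norm_num) (by norm_num))
      cu169 (by have := cl192; rwa [show ((192:ℕ):ℝ) * (Real.log 2/16) = (169:ℕ) * (Real.log 2/16) + (23:ℕ) * (Real.log 2/16) by push_cast; ring] at this)
      cu594 (by have := cl617; rwa [show ((617:ℕ):ℝ) * (Real.log 2/16) = (594:ℕ) * (Real.log 2/16) + (23:ℕ) * (Real.log 2/16) by push_cast; ring] at this)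
      (by norm_num) (by norm_num) (by norm_num) (by norm_num) (by norm_num) (by norm_num) (by norm_num)
  exact MI P hdeg hreg u hu ((786:ℕ) * (Real.log 2/16)/2) ((1723:ℕ) * (Real.log 2/16)/2) ((224:ℕ) * (Real.log 2/16))
      ((23:ℕ) * (Real.log 2/16)) ((1476:ℕ) * (Real.log 2/16)) 1.0844789959 0.6076236799 0.0257149294
      334.5453554074 534.4592779477 6685616.1835088004 7250410.3260860766 c4.le ue (by positivity) (by push_cast; linarith) (by norm_num)
      (exp_lo 23 _ (by norm_num) (by norm_num)) (exp_hi 786 224 _ (by norm_num) (by norm_num))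
      cu224 (by have := cl247; rwa [show ((247:ℕ):ℝ) * (Real.log 2/16) = (224:ℕ) * (Real.log 2/16) + (23:ℕ) * (Real.log 2/16) by push_cast; ring] at this)
      cu1476 (by have := cl1499; rwa [show ((1499:ℕ):ℝ) * (Real.log 2/16) = (1476:ℕ) * (Real.log 2/16) + (23:ℕ) * (Real.log 2/16) by push_cast; ring] at this)
      (by norm_num) (by norm_num) (by norm_num) (by norm_num) (by norm_num) (by norm_num) (by norm_num)
end RegB
end

open NumberField

theorem abs_discr_lt_of_regulator_le
    (K : Type*) [Field K] [NumberField K]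
    (hdeg : Module.finrank ℚ K = 7)
    (hreal : InfinitePlace.nrRealPlaces K = 5)
    (hreg : NumberField.Units.regulator K ≤ 3.2) :
    |NumberField.discr K| < 3030000 := by
  obtain ⟨P⟩ := RegB.exists_PD K hdeg hreal
  by_contra hc
  rw [not_lt] at hc
  exact RegB.final P hdeg hreg (by exact_mod_cast hc)
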